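/- arXiv:2512.07751 — 4 statements merged into one kernel-verified Lean document; each statement's English description precedes it below -/
import Mathlib

section
/- Let k ≥ 3 and ℓ ∈ [k−1] with (k,ℓ) ≠ (3,1), and set t = ⌊k/(k−ℓ)⌋·(k−ℓ). There exists ε₀ > 0 (depending on k) such that for every ε ∈ (0, ε₀] there exists n₀ such that the following holds for every n ≥ n₀ divisible by k−ℓ: if G is an n-vertex k-graph with no isolated vertices and δ*(G) ≥ (1 − 1/t)·n − (k−3), and there is a subset A ⊆ V(G) with |A| = ⌊n/t⌋ that contains at most εn² supported pairs, then G has a Hamilton ℓ-cycle. -/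
open Finset

/-- The number of supported pairs (supported 2-sets) contained in `A`. -/
def suppPairs {n : ℕ} (E : Finset (Finset (Fin n))) (A : Finset (Fin n)) : ℕ :=
  ((A.powersetCard 2).filter fun p => ∃ e ∈ E, p ⊆ e).card

/-- A Hamilton ℓ-cycle in the `k`-graph with edge set `E` on vertex set `Fin n`. -/
def HamCycle {n : ℕ} (k l : ℕ) (E : Finset (Finset (Fin n))) : Prop :=
  ∃ f : ZMod n → Fin n, Function.Bijective f ∧
    ∀ i : ℕ,
      (Finset.image (fun j : Fin k => f (((i * (k - l) + (j : ℕ)) : ℕ) : ZMod n))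
        Finset.univ) ∈ E

/-- Some permutation maps the injective tuple `x` to the injective tuple `y` and moves only
entries of the two tuples. -/
theorem exists_perm_map_tuple {β γ : Type*} [Fintype β] [DecidableEq β]
    (x y : γ → β) (hx : Function.Injective x) (hy : Function.Injective y) :
    ∃ π : Equiv.Perm β, (∀ c, π (x c) = y c) ∧
      ∀ z, (∀ c, z ≠ x c) → (∀ c, z ≠ y c) → π z = z := by
  classical
  let T : β → Prop := fun z => (∃ c, z = x c) ∨ ∃ c, z = y c
  let x' : γ → {z // T z} := fun c => ⟨x c, Or.inl ⟨c, rfl⟩⟩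
  let y' : γ → {z // T z} := fun c => ⟨y c, Or.inr ⟨c, rfl⟩⟩
  have hx' : Function.Injective x' := fun a b h => hx (congrArg Subtype.val h)
  have hy' : Function.Injective y' := fun a b h => hy (congrArg Subtype.val h)
  let e : {z // z ∈ Set.range x'} ≃ {z // z ∈ Set.range y'} :=
    (Equiv.ofInjective x' hx').symm.trans (Equiv.ofInjective y' hy')
  refine ⟨Equiv.Perm.ofSubtype e.extendSubtype, fun c => ?_, fun z h1 h2 => ?_⟩
  · have hT : T (x c) := Or.inl ⟨c, rfl⟩
    rw [Equiv.Perm.ofSubtype_apply_of_mem _ hT]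
    have h3 : e.extendSubtype (x' c) = y' c := by
      rw [Equiv.extendSubtype_apply_of_mem e (x' c) ⟨c, rfl⟩]
      have : (⟨x' c, ⟨c, rfl⟩⟩ : {z // z ∈ Set.range x'}) = Equiv.ofInjective x' hx' c := rfl
      simp only [e, Equiv.trans_apply]
      erw [this, Equiv.symm_apply_apply]
      rfl
    exact congrArg Subtype.val h3
  · apply Equiv.Perm.ofSubtype_apply_of_not_mem
    rintro (⟨c, h⟩ | ⟨c, h⟩)
    · exact h1 c h
    · exact h2 c h

theorem le_descFactorial {n d : ℕ} (h1 : 1 ≤ d) (h2 : d ≤ n) : n ≤ n.descFactorial d := by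
  obtain ⟨d, rfl⟩ := Nat.exists_eq_add_of_le' h1
  obtain ⟨n, rfl⟩ := Nat.exists_eq_add_of_le' (h1.trans h2)
  rw [Nat.succ_descFactorial_succ]
  exact Nat.le_mul_of_pos_right _ (Nat.descFactorial_pos.2 (by omega))

section LocalLemma

variable {β ι : Type*} [Fintype β] [DecidableEq β]
  (d : ι → ℕ) (p v : ∀ i, Fin (d i) → β)

/-- The permutations that contain none of the partial maps `p j c ↦ v j c` with `j ∈ S`. -/
noncomputable def avoiding (S : Finset ι) : Finset (Equiv.Perm β) := by
  classical
  exact univ.filter fun ρ => ∀ j ∈ S, ¬ ∀ c, ρ (p j c) = v j c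

/-- The permutations that contain the partial map `p i c ↦ v i c` but none of those with
index in `S`. -/
noncomputable def hitting (i : ι) (S : Finset ι) : Finset (Equiv.Perm β) := by
  classical
  exact (avoiding d p v S).filter fun ρ => ∀ c, ρ (p i c) = v i c

/-- Two partial maps conflict if they share a source or a target. -/
def Conflict (i j : ι) : Prop := ∃ c c', p i c = p j c' ∨ v i c = v j c'

theorem mem_avoiding {S : Finset ι} {ρ : Equiv.Perm β} :
    ρ ∈ avoiding d p v S ↔ ∀ j ∈ S, ¬ ∀ c, ρ (p j c) = v j c := by
  classical
  simp [avoiding]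

theorem mem_hitting {i : ι} {S : Finset ι} {ρ : Equiv.Perm β} :
    ρ ∈ hitting d p v i S ↔ (∀ j ∈ S, ¬ ∀ c, ρ (p j c) = v j c) ∧ ∀ c, ρ (p i c) = v i c := by
  classical
  rw [hitting, mem_filter, mem_avoiding]

theorem descFactorial_mul_card_hitting_le (hp : ∀ i, Function.Injective (p i)) (i : ι)
    (S : Finset ι) (hS : ∀ j ∈ S, ¬ Conflict d p v i j) :
    (Fintype.card β).descFactorial (d i) * (hitting d p v i S).card ≤
      (avoiding d p v S).card := by
  classical
  have hmap : ∀ ρ ∈ avoiding d p v S,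
      (⟨fun c => ρ (p i c), ρ.injective.comp (hp i)⟩ : Fin (d i) ↪ β) ∈
        (univ : Finset (Fin (d i) ↪ β)) := fun _ _ => mem_univ _
  rw [Finset.card_eq_sum_card_fiberwise hmap]
  have hc : (Fintype.card β).descFactorial (d i) = (univ : Finset (Fin (d i) ↪ β)).card := by
    rw [Finset.card_univ, Fintype.card_embedding_eq, Fintype.card_fin]
  rw [hc, ← smul_eq_mul, ← Finset.sum_const]
  apply Finset.sum_le_sum
  intro y _
  by_cases hv : Function.Injective (v i)
  · obtain ⟨π, h1, h2⟩ := exists_perm_map_tuple (v i) y hv y.injective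
    apply Finset.card_le_card_of_injOn (fun ρ => π * ρ)
    · intro ρ hρ
      rw [mem_coe, mem_hitting] at hρ
      rw [mem_coe, mem_filter, mem_avoiding]
      refine ⟨fun j hj hev => hρ.1 j hj fun c => ?_, ?_⟩
      · have hnc := hS j hj
        have h3 := hev c
        rw [Equiv.Perm.mul_apply] at h3
        by_cases hz : ∃ c', v j c = y c'
        · obtain ⟨c', hc'⟩ := hz
          rw [hc', ← h1 c'] at h3
          have h4 := π.injective h3
          rw [← hρ.2 c'] at h4
          exact absurd ⟨c', c, Or.inl (ρ.injective h4).symm⟩ hnc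
        · push Not at hz
          have h5 : π (v j c) = v j c :=
            h2 _ (fun c' h => hnc ⟨c', c, Or.inr h.symm⟩) hz
          apply π.injective
          rw [h3, h5]
      · ext c
        simp [hρ.2 c, h1 c]
    · intro a _ b _ h
      exact mul_left_cancel h
  · have : hitting d p v i S = ∅ := by
      apply Finset.eq_empty_of_forall_notMem
      intro ρ hρ
      rw [mem_hitting] at hρ
      apply hv
      intro a b hab
      rw [← hρ.2 a, ← hρ.2 b] at hab
      exact hp i (ρ.injective hab)
    rw [this, Finset.card_empty]
    exact Nat.zero_le _

theorem card_avoiding_le_add_sum [DecidableEq ι] (S T : Finset ι) :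
    (avoiding d p v T).card ≤
      (avoiding d p v (S ∪ T)).card + ∑ j ∈ S, (hitting d p v j T).card := by
  classical
  have hsub : avoiding d p v T ⊆ avoiding d p v (S ∪ T) ∪ S.biUnion fun j => hitting d p v j T := by
    intro ρ hρ
    rw [mem_avoiding] at hρ
    by_cases h : ∃ j ∈ S, ∀ c, ρ (p j c) = v j c
    · obtain ⟨j, hj, h⟩ := h
      exact mem_union_right _ (mem_biUnion.2 ⟨j, hj, (mem_hitting d p v).2 ⟨hρ, h⟩⟩)
    · push Not at h
      refine mem_union_left _ ((mem_avoiding d p v).2 fun j hj hev => ?_)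
      rcases mem_union.1 hj with hj | hj
      · obtain ⟨c, hc⟩ := h j hj
        exact hc (hev c)
      · exact hρ j hj hev
  calc _ ≤ _ := card_le_card hsub
    _ ≤ _ := card_union_le _ _
    _ ≤ _ := Nat.add_le_add_left card_biUnion_le _

theorem card_hitting_le (hp : ∀ i, Function.Injective (p i)) (I : Finset ι)
    (hd : ∀ i ∈ I, d i ≤ Fintype.card β)
    (hsum : ∀ i ∈ I, ∀ S ⊆ I, (∀ j ∈ S, Conflict d p v i j) →
      ∑ j ∈ S, (1 / ((Fintype.card β).descFactorial (d j) : ℝ)) ≤ 1 / 4) :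
    ∀ S ⊆ I, ∀ i ∈ I, ((hitting d p v i S).card : ℝ) ≤
      2 * (1 / ((Fintype.card β).descFactorial (d i) : ℝ)) * (avoiding d p v S).card := by
  classical
  intro S
  induction S using Finset.strongInduction with
  | H S ih =>
    intro hSI i hi
    set D : ι → ℝ := fun j => ((Fintype.card β).descFactorial (d j) : ℝ) with hD
    have hDpos : ∀ j ∈ I, 0 < D j := fun j hj => by
      have := Nat.descFactorial_pos.2 (hd j hj)
      simp only [hD]
      exact_mod_cast this
    set S1 := S.filter fun j => Conflict d p v i j with hS1
    set S2 := S.filter fun j => ¬ Conflict d p v i j with hS2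
    have hU : S1 ∪ S2 = S := Finset.filter_union_filter_not_eq _ _
    have hkey : D i * (hitting d p v i S2).card ≤ (avoiding d p v S2).card := by
      have := descFactorial_mul_card_hitting_le d p v hp i S2 fun j hj => (mem_filter.1 hj).2
      simp only [hD]
      exact_mod_cast this
    have hmono : ((hitting d p v i S).card : ℝ) ≤ (hitting d p v i S2).card := by
      have : hitting d p v i S ⊆ hitting d p v i S2 := fun ρ hρ => by
        rw [mem_hitting] at hρ ⊢
        exact ⟨fun j hj => hρ.1 j (mem_filter.1 hj).1, hρ.2⟩
      exact_mod_cast card_le_card this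
    have hstep : ∀ j ∈ S1, ((hitting d p v j S2).card : ℝ) ≤
        2 * (1 / D j) * (avoiding d p v S2).card := fun j hj => by
      apply ih S2 _ ((filter_subset _ _).trans hSI) j (hSI (mem_filter.1 hj).1)
      refine (Finset.filter_ssubset).2 ⟨j, (mem_filter.1 hj).1, ?_⟩
      exact not_not.2 (mem_filter.1 hj).2
    have hge : ((avoiding d p v S2).card : ℝ) ≤ 2 * (avoiding d p v S).card := by
      have h1 : ((avoiding d p v S2).card : ℝ) ≤ (avoiding d p v (S1 ∪ S2)).card +
          ∑ j ∈ S1, ((hitting d p v j S2).card : ℝ) := by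
        exact_mod_cast card_avoiding_le_add_sum d p v S1 S2
      rw [hU] at h1
      have h2 := Finset.sum_le_sum hstep
      rw [← Finset.sum_mul, ← Finset.mul_sum] at h2
      have h3 := hsum i hi S1 ((filter_subset _ _).trans hSI) fun j hj => (mem_filter.1 hj).2
      have h4 : (0 : ℝ) ≤ (avoiding d p v S2).card := Nat.cast_nonneg _
      have h5 := mul_le_mul_of_nonneg_right h3 h4
      linarith
    have hi' := hDpos i hi
    have : ((hitting d p v i S2).card : ℝ) ≤ 1 / D i * (avoiding d p v S2).card := by
      rw [one_div, ← div_eq_inv_mul, le_div_iff₀ hi', mul_comm]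
      exact hkey
    calc _ ≤ _ := hmono
      _ ≤ _ := this
      _ ≤ 1 / D i * (2 * (avoiding d p v S).card) := by gcongr
      _ = _ := by ring

/-- The lopsided local lemma for random permutations: if each partial map conflicts with
partial maps of small total weight, some permutation avoids all of them. -/
theorem exists_perm_avoiding (hp : ∀ i, Function.Injective (p i)) (I : Finset ι)
    (hd : ∀ i ∈ I, d i ≤ Fintype.card β) (hd1 : ∀ i ∈ I, 1 ≤ d i)
    (hN : 3 ≤ Fintype.card β)
    (hsum : ∀ i ∈ I, ∀ S ⊆ I, (∀ j ∈ S, Conflict d p v i j) →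
      ∑ j ∈ S, (1 / ((Fintype.card β).descFactorial (d j) : ℝ)) ≤ 1 / 4) :
    ∃ ρ : Equiv.Perm β, ∀ i ∈ I, ¬ ∀ c, ρ (p i c) = v i c := by
  classical
  have hpos : ∀ S ⊆ I, 0 < (avoiding d p v S).card := by
    intro S
    induction S using Finset.induction_on with
    | empty =>
      intro _
      exact card_pos.2 ⟨1, (mem_avoiding d p v).2 (by simp)⟩
    | insert i S _ ih =>
      intro hI
      have hi : i ∈ I := hI (mem_insert_self _ _)
      have hS : S ⊆ I := (subset_insert _ _).trans hI
      have h0 := ih hS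
      have h1 := card_avoiding_le_add_sum d p v {i} S
      rw [Finset.sum_singleton, ← Finset.insert_eq] at h1
      have h2 := card_hitting_le d p v hp I hd hsum S hS i hi
      have h3 : (3 : ℝ) ≤ (Fintype.card β).descFactorial (d i) := by
        exact_mod_cast hN.trans (le_descFactorial (hd1 i hi) (hd i hi))
      have h4 : 1 / ((Fintype.card β).descFactorial (d i) : ℝ) ≤ 1 / 3 :=
        one_div_le_one_div_of_le (by norm_num) h3
      have h5 : (0 : ℝ) < (avoiding d p v S).card := by exact_mod_cast h0
      have h6 : ((hitting d p v i S).card : ℝ) < (avoiding d p v S).card := by nlinarith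
      have h7 : (hitting d p v i S).card < (avoiding d p v S).card := by exact_mod_cast h6
      omega
  obtain ⟨ρ, hρ⟩ := card_pos.1 (hpos I subset_rfl)
  exact ⟨ρ, (mem_avoiding d p v).1 hρ⟩

end LocalLemma

section Counting

variable {β V : Type*} [Fintype β] [DecidableEq β] [DecidableEq V]

open Classical in
theorem card_bad_tuples_through_le {Q : Finset V → Prop} (g : β → V) (j : ℕ) (S : Finset V)
    (c₀ : Fin (j + 1)) (x : β) :
    (univ.filter fun τ : Fin (j + 1) → β =>
      τ c₀ = x ∧ ¬ Q (S ∪ univ.image fun c => g (τ c))).card ≤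
    (univ.filter fun τ : Fin j → β =>
      ¬ Q (insert (g x) S ∪ univ.image fun c => g (τ c))).card := by
  apply Finset.card_le_card_of_injOn (fun τ => c₀.removeNth τ)
  · intro τ hτ
    rw [mem_coe, mem_filter] at hτ ⊢
    refine ⟨mem_univ _, ?_⟩
    convert hτ.2.2 using 2
    ext y
    simp only [mem_union, mem_insert, mem_image, mem_univ, true_and]
    rw [Fin.exists_iff_succAbove c₀, hτ.2.1]
    simp only [Fin.removeNth, eq_comm]
    tauto
  · intro a ha b hb h
    rw [mem_coe, mem_filter] at ha hb
    rw [← Fin.insertNth_self_removeNth c₀ a, ← Fin.insertNth_self_removeNth c₀ b]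
    simp only at h
    rw [h, ha.2.1, hb.2.1]

open Classical in
/-- Tuples that extend `S` badly are rare if almost every single element extends well. -/
theorem card_bad_tuples_le {Q : Finset V → Prop} {k K : ℕ} (g : β → V)
    (hQ : ∀ S, Q S → S.card < k → (univ.filter fun x => ¬ Q (insert (g x) S)).card ≤ K)
    (j : ℕ) (S : Finset V) (hS : Q S) (hj : S.card + j ≤ k) :
    (univ.filter fun τ : Fin j → β => ¬ Q (S ∪ univ.image fun c => g (τ c))).card *
      Fintype.card β ≤ j * K * Fintype.card β ^ j := by
  induction j generalizing S with
  | zero =>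
    have : (univ.filter fun τ : Fin 0 → β => ¬ Q (S ∪ univ.image fun c => g (τ c))) = ∅ := by
      apply filter_false_of_mem
      intro τ _
      simpa using hS
    rw [this]
    simp
  | succ j ih =>
    set N := Fintype.card β with hN
    have hsum : (univ.filter fun τ : Fin (j + 1) → β =>
        ¬ Q (S ∪ univ.image fun c => g (τ c))).card ≤
        ∑ x : β, (univ.filter fun τ : Fin j → β =>
          ¬ Q (insert (g x) S ∪ univ.image fun c => g (τ c))).card := by
      rw [Finset.card_eq_sum_card_fiberwise (f := fun τ : Fin (j + 1) → β => τ 0)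
        (t := univ) (fun _ _ => mem_univ _)]
      apply Finset.sum_le_sum
      intro x _
      refine le_trans (le_of_eq ?_) (card_bad_tuples_through_le g j S 0 x)
      rw [filter_filter]
      simp only [and_comm]
    refine (Nat.mul_le_mul_right _ hsum).trans ?_
    rw [Finset.sum_mul]
    have hbound : ∀ x : β, (univ.filter fun τ : Fin j → β =>
        ¬ Q (insert (g x) S ∪ univ.image fun c => g (τ c))).card * N ≤
        (if ¬ Q (insert (g x) S) then N ^ (j + 1) else 0) + j * K * N ^ j := by
      intro x
      by_cases hx : ¬ Q (insert (g x) S)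
      · rw [if_pos hx]
        have h1 : (univ.filter fun τ : Fin j → β =>
            ¬ Q (insert (g x) S ∪ univ.image fun c => g (τ c))).card ≤ N ^ j := by
          refine (card_filter_le _ _).trans ?_
          simp [hN]
        have h2 := Nat.mul_le_mul_right N h1
        rw [← pow_succ] at h2
        omega
      · rw [if_neg hx]
        have h1 := ih (insert (g x) S) (not_not.1 hx) (by
          have := card_insert_le (g x) S
          omega)
        simpa using h1
    calc _ ≤ ∑ x : β, ((if ¬ Q (insert (g x) S) then N ^ (j + 1) else 0) + j * K * N ^ j) :=
          Finset.sum_le_sum fun x _ => hbound x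
      _ = (univ.filter fun x => ¬ Q (insert (g x) S)).card * N ^ (j + 1) +
            N * (j * K * N ^ j) := by
          rw [Finset.sum_add_distrib, ← Finset.sum_filter, Finset.sum_const, Finset.sum_const,
            smul_eq_mul, smul_eq_mul, Finset.card_univ]
      _ ≤ K * N ^ (j + 1) + N * (j * K * N ^ j) := by
          gcongr
          exact hQ S hS (by omega)
      _ = _ := by ring

theorem pow_le_two_mul_descFactorial {N d k : ℕ} (hd : d ≤ k) (hN : 2 * k ^ 2 ≤ N) :
    N ^ d ≤ 2 * N.descFactorial d := by
  rcases Nat.eq_zero_or_pos N with rfl | hpos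
  · have : k = 0 := by nlinarith
    have : d = 0 := by omega
    subst this
    simp
  have h1 := Nat.pow_sub_le_descFactorial N d
  have hdN : d ≤ N := by nlinarith
  have h2 : (N : ℝ) ^ d ≤ 2 * ((N + 1 - d : ℕ) : ℝ) ^ d := by
    have hN0 : (0 : ℝ) < N := by exact_mod_cast hpos
    have hsq : 2 * (d : ℝ) * d ≤ N := by
      have : 2 * d * d ≤ N := by nlinarith
      exact_mod_cast this
    have hb := one_add_mul_le_pow (a := -((d : ℝ) / N)) (by
      have : (d : ℝ) / N ≤ 1 := by
        rw [div_le_one hN0]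
        exact_mod_cast hdN
      linarith) d
    have h3 : (1 : ℝ) / 2 ≤ 1 + d * -((d : ℝ) / N) := by
      have : d * ((d : ℝ) / N) ≤ 1 / 2 := by
        rw [← mul_div_assoc, div_le_iff₀ hN0]
        linarith
      linarith
    have h4 : (N : ℝ) ^ d * (1 + -((d : ℝ) / N)) ^ d ≤ ((N + 1 - d : ℕ) : ℝ) ^ d := by
      rw [← mul_pow]
      apply pow_le_pow_left₀
      · have : (d : ℝ) / N ≤ 1 := by
          rw [div_le_one hN0]
          exact_mod_cast hdN
        exact mul_nonneg hN0.le (by linarith)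
      · rw [Nat.cast_sub (by omega)]
        push_cast
        rw [mul_add, mul_neg, mul_div_cancel₀ _ hN0.ne']
        linarith
    have h5 : (0 : ℝ) ≤ (N : ℝ) ^ d := by positivity
    nlinarith [h3.trans hb]
  have h3 : N ^ d ≤ 2 * (N + 1 - d) ^ d := by exact_mod_cast h2
  omega

end Counting

section Completion

variable {β V : Type*} [Fintype β] [DecidableEq β] [DecidableEq V]

open Classical in
theorem weight_bad_tuples_le {Q : Finset V → Prop} {k K : ℕ} (g : β → V)
    (hN : 2 * k ^ 2 ≤ Fintype.card β) (hpos : 0 < Fintype.card β)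
    (hQ : ∀ S, Q S → S.card < k → (univ.filter fun x => ¬ Q (insert (g x) S)).card ≤ K)
    (d : ℕ) (S : Finset V) (hS : Q S) (hd : S.card + d ≤ k) :
    ((univ.filter fun τ : Fin d → β => ¬ Q (S ∪ univ.image fun c => g (τ c))).card : ℝ) *
      (1 / ((Fintype.card β).descFactorial d : ℝ)) ≤ 2 * k * K / Fintype.card β := by
  set N := Fintype.card β
  have h1 := card_bad_tuples_le g hQ d S hS hd
  have h2 : N ^ d ≤ 2 * N.descFactorial d := pow_le_two_mul_descFactorial (by omega) hN
  have hdN : d ≤ N := by nlinarith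
  have h3 : (0 : ℝ) < N.descFactorial d := by exact_mod_cast Nat.descFactorial_pos.2 hdN
  rw [mul_one_div, div_le_div_iff₀ h3 (by exact_mod_cast hpos)]
  have h4 : d * K * N ^ d ≤ 2 * k * K * N.descFactorial d := by
    calc d * K * N ^ d ≤ k * K * (2 * N.descFactorial d) := by
          gcongr
          omega
      _ = _ := by ring
  exact_mod_cast h1.trans h4

open Classical in
theorem weight_bad_tuples_through_le {Q : Finset V → Prop} {k K : ℕ} (g : β → V)
    (hN : 2 * k ^ 2 ≤ Fintype.card β) (hpos : 0 < Fintype.card β)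
    (hQ : ∀ S, Q S → S.card < k → (univ.filter fun x => ¬ Q (insert (g x) S)).card ≤ K)
    (d : ℕ) (S : Finset V) (hd : S.card + d ≤ k) (c₀ : Fin d) (x : β) :
    ((univ.filter fun τ : Fin d → β =>
      τ c₀ = x ∧ ¬ Q (S ∪ univ.image fun c => g (τ c))).card : ℝ) *
      (1 / ((Fintype.card β).descFactorial d : ℝ)) ≤
    (if ¬ Q (insert (g x) S) then 2 / (Fintype.card β : ℝ) else 0) +
      2 * k * K / (Fintype.card β : ℝ) ^ 2 := by
  obtain ⟨j, rfl⟩ : ∃ j, d = j + 1 := ⟨d - 1, by have := c₀.2; omega⟩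
  set N := Fintype.card β with hNdef
  have h1 := card_bad_tuples_through_le (Q := Q) g j S c₀ x
  have h2 : N ^ (j + 1) ≤ 2 * N.descFactorial (j + 1) :=
    pow_le_two_mul_descFactorial (by omega) hN
  have hdN : j + 1 ≤ N := by nlinarith
  have h3 : (0 : ℝ) < N.descFactorial (j + 1) := by
    exact_mod_cast Nat.descFactorial_pos.2 hdN
  have hN0 : (0 : ℝ) < N := by exact_mod_cast hpos
  have h2' : (N : ℝ) ^ (j + 1) ≤ 2 * N.descFactorial (j + 1) := by exact_mod_cast h2
  set b := (univ.filter fun τ : Fin (j + 1) → β =>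
      τ c₀ = x ∧ ¬ Q (S ∪ univ.image fun c => g (τ c))).card
  by_cases hx : ¬ Q (insert (g x) S)
  · rw [if_pos hx]
    have h4 : b ≤ N ^ j := by
      refine h1.trans ((card_filter_le _ _).trans ?_)
      simp [hNdef]
    have h4' : (b : ℝ) ≤ (N : ℝ) ^ j := by exact_mod_cast h4
    have h5 : (b : ℝ) * (1 / (N.descFactorial (j + 1) : ℝ)) ≤ 2 / N := by
      rw [mul_one_div, div_le_div_iff₀ h3 hN0]
      calc (b : ℝ) * N ≤ (N : ℝ) ^ j * N := by gcongr
        _ = (N : ℝ) ^ (j + 1) := by ring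
        _ ≤ _ := h2'
    have h6 : (0 : ℝ) ≤ 2 * k * K / (N : ℝ) ^ 2 := by positivity
    linarith
  · rw [if_neg hx, zero_add, mul_one_div, div_le_div_iff₀ h3 (by positivity)]
    have h4 := card_bad_tuples_le g hQ j (insert (g x) S) (not_not.1 hx) (by
      have := card_insert_le (g x) S
      omega)
    have h5 : b * N ≤ j * K * N ^ j := (Nat.mul_le_mul_right N h1).trans h4
    have h5' : (b : ℝ) * N ≤ j * K * (N : ℝ) ^ j := by exact_mod_cast h5
    have hjk : (j : ℝ) ≤ k := by
      have : j ≤ k := by omega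
      exact_mod_cast this
    calc (b : ℝ) * (N : ℝ) ^ 2 = b * N * N := by ring
      _ ≤ j * K * (N : ℝ) ^ j * N := by gcongr
      _ = j * K * (N : ℝ) ^ (j + 1) := by ring
      _ ≤ k * K * (2 * N.descFactorial (j + 1)) := by gcongr
      _ = _ := by ring

open Classical in
/-- A partial arrangement all of whose windows extend well to almost all of the free elements
can be completed by rearranging the free positions `P`. -/
theorem exists_completion [Fintype V] {W : Type*} (𝒲 : Finset W) (win : W → Finset V)
    (f₀ : Equiv.Perm V) (P : Finset V) (Q : Finset V → Prop) (k K : ℕ)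
    (hwin : ∀ w ∈ 𝒲, (win w).card = k)
    (hdeg : ∀ p, (𝒲.filter fun w => p ∈ win w).card ≤ k)
    (hQ₀ : ∀ w ∈ 𝒲, Q ((win w \ P).image f₀))
    (hQ : ∀ S, Q S → S.card < k → (P.filter fun x => ¬ Q (insert (f₀ x) S)).card ≤ K)
    (hfew : ∀ x ∈ P,
      (𝒲.filter fun w => ¬ Q (insert (f₀ x) ((win w \ P).image f₀))).card ≤ K)
    (hW : 𝒲.card ≤ 4 * P.card) (hP3 : 3 ≤ P.card) (hPk : 2 * k ^ 2 ≤ P.card)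
    (hK : 48 * k ^ 3 * K ≤ P.card) :
    ∃ ρ : Equiv.Perm V, (∀ p ∉ P, ρ p = f₀ p) ∧ ∀ w ∈ 𝒲, Q ((win w).image ρ) := by
  set g : {x // x ∈ P} → V := fun x => f₀ x with hg
  have hcard : Fintype.card {x // x ∈ P} = P.card := Fintype.card_coe P
  set N := Fintype.card {x // x ∈ P} with hN
  have hQ' : ∀ S, Q S → S.card < k →
      (univ.filter fun x : {x // x ∈ P} => ¬ Q (insert (g x) S)).card ≤ K := by
    intro S h1 h2
    refine le_trans ?_ (hQ S h1 h2)
    apply Finset.card_le_card_of_injOn Subtype.val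
    · intro x hx
      rw [mem_coe, mem_filter] at hx ⊢
      exact ⟨x.2, hx.2⟩
    · exact Subtype.val_injective.injOn
  set d : W → ℕ := fun w => (P ∩ win w).card with hd
  set en : ∀ w, Fin (d w) → {x // x ∈ P} := fun w c =>
    ⟨((P ∩ win w).equivFin.symm c).1, (mem_inter.1 ((P ∩ win w).equivFin.symm c).2).1⟩ with hen
  have hen_inj : ∀ w, Function.Injective (en w) := fun w a b h => by
    have h1 := congrArg Subtype.val h
    exact (P ∩ win w).equivFin.symm.injective (Subtype.ext h1)
  have hen_mem : ∀ w c, (en w c : V) ∈ win w := fun w c =>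
    (mem_inter.1 ((P ∩ win w).equivFin.symm c).2).2
  have hen_surj : ∀ w, ∀ x ∈ P, x ∈ win w → ∃ c, (en w c : V) = x := fun w x h1 h2 =>
    ⟨(P ∩ win w).equivFin ⟨x, mem_inter.2 ⟨h1, h2⟩⟩, by simp [hen]⟩
  set F : W → Finset V := fun w => (win w \ P).image f₀ with hF
  have hFcard : ∀ w ∈ 𝒲, (F w).card + d w ≤ k := fun w hw => by
    have h1 : (F w).card ≤ (win w \ P).card := card_image_le
    have h2 := card_sdiff_add_card_inter (win w) P
    rw [inter_comm] at h2
    have h3 := hwin w hw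
    simp only [hd]
    omega
  set I : Finset (Σ w : W, (Fin (d w) → {x // x ∈ P})) :=
    𝒲.sigma fun w => univ.filter fun τ => ¬ Q (F w ∪ univ.image fun c => g (τ c)) with hI
  have hmemI : ∀ i ∈ I, i.1 ∈ 𝒲 ∧ ¬ Q (F i.1 ∪ univ.image fun c => g (i.2 c)) := fun i hi => by
    rw [hI, mem_sigma, mem_filter] at hi
    exact ⟨hi.1, hi.2.2⟩
  have hdN : ∀ w ∈ 𝒲, d w ≤ N := fun w hw => by
    have := hFcard w hw
    nlinarith
  have hNpos : 0 < N := by omega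
  have hN0 : (0 : ℝ) < N := by exact_mod_cast hNpos
  obtain ⟨ρ, hρ⟩ := exists_perm_avoiding (fun i : Σ w : W, (Fin (d w) → {x // x ∈ P}) => d i.1)
    (fun i => en i.1) (fun i => i.2) (fun i => hen_inj i.1) I
    (fun i hi => hdN i.1 (hmemI i hi).1)
    (fun i hi => by
      by_contra h
      obtain ⟨h1, h2⟩ := hmemI i hi
      have : IsEmpty (Fin (d i.1)) := by
        rw [show d i.1 = 0 by omega]
        infer_instance
      apply h2
      rw [univ_eq_empty, image_empty, union_empty]
      exact hQ₀ i.1 h1)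
    (by omega) (by
      intro i hi S hSI hS
      set wt : (Σ w : W, (Fin (d w) → {x // x ∈ P})) → ℝ :=
        fun j => 1 / (N.descFactorial (d j.1) : ℝ) with hwt
      have hwt0 : ∀ j, 0 ≤ wt j := fun j => by positivity
      have hiW := (hmemI i hi).1
      have hdk : d i.1 ≤ k := by
        have := hFcard i.1 hiW
        omega
      have hposs : ∀ p : V, ∑ j ∈ I, (if p ∈ win j.1 then wt j else 0) ≤
          k * (2 * k * K / N) := by
        intro p
        rw [hI, Finset.sum_sigma]
        calc _ ≤ ∑ w ∈ 𝒲, (if p ∈ win w then 2 * (k : ℝ) * K / N else 0) := by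
              apply Finset.sum_le_sum
              intro w hw
              split_ifs
              · simp only [hwt]
                rw [Finset.sum_const, nsmul_eq_mul]
                exact weight_bad_tuples_le g (by omega) hNpos hQ' (d w) (F w) (hQ₀ w hw)
                  (hFcard w hw)
              · simp
          _ = ((𝒲.filter fun w => p ∈ win w).card : ℝ) * (2 * k * K / N) := by
              rw [← Finset.sum_filter, Finset.sum_const, nsmul_eq_mul]
          _ ≤ _ := by
              have : ((𝒲.filter fun w => p ∈ win w).card : ℝ) ≤ k := by exact_mod_cast hdeg p
              gcongr
      have hvals : ∀ x : {x // x ∈ P}, ∑ j ∈ I, (if ∃ c, j.2 c = x then wt j else 0) ≤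
          10 * k ^ 2 * K / N := by
        intro x
        rw [hI, Finset.sum_sigma]
        have hw1 : ∀ w ∈ 𝒲, ∑ τ ∈ univ.filter (fun τ : Fin (d w) → {x // x ∈ P} =>
            ¬ Q (F w ∪ univ.image fun c => g (τ c))),
            (if ∃ c, τ c = x then wt ⟨w, τ⟩ else 0) ≤
            (if ¬ Q (insert (g x) (F w)) then 2 * (k : ℝ) / N else 0) +
              2 * k ^ 2 * K / (N : ℝ) ^ 2 := by
          intro w hw
          calc _ ≤ ∑ τ ∈ univ.filter (fun τ : Fin (d w) → {x // x ∈ P} =>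
                  ¬ Q (F w ∪ univ.image fun c => g (τ c))),
                  ∑ c, (if τ c = x then wt ⟨w, τ⟩ else 0) := by
                apply Finset.sum_le_sum
                intro τ _
                by_cases h : ∃ c, τ c = x
                · rw [if_pos h]
                  obtain ⟨c, hc⟩ := h
                  refine le_trans (le_of_eq ?_) (Finset.single_le_sum
                    (f := fun c => if τ c = x then wt ⟨w, τ⟩ else 0) (fun c _ => ?_) (mem_univ c))
                  · rw [if_pos hc]
                  · split_ifs
                    exacts [hwt0 _, le_rfl]
                · rw [if_neg h]
                  apply Finset.sum_nonneg
                  intro c _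
                  split_ifs
                  exacts [hwt0 _, le_rfl]
            _ = ∑ c, ((univ.filter fun τ : Fin (d w) → {x // x ∈ P} =>
                  τ c = x ∧ ¬ Q (F w ∪ univ.image fun c => g (τ c))).card : ℝ) *
                  (1 / (N.descFactorial (d w) : ℝ)) := by
                rw [Finset.sum_comm]
                apply Finset.sum_congr rfl
                intro c _
                rw [← Finset.sum_filter, filter_filter]
                simp only [hwt]
                rw [Finset.sum_const, nsmul_eq_mul]
                simp only [and_comm]
            _ ≤ ∑ c : Fin (d w), ((if ¬ Q (insert (g x) (F w)) then 2 / (N : ℝ) else 0) +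
                  2 * k * K / (N : ℝ) ^ 2) := by
                apply Finset.sum_le_sum
                intro c _
                exact weight_bad_tuples_through_le g (by omega) hNpos hQ' (d w) (F w)
                  (hFcard w hw) c x
            _ = d w * ((if ¬ Q (insert (g x) (F w)) then 2 / (N : ℝ) else 0) +
                  2 * k * K / (N : ℝ) ^ 2) := by
                rw [Finset.sum_const, nsmul_eq_mul, card_univ, Fintype.card_fin]
            _ ≤ k * ((if ¬ Q (insert (g x) (F w)) then 2 / (N : ℝ) else 0) +
                  2 * k * K / (N : ℝ) ^ 2) := by
                have : (d w : ℝ) ≤ k := by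
                  have := hFcard w hw
                  exact_mod_cast (by omega : d w ≤ k)
                apply mul_le_mul_of_nonneg_right this
                split_ifs <;> positivity
            _ = _ := by
                split_ifs <;> ring
        refine (Finset.sum_le_sum hw1).trans ?_
        rw [Finset.sum_add_distrib, ← Finset.sum_filter, Finset.sum_const, Finset.sum_const,
          nsmul_eq_mul, nsmul_eq_mul]
        have h1 : ((𝒲.filter fun w => ¬ Q (insert (g x) (F w))).card : ℝ) ≤ K := by
          exact_mod_cast hfew x x.2
        have h2 : (𝒲.card : ℝ) ≤ 4 * N := by
          rw [hcard]
          exact_mod_cast hW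
        have hkk : (k : ℝ) ≤ k ^ 2 := by
          exact_mod_cast Nat.le_self_pow (by norm_num) k
        calc _ ≤ (K : ℝ) * (2 * k / N) + 4 * N * (2 * k ^ 2 * K / (N : ℝ) ^ 2) := by gcongr
          _ = (2 * k * K + 8 * k ^ 2 * K) / N := by
              field_simp
              ring
          _ ≤ (2 * k ^ 2 * K + 8 * k ^ 2 * K) / N := by gcongr
          _ = _ := by ring
      have hterm : ∀ j ∈ S, wt j ≤ ∑ c, ((if (en i.1 c : V) ∈ win j.1 then wt j else 0) +
          (if ∃ c', j.2 c' = i.2 c then wt j else 0)) := by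
        intro j hj
        obtain ⟨c, c', h⟩ := hS j hj
        have hnn : ∀ c ∈ univ, 0 ≤ (if (en i.1 c : V) ∈ win j.1 then wt j else 0) +
          (if ∃ c', j.2 c' = i.2 c then wt j else 0) := fun c _ => by
          have := hwt0 j
          split_ifs <;> linarith
        refine le_trans ?_ (Finset.single_le_sum hnn (mem_univ c))
        have := hwt0 j
        rcases h with h | h
        · rw [if_pos (show (en i.1 c : V) ∈ win j.1 from
            (show en i.1 c = en j.1 c' from h) ▸ hen_mem _ _)]
          split_ifs <;> linarith
        · rw [if_pos (show ∃ c', j.2 c' = i.2 c from ⟨c', h.symm⟩)]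
          split_ifs <;> linarith
      calc ∑ j ∈ S, wt j ≤ ∑ j ∈ S, ∑ c, ((if (en i.1 c : V) ∈ win j.1 then wt j else 0) +
              (if ∃ c', j.2 c' = i.2 c then wt j else 0)) := Finset.sum_le_sum hterm
        _ ≤ ∑ j ∈ I, ∑ c, ((if (en i.1 c : V) ∈ win j.1 then wt j else 0) +
              (if ∃ c', j.2 c' = i.2 c then wt j else 0)) := by
            apply Finset.sum_le_sum_of_subset_of_nonneg hSI
            intro j _ _
            apply Finset.sum_nonneg
            intro c _
            have := hwt0 j
            split_ifs <;> linarith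
        _ = ∑ c, (∑ j ∈ I, (if (en i.1 c : V) ∈ win j.1 then wt j else 0) +
              ∑ j ∈ I, (if ∃ c', j.2 c' = i.2 c then wt j else 0)) := by
            rw [Finset.sum_comm]
            simp only [Finset.sum_add_distrib]
        _ ≤ ∑ c : Fin (d i.1), (k * (2 * k * K / N) + 10 * k ^ 2 * K / (N : ℝ)) := by
            apply Finset.sum_le_sum
            intro c _
            exact add_le_add (hposs _) (hvals _)
        _ = d i.1 * (12 * k ^ 2 * K / (N : ℝ)) := by
            rw [Finset.sum_const, nsmul_eq_mul, card_univ, Fintype.card_fin]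
            ring
        _ ≤ k * (12 * k ^ 2 * K / (N : ℝ)) := by
            have : (d i.1 : ℝ) ≤ k := by exact_mod_cast hdk
            gcongr
        _ = 12 * k ^ 3 * K / N := by ring
        _ ≤ 1 / 4 := by
            rw [div_le_iff₀ hN0]
            have : 48 * (k : ℝ) ^ 3 * K ≤ N := by
              rw [hcard]
              exact_mod_cast hK
            linarith)
  refine ⟨(Equiv.Perm.ofSubtype ρ).trans f₀, fun p hp => ?_, fun w hw => ?_⟩
  · rw [Equiv.trans_apply, Equiv.Perm.ofSubtype_apply_of_not_mem ρ hp]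
  · by_contra hbad
    have himg : (win w).image ((Equiv.Perm.ofSubtype ρ).trans f₀) =
        F w ∪ univ.image fun c => g (ρ (en w c)) := by
      ext y
      simp only [mem_image, mem_union, mem_univ, true_and, hF, mem_sdiff, Equiv.trans_apply]
      constructor
      · rintro ⟨p, hp, rfl⟩
        by_cases hpP : p ∈ P
        · right
          obtain ⟨c, hc⟩ := hen_surj w p hpP hp
          refine ⟨c, ?_⟩
          rw [← hc, Equiv.Perm.ofSubtype_apply_coe]
        · left
          exact ⟨p, ⟨hp, hpP⟩, by rw [Equiv.Perm.ofSubtype_apply_of_not_mem ρ hpP]⟩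
      · rintro (⟨p, ⟨hp, hpP⟩, rfl⟩ | ⟨c, rfl⟩)
        · exact ⟨p, hp, by rw [Equiv.Perm.ofSubtype_apply_of_not_mem ρ hpP]⟩
        · exact ⟨en w c, hen_mem w c, by rw [Equiv.Perm.ofSubtype_apply_coe]⟩
    rw [himg] at hbad
    have hiI : (⟨w, fun c => ρ (en w c)⟩ : Σ w : W, (Fin (d w) → {x // x ∈ P})) ∈ I := by
      rw [hI, mem_sigma, mem_filter]
      exact ⟨hw, mem_univ _, hbad⟩
    exact hρ _ hiI fun c => rfl

end Completion

section Structure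

/-- The set `S` is contained in an edge. -/
def Supp {V : Type*} (E : Finset (Finset V)) (S : Finset V) : Prop := ∃ e ∈ E, S ⊆ e

theorem Supp.mono {V : Type*} {E : Finset (Finset V)} {S T : Finset V} (h : Supp E T)
    (hST : S ⊆ T) : Supp E S := by
  obtain ⟨e, he, hTe⟩ := h
  exact ⟨e, he, hST.trans hTe⟩

/-- Every supported set extends to a supported set with `k - 1` elements. -/
theorem exists_supp_superset {V : Type*} {E : Finset (Finset V)} {k : ℕ} (hE : ∀ e ∈ E, e.card = k)
    {S : Finset V} (hS : Supp E S) (hc : S.card ≤ k - 1) :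
    ∃ T, S ⊆ T ∧ T.card = k - 1 ∧ Supp E T := by
  classical
  obtain ⟨e, he, hSe⟩ := hS
  have hek := hE e he
  obtain ⟨T, h1, h2, h3⟩ := exists_subsuperset_card_eq hSe hc (by omega)
  exact ⟨T, h1, h3, e, he, h2⟩

variable {V : Type*} [DecidableEq V]

/-- The elements of `C` that form a supported pair with `v`. -/
noncomputable def nbr (E : Finset (Finset V)) (v : V) (C : Finset V) : Finset V := by
  classical
  exact C.filter fun u => u ≠ v ∧ Supp E {u, v}

theorem mem_nbr {E : Finset (Finset V)} {v u : V} {C : Finset V} :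
    u ∈ nbr E v C ↔ u ∈ C ∧ u ≠ v ∧ Supp E {u, v} := by
  classical
  rw [nbr, mem_filter]

theorem nbr_subset {E : Finset (Finset V)} {v : V} {C : Finset V} : nbr E v C ⊆ C :=
  fun _ h => (mem_nbr.1 h).1

theorem card_nbr_le_add {E : Finset (Finset V)} {v : V} (C D : Finset V) :
    (nbr E v C).card ≤ (nbr E v D).card + (C \ D).card := by
  have : nbr E v C ⊆ nbr E v D ∪ (C \ D) := fun u hu => by
    rw [mem_nbr] at hu
    rw [mem_union, mem_nbr, mem_sdiff]
    tauto
  exact (card_le_card this).trans (card_union_le _ _)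

theorem sum_card_nbr_le {n : ℕ} (E : Finset (Finset (Fin n))) (A : Finset (Fin n)) :
    ∑ v ∈ A, (nbr E v A).card ≤ 2 * suppPairs E A := by
  classical
  rw [← Finset.card_sigma, suppPairs]
  have himg : (A.sigma fun v => nbr E v A).image (fun x => ({x.2, x.1} : Finset (Fin n))) ⊆
      (A.powersetCard 2).filter fun p => ∃ e ∈ E, p ⊆ e := by
    intro p hp
    rw [mem_image] at hp
    obtain ⟨⟨v, u⟩, hx, rfl⟩ := hp
    rw [mem_sigma] at hx
    obtain ⟨hv, hu⟩ := hx
    simp only at hv hu ⊢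
    rw [mem_nbr] at hu
    rw [mem_filter, mem_powersetCard]
    refine ⟨⟨?_, card_pair hu.2.1⟩, hu.2.2⟩
    intro y hy
    rw [mem_insert, mem_singleton] at hy
    rcases hy with rfl | rfl
    exacts [hu.1, hv]
  refine (Finset.card_le_mul_card_image (f := fun x : Σ _ : Fin n, Fin n =>
    ({x.2, x.1} : Finset (Fin n))) _ 2 ?_).trans (Nat.mul_le_mul_left 2 (card_le_card himg))
  intro p hp
  rw [mem_image] at hp
  obtain ⟨⟨v, u⟩, _, rfl⟩ := hp
  refine (card_le_card (t := {⟨v, u⟩, ⟨u, v⟩}) ?_).trans card_le_two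
  rintro ⟨a, b⟩ hab
  rw [mem_filter, mem_sigma] at hab
  obtain ⟨⟨_, hb⟩, hab⟩ := hab
  simp only at hb hab
  rw [mem_nbr] at hb
  have h1 : a ∈ ({u, v} : Finset (Fin n)) := by rw [← hab]; simp
  have h2 : b ∈ ({u, v} : Finset (Fin n)) := by rw [← hab]; simp
  rw [mem_insert, mem_singleton] at h1 h2
  rw [mem_insert, mem_singleton]
  rcases h1 with rfl | rfl <;> rcases h2 with rfl | rfl
  · exact absurd rfl hb.2.1
  · right; rfl
  · left; rfl
  · exact absurd rfl hb.2.1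

variable [Fintype V]

/-- The vertices that extend `S` to a supported set. -/
noncomputable def exts (E : Finset (Finset V)) (S : Finset V) : Finset V := by
  classical
  exact univ.filter fun v => v ∉ S ∧ Supp E (insert v S)

theorem mem_exts {E : Finset (Finset V)} {S : Finset V} {v : V} :
    v ∈ exts E S ↔ v ∉ S ∧ Supp E (insert v S) := by
  classical
  rw [exts, mem_filter]
  simp

theorem card_edges_le_card_exts {E : Finset (Finset V)} {k : ℕ} (hk : 1 ≤ k)
    (hE : ∀ e ∈ E, e.card = k) (S : Finset V) (hS : S.card = k - 1) :
    (E.filter fun e => S ⊆ e).card ≤ (exts E S).card := by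
  classical
  have : (E.filter fun e => S ⊆ e) ⊆ (exts E S).image fun v => insert v S := by
    intro e he
    rw [mem_filter] at he
    have h1 : (e \ S).card = 1 := by
      rw [card_sdiff_of_subset he.2, hE e he.1, hS]
      omega
    obtain ⟨v, hv⟩ := card_eq_one.1 h1
    have hve : v ∈ e \ S := by rw [hv]; exact mem_singleton_self v
    rw [mem_sdiff] at hve
    have heq : insert v S = e := by
      rw [← sdiff_union_of_subset he.2, hv]
      rfl
    exact mem_image.2 ⟨v, mem_exts.2 ⟨hve.2, e, he.1, heq.le⟩, heq⟩
  exact (card_le_card this).trans card_image_le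

theorem card_univ_sdiff_nbr_lt {E : Finset (Finset V)} {k a : ℕ} (hk : 3 ≤ k)
    (hE : ∀ e ∈ E, e.card = k) (hcov : ∀ v, ∃ e ∈ E, v ∈ e)
    (hco : ∀ S : Finset V, S.card = k - 1 → Supp E S →
      Fintype.card V ≤ (exts E S).card + a + (k - 3)) (v : V) :
    (univ \ nbr E v univ).card + 1 ≤ a := by
  obtain ⟨e, he, hve⟩ := hcov v
  obtain ⟨S, h1, h2, h3⟩ := exists_supp_superset hE
    (S := {v}) ⟨e, he, by simpa using hve⟩ (by rw [card_singleton]; omega)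
  have hvS : v ∈ S := by simpa using h1
  have hsub : exts E S ∪ S.erase v ⊆ nbr E v univ := by
    intro u hu
    rw [mem_nbr]
    rcases mem_union.1 hu with hu | hu
    · rw [mem_exts] at hu
      refine ⟨mem_univ _, fun h => hu.1 (h ▸ hvS), hu.2.mono ?_⟩
      intro y hy
      rw [mem_insert, mem_singleton] at hy
      rcases hy with rfl | rfl
      · exact mem_insert_self _ _
      · exact mem_insert_of_mem hvS
    · rw [mem_erase] at hu
      refine ⟨mem_univ _, hu.1, h3.mono ?_⟩
      intro y hy
      rw [mem_insert, mem_singleton] at hy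
      rcases hy with rfl | rfl
      exacts [hu.2, hvS]
  have hdisj : Disjoint (exts E S) (S.erase v) := by
    rw [Finset.disjoint_left]
    intro u hu hu'
    exact (mem_exts.1 hu).1 (mem_of_mem_erase hu')
  have h4 := card_le_card hsub
  rw [card_union_of_disjoint hdisj, card_erase_of_mem hvS, h2] at h4
  have h5 := hco S h2 h3
  have h6 := card_sdiff_add_card_eq_card (subset_univ (nbr E v univ))
  rw [card_univ] at h6
  omega

/-- A set `A` of about `a` vertices that is sparse in supported pairs, together with a small set
`X` of exceptional vertices outside `A`, such that all other supported pairs and sets behave as in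
the extremal example. -/
structure NearExtremal (E : Finset (Finset V)) (k a G h : ℕ) (A X : Finset V) : Prop where
  disj : Disjoint A X
  card_X : X.card ≤ h
  lower : a ≤ A.card + h
  upper : A.card ≤ a + h
  nbr_le : ∀ v ∈ A, (nbr E v A).card ≤ 2 * G
  le_nbr : ∀ v ∉ A, G ≤ 2 * (nbr E v A).card
  nonnbr_le : ∀ v ∉ A, v ∉ X → (A \ nbr E v A).card ≤ 2 * G
  exts_le : ∀ S, Supp E S → (∃ v ∈ S, v ∈ A) → S.card < k →
    ∀ U : Finset V, (∀ u ∈ U, u ∉ A ∧ ¬ Supp E (insert u S)) → U.card ≤ 4 * G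
  lt_nbr : ∀ v ∈ A, A.card + 1 ≤ (nbr E v A).card + a

theorem exists_nearExtremal {E : Finset (Finset V)} {k a D G h : ℕ} (hk : 3 ≤ k)
    (hE : ∀ e ∈ E, e.card = k) (hcov : ∀ v, ∃ e ∈ E, v ∈ e)
    (hco : ∀ S : Finset V, S.card = k - 1 → Supp E S →
      Fintype.card V ≤ (exts E S).card + a + (k - 3))
    (ha : 3 * a ≤ Fintype.card V)
    (hD : 1 ≤ D) (hDG : 2 * D ≤ G) (hGa : 2 * (D + G) ≤ a) (hDh : 2 * D ≤ h)
    (hh : Fintype.card V * D ≤ h * G) (hkG : k + h ≤ 2 * G)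
    (A : Finset V) (hA : A.card = a) (hsum : ∑ v ∈ A, (nbr E v A).card ≤ D * D) :
    ∃ A' X, NearExtremal E k a G h A' X := by
  classical
  have hnon := fun v => card_univ_sdiff_nbr_lt hk hE hcov hco v
  set T := A.filter fun v => (nbr E v A).card ≤ D with hT
  have hTA : T ⊆ A := filter_subset _ _
  have hAT : (A \ T).card ≤ D := by
    have h1 : (A \ T).card * (D + 1) ≤ ∑ v ∈ A \ T, (nbr E v A).card := by
      rw [← smul_eq_mul]
      refine card_nsmul_le_sum _ _ _ fun v hv => ?_
      rw [mem_sdiff, hT, mem_filter] at hv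
      by_contra hlt
      exact hv.2 ⟨hv.1, by omega⟩
    have h2 : ∑ v ∈ A \ T, (nbr E v A).card ≤ ∑ v ∈ A, (nbr E v A).card :=
      sum_le_sum_of_subset sdiff_subset
    by_contra hlt
    have : (D + 1) * (D + 1) ≤ (A \ T).card * (D + 1) := Nat.mul_le_mul_right _ (by omega)
    nlinarith
  have hTa : T.card ≤ a := hA ▸ card_le_card hTA
  have haT : a ≤ T.card + D := by
    have := card_sdiff_add_card_eq_card hTA
    omega
  -- non-neighbours of `T` outside `A`
  have hTout : ∀ v ∈ T, ∀ U : Finset V, Disjoint U A → (U.filter fun u => ¬ Supp E {u, v}).card ≤ D := by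
    intro v hv U hU
    rw [hT, mem_filter] at hv
    have h1 : (U.filter fun u => ¬ Supp E {u, v}) ∪ (A \ nbr E v A) ⊆ univ \ nbr E v univ := by
      intro u hu
      rw [mem_sdiff, mem_nbr]
      refine ⟨mem_univ _, fun h => ?_⟩
      rcases mem_union.1 hu with hu | hu
      · exact (mem_filter.1 hu).2 h.2.2
      · rw [mem_sdiff, mem_nbr] at hu
        exact hu.2 ⟨hu.1, h.2⟩
    have h2 : Disjoint (U.filter fun u => ¬ Supp E {u, v}) (A \ nbr E v A) :=
      Finset.disjoint_of_subset_left (filter_subset _ _)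
        (Finset.disjoint_of_subset_right sdiff_subset hU)
    have h3 := card_le_card h1
    rw [card_union_of_disjoint h2] at h3
    have h4 := card_sdiff_add_card_eq_card (nbr_subset (E := E) (v := v) (C := A))
    have h5 := hnon v
    omega
  have hcount : ∀ (U : Finset V) (c : ℕ), Disjoint U A →
      (∀ u ∈ U, c ≤ (T.filter fun v => ¬ Supp E {u, v}).card) → U.card * c ≤ a * D := by
    intro U c hU hc
    calc U.card * c ≤ ∑ u ∈ U, (T.filter fun v => ¬ Supp E {u, v}).card := by
          rw [← smul_eq_mul]; exact card_nsmul_le_sum _ _ _ hc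
      _ = ∑ v ∈ T, (U.filter fun u => ¬ Supp E {u, v}).card := by
          simp_rw [card_filter]; exact sum_comm
      _ ≤ T.card * D := by
          rw [← smul_eq_mul]; exact sum_le_card_nsmul _ _ _ fun v hv => hTout v hv U hU
      _ ≤ a * D := Nat.mul_le_mul_right _ hTa
  have hTnon : ∀ u, u ∉ A → (A \ nbr E u A).card ≤
      (T.filter fun v => ¬ Supp E {u, v}).card + D := by
    intro u hu
    have : A \ nbr E u A ⊆ (T.filter fun v => ¬ Supp E {u, v}) ∪ (A \ T) := by
      intro v hv
      rw [mem_sdiff, mem_nbr] at hv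
      rw [mem_union, mem_filter, mem_sdiff]
      by_cases hvT : v ∈ T
      · left
        refine ⟨hvT, fun h => hv.2 ⟨hv.1, ?_, by rwa [pair_comm]⟩⟩
        rintro rfl
        exact hu hv.1
      · exact Or.inr ⟨hv.1, hvT⟩
    have := (card_le_card this).trans (card_union_le _ _)
    omega
  have hsplit : ∀ u, (A \ nbr E u A).card + (nbr E u A).card = a := fun u => by
    rw [card_sdiff_add_card_eq_card nbr_subset, hA]
  set A' := univ.filter fun v => (nbr E v A).card ≤ G with hA'
  have hmemA' : ∀ v, v ∈ A' ↔ (nbr E v A).card ≤ G := fun v => by rw [hA', mem_filter]; simp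
  set X := univ.filter fun v => v ∉ A' ∧ G < (A \ nbr E v A).card with hX
  have hmemX : ∀ v, v ∈ X ↔ v ∉ A' ∧ G < (A \ nbr E v A).card := fun v => by
    rw [hX, mem_filter]; simp
  have hAA' : (A \ A').card ≤ D := by
    refine (card_le_card (sdiff_subset_sdiff le_rfl ?_)).trans hAT
    intro v hv
    rw [hT, mem_filter] at hv
    rw [hmemA']
    omega
  have hA'A : (A' \ A).card ≤ 2 * D := by
    have h1 := hcount (A' \ A) (a - D - G) sdiff_disjoint (by
      intro u hu
      rw [mem_sdiff, hmemA'] at hu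
      have := hTnon u hu.2
      have := hsplit u
      omega)
    have h2 : (A' \ A).card * a ≤ 2 * D * a := by
      have : (A' \ A).card * a ≤ (A' \ A).card * (2 * (a - D - G)) :=
        Nat.mul_le_mul_left _ (by omega)
      nlinarith
    exact Nat.le_of_mul_le_mul_right h2 (by omega)
  have hcA := card_sdiff_add_card_inter A A'
  have hcA' := card_sdiff_add_card_inter A' A
  rw [inter_comm A' A] at hcA'
  have hXle : X.card ≤ h := by
    have h1 := hcount (X \ A) (G - D) sdiff_disjoint (by
      intro u hu
      rw [mem_sdiff, hmemX] at hu
      have := hTnon u hu.2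
      omega)
    have h2 : X.card ≤ (X \ A).card + D := by
      have : X ⊆ (X \ A) ∪ (A \ A') := by
        intro v hv
        rw [mem_union, mem_sdiff, mem_sdiff]
        by_cases hvA : v ∈ A
        · exact Or.inr ⟨hvA, ((hmemX v).1 hv).1⟩
        · exact Or.inl ⟨hv, hvA⟩
      have := (card_le_card this).trans (card_union_le _ _)
      omega
    have h3 : X.card * G ≤ h * G := by
      have e1 : (X \ A).card * G ≤ (X \ A).card * (2 * (G - D)) :=
        Nat.mul_le_mul_left _ (by omega)
      have e2 : X.card * G ≤ ((X \ A).card + D) * G := Nat.mul_le_mul_right _ h2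
      have e3 : 3 * a * D ≤ Fintype.card V * D := Nat.mul_le_mul_right _ ha
      have e4 : D * G ≤ D * a := Nat.mul_le_mul_left _ (by omega)
      nlinarith
    exact Nat.le_of_mul_le_mul_right h3 (by omega)
  have hnbrA' : ∀ v ∈ A', (nbr E v A').card ≤ 2 * G := by
    intro v hv
    have := card_nbr_le_add (E := E) (v := v) A' A
    rw [hmemA'] at hv
    omega
  refine ⟨A', X, ?_, hXle, by omega, by omega, hnbrA', ?_, ?_, ?_, ?_⟩
  · rw [Finset.disjoint_left]
    intro v hv hvX
    exact ((hmemX v).1 hvX).1 hv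
  · intro v hv
    have := card_nbr_le_add (E := E) (v := v) A A'
    rw [hmemA'] at hv
    omega
  · intro v hv hvX
    have h1 : (A \ nbr E v A).card ≤ G := by
      by_contra hlt
      exact hvX ((hmemX v).2 ⟨hv, by omega⟩)
    have h2 : A' \ nbr E v A' ⊆ (A \ nbr E v A) ∪ (A' \ A) := by
      intro u hu
      rw [mem_sdiff, mem_nbr] at hu
      rw [mem_union, mem_sdiff, mem_sdiff, mem_nbr]
      tauto
    have := (card_le_card h2).trans (card_union_le _ _)
    omega
  · rintro S hS ⟨v, hvS, hvA⟩ hSk U hU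
    obtain ⟨T', h1, h2, h3⟩ := exists_supp_superset hE hS (by omega)
    have h4 := hco T' h2 h3
    have h5 : A' ∩ exts E T' ⊆ nbr E v A' := by
      intro u hu
      rw [mem_inter, mem_exts] at hu
      rw [mem_nbr]
      refine ⟨hu.1, fun h => hu.2.1 (h ▸ h1 hvS), hu.2.2.mono ?_⟩
      intro y hy
      rw [mem_insert, mem_singleton] at hy
      rcases hy with rfl | rfl
      · exact mem_insert_self _ _
      · exact mem_insert_of_mem (h1 hvS)
    have h6 : U ∪ (A' \ exts E T') ⊆ univ \ exts E T' := by
      intro u hu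
      rw [mem_sdiff]
      refine ⟨mem_univ _, fun h => ?_⟩
      rcases mem_union.1 hu with hu | hu
      · exact (hU u hu).2 ((mem_exts.1 h).2.mono (insert_subset_insert _ h1))
      · exact (mem_sdiff.1 hu).2 h
    have h7 : Disjoint U (A' \ exts E T') := by
      rw [Finset.disjoint_left]
      intro u hu hu'
      exact (hU u hu).1 (mem_sdiff.1 hu').1
    have h8 := card_le_card h6
    rw [card_union_of_disjoint h7] at h8
    have h9 := card_sdiff_add_card_eq_card (subset_univ (exts E T'))
    rw [card_univ] at h9
    have h10 := card_sdiff_add_card_inter A' (exts E T')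
    have h11 := (card_le_card h5).trans (hnbrA' v hvA)
    omega
  · intro v hv
    have h1 : A' \ nbr E v A' ⊆ univ \ nbr E v univ := by
      intro u hu
      rw [mem_sdiff, mem_nbr] at hu
      rw [mem_sdiff, mem_nbr]
      exact ⟨mem_univ _, fun h => hu.2 ⟨hu.1, h.2⟩⟩
    have h2 := card_le_card h1
    have h3 := card_sdiff_add_card_eq_card (nbr_subset (E := E) (v := v) (C := A'))
    have := hnon v
    omega

end Structure

section Gadgets

variable {V : Type*} [DecidableEq V]

theorem exists_disjoint_family {Γ : Type*} [Nonempty Γ] (supp : ℕ → Γ → Finset V)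
    (P : ℕ → Γ → Prop) (B N : ℕ) (F₀ : Finset V)
    (hstep : ∀ j < N, ∀ F, F₀ ⊆ F → (F \ F₀).card ≤ B * j →
      ∃ γ, P j γ ∧ (supp j γ).card ≤ B ∧ Disjoint (supp j γ) F) :
    ∃ g : ℕ → Γ, ∀ j < N, P j (g j) ∧ (supp j (g j)).card ≤ B ∧ Disjoint (supp j (g j)) F₀ ∧
      ∀ i < j, Disjoint (supp j (g j)) (supp i (g i)) := by
  induction N with
  | zero => exact ⟨fun _ => Classical.arbitrary Γ, fun j hj => absurd hj (Nat.not_lt_zero j)⟩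
  | succ N ih =>
    obtain ⟨g, hg⟩ := ih fun j hj => hstep j (by omega)
    set U := (range N).biUnion fun j => supp j (g j) with hU
    have hUc : U.card ≤ B * N := by
      refine card_biUnion_le.trans ?_
      refine (sum_le_card_nsmul _ _ B fun j hj => (hg j (mem_range.1 hj)).2.1).trans ?_
      rw [card_range, smul_eq_mul, mul_comm]
    obtain ⟨γ, h1, h2, h3⟩ := hstep N (by omega) (F₀ ∪ U) subset_union_left
      ((card_le_card (by rw [union_sdiff_left]; exact sdiff_subset)).trans hUc)
    rw [disjoint_union_right] at h3
    refine ⟨Function.update g N γ, fun j hj => ?_⟩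
    rcases Nat.lt_succ_iff_lt_or_eq.1 hj with hj | rfl
    · rw [Function.update_of_ne hj.ne]
      refine ⟨(hg j hj).1, (hg j hj).2.1, (hg j hj).2.2.1, fun i hi => ?_⟩
      rw [Function.update_of_ne (by omega)]
      exact (hg j hj).2.2.2 i hi
    · rw [Function.update_self]
      refine ⟨h1, h2, h3.1, fun i hi => ?_⟩
      rw [Function.update_of_ne hi.ne]
      exact disjoint_of_subset_right
        (subset_biUnion_of_mem (fun j => supp j (g j)) (mem_range.2 hi)) h3.2

theorem exists_enum [Nonempty V] (S : Finset V) : ∃ f : ℕ → V,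
    Set.InjOn f (range S.card) ∧ (range S.card).image f = S := by
  have himg : ∃ f : ℕ → V, (range S.card).image f = S := by
    refine ⟨fun i => if h : i < S.card then (S.equivFin.symm ⟨i, h⟩ : V) else
      Classical.arbitrary V, ?_⟩
    ext v
    rw [mem_image]
    constructor
    · rintro ⟨i, hi, rfl⟩
      rw [mem_range] at hi
      rw [dif_pos hi]
      exact (S.equivFin.symm ⟨i, hi⟩).2
    · intro hv
      refine ⟨S.equivFin ⟨v, hv⟩, mem_range.2 (S.equivFin ⟨v, hv⟩).2, ?_⟩
      rw [dif_pos (S.equivFin ⟨v, hv⟩).2]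
      simp
  obtain ⟨f, hf⟩ := himg
  exact ⟨f, injOn_of_card_image_eq (by rw [hf, card_range]), hf⟩

theorem exists_enum_extending [Nonempty V] (S : Finset V) (M : ℕ) (g : ℕ → V)
    (hinj : Set.InjOn g (range M)) (hS : ∀ i < M, g i ∈ S) :
    ∃ f : ℕ → V, (∀ i < M, f i = g i) ∧ Set.InjOn f (range S.card) ∧
      (range S.card).image f = S := by
  set R := (range M).image g with hR
  have hRS : R ⊆ S := by
    intro v hv
    obtain ⟨i, hi, rfl⟩ := mem_image.1 hv
    exact hS i (mem_range.1 hi)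
  have hRc : R.card = M := by rw [hR, card_image_of_injOn hinj, card_range]
  obtain ⟨e, _, he⟩ := exists_enum (S \ R)
  have hc := card_sdiff_add_card_eq_card hRS
  have himg : (range S.card).image (fun i => if i < M then g i else e (i - M)) = S := by
    ext v
    rw [mem_image]
    constructor
    · rintro ⟨i, hi, rfl⟩
      rw [mem_range] at hi
      split_ifs with h
      · exact hS i h
      · have : e (i - M) ∈ S \ R := by
          rw [← he]
          exact mem_image_of_mem _ (mem_range.2 (by omega))
        exact (mem_sdiff.1 this).1
    · intro hv
      by_cases hvR : v ∈ R
      · obtain ⟨i, hi, rfl⟩ := mem_image.1 hvR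
        rw [mem_range] at hi
        exact ⟨i, mem_range.2 (by omega), if_pos hi⟩
      · have : v ∈ S \ R := mem_sdiff.2 ⟨hv, hvR⟩
        rw [← he] at this
        obtain ⟨i, hi, rfl⟩ := mem_image.1 this
        rw [mem_range] at hi
        refine ⟨i + M, mem_range.2 (by omega), ?_⟩
        rw [if_neg (by omega), Nat.add_sub_cancel]
  exact ⟨_, fun i hi => if_pos hi, injOn_of_card_image_eq (by rw [himg, card_range]), himg⟩

theorem NearExtremal.exists_common {E : Finset (Finset V)} {k a G h : ℕ} {A X : Finset V}
    (H : NearExtremal E k a G h A X) (F : Finset V) (S S' : Finset V)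
    (hS : Supp E S) (hS' : Supp E S') (hSA : ∃ v ∈ S, v ∈ A) (hSA' : ∃ v ∈ S', v ∈ A)
    (hSk : S.card < k) (hSk' : S'.card < k)
    (U : Finset V) (hU : F.card + 8 * G < U.card) (hUA : Disjoint U A) :
    ∃ b ∈ U, b ∉ F ∧ Supp E (insert b S) ∧ Supp E (insert b S') := by
  classical
  by_contra hcon
  push Not at hcon
  have hsub : U ⊆ F ∪ ((U.filter fun b => ¬ Supp E (insert b S)) ∪
      (U.filter fun b => ¬ Supp E (insert b S'))) := by
    intro b hb
    rw [mem_union, mem_union, mem_filter, mem_filter]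
    have := hcon b hb
    tauto
  have hout : ∀ b ∈ U, b ∉ A := fun b hb => Finset.disjoint_left.1 hUA hb
  have h1 := H.exts_le S hS hSA hSk (U.filter fun b => ¬ Supp E (insert b S)) fun b hb =>
    ⟨hout b (mem_filter.1 hb).1, (mem_filter.1 hb).2⟩
  have h2 := H.exts_le S' hS' hSA' hSk' (U.filter fun b => ¬ Supp E (insert b S')) fun b hb =>
    ⟨hout b (mem_filter.1 hb).1, (mem_filter.1 hb).2⟩
  have h3 := (card_le_card hsub).trans (card_union_le _ _)
  have h4 := card_union_le (U.filter fun b => ¬ Supp E (insert b S))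
    (U.filter fun b => ¬ Supp E (insert b S'))
  omega

theorem NearExtremal.exists_cherry {E : Finset (Finset V)} {k a G h : ℕ} {A X : Finset V}
    (H : NearExtremal E k a G h A X) {x : ℕ} (hx : A.card = a + x) (hx1 : 1 ≤ x)
    (F : Finset V) (c : ℕ) (hF : (F ∩ A).card ≤ c * x) (hA : c * x + 2 * c * G < A.card) :
    ∃ p ∈ A, ∃ q ∈ A, ∃ z ∈ A, p ≠ q ∧ p ≠ z ∧ q ≠ z ∧ Supp E {z, p} ∧ Supp E {z, q} ∧
      p ∉ F ∧ q ∉ F ∧ z ∉ F := by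
  classical
  by_contra hcon
  have hdeg : ∀ z ∈ A \ F, x ≤ (nbr E z (F ∩ A)).card := by
    intro z hz
    rw [mem_sdiff] at hz
    have h1 := H.lt_nbr z hz.1
    have h2 : (nbr E z (A \ F)).card ≤ 1 := by
      rw [card_le_one]
      intro p hp q hq
      by_contra hpq
      rw [mem_nbr, mem_sdiff] at hp hq
      exact hcon ⟨p, hp.1.1, q, hq.1.1, z, hz.1, hpq, hp.2.1, hq.2.1,
        by rw [pair_comm]; exact hp.2.2, by rw [pair_comm]; exact hq.2.2, hp.1.2, hq.1.2, hz.2⟩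
    have h3 : nbr E z A ⊆ nbr E z (F ∩ A) ∪ nbr E z (A \ F) := by
      intro v hv
      rw [mem_nbr] at hv
      rw [mem_union, mem_nbr, mem_nbr, mem_inter, mem_sdiff]
      tauto
    have h4 := (card_le_card h3).trans (card_union_le _ _)
    omega
  have hdc : (A \ F).card * x ≤ (F ∩ A).card * (2 * G) := by
    calc (A \ F).card * x ≤ ∑ z ∈ A \ F, (nbr E z (F ∩ A)).card := by
          rw [← smul_eq_mul]; exact card_nsmul_le_sum _ _ _ hdeg
      _ = ∑ z ∈ A \ F, ((F ∩ A).filter fun v => v ≠ z ∧ Supp E {v, z}).card := by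
          refine sum_congr rfl fun z _ => ?_
          congr 1
      _ = ∑ v ∈ F ∩ A, ((A \ F).filter fun z => v ≠ z ∧ Supp E {v, z}).card := by
          simp_rw [card_filter]; exact sum_comm
      _ ≤ (F ∩ A).card * (2 * G) := by
          rw [← smul_eq_mul]
          refine sum_le_card_nsmul _ _ _ fun v hv => ?_
          refine (card_le_card ?_).trans (H.nbr_le v (mem_inter.1 hv).2)
          intro z hz
          rw [mem_filter] at hz
          rw [mem_nbr]
          exact ⟨(mem_sdiff.1 hz.1).1, hz.2.1.symm, by rw [pair_comm]; exact hz.2.2⟩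
  have h5 := card_sdiff_add_card_inter A F
  rw [inter_comm] at h5
  have h6 : (A \ F).card * x ≤ 2 * c * G * x := by
    calc (A \ F).card * x ≤ (F ∩ A).card * (2 * G) := hdc
      _ ≤ c * x * (2 * G) := Nat.mul_le_mul_right _ hF
      _ = 2 * c * G * x := by ring
  have h7 := Nat.le_of_mul_le_mul_right h6 hx1
  omega

variable [Fintype V]

theorem NearExtremal.exists_common_seq [Nonempty V] {E : Finset (Finset V)} {k a G h : ℕ}
    {A X : Finset V}
    (H : NearExtremal E k a G h A X) (F : Finset V) {p q : V} (hp : p ∈ A) (hq : q ∈ A)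
    (hpE : Supp E {p}) (hqE : Supp E {q})
    (hA : F.card + k + 8 * G + A.card < Fintype.card V) (m : ℕ) (hm : m + 1 ≤ k) :
    ∃ b : ℕ → V, Set.InjOn b (range m) ∧ (∀ i < m, b i ∉ A ∧ b i ∉ F) ∧
      Supp E (insert p ((range m).image b)) ∧ Supp E (insert q ((range m).image b)) := by
  induction m with
  | zero =>
    refine ⟨fun _ => Classical.arbitrary V, by simp, by simp, ?_, ?_⟩ <;> simpa
  | succ m ih =>
    obtain ⟨b, h1, h2, h3, h4⟩ := ih (by omega)
    have hc : ((range m).image b).card ≤ m := card_image_le.trans (card_range m).le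
    have hcA := card_sdiff_add_card_eq_card (subset_univ A)
    rw [card_univ] at hcA
    have hFc := card_union_le F ((range m).image b)
    obtain ⟨y, hy, hyF, hy1, hy2⟩ := H.exists_common (F ∪ (range m).image b) _ _ h3 h4
      ⟨p, mem_insert_self _ _, hp⟩ ⟨q, mem_insert_self _ _, hq⟩
      (lt_of_le_of_lt (card_insert_le _ _) (by omega))
      (lt_of_le_of_lt (card_insert_le _ _) (by omega))
      (univ \ A) (by omega) sdiff_disjoint
    rw [mem_union, not_or] at hyF
    have himg : (range (m + 1)).image (Function.update b m y) =
        insert y ((range m).image b) := by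
      rw [range_add_one, image_insert, Function.update_self]
      congr 1
      refine image_congr fun i hi => ?_
      rw [coe_range, Set.mem_Iio] at hi
      rw [Function.update_of_ne hi.ne]
    refine ⟨Function.update b m y, ?_, ?_, ?_, ?_⟩
    · refine injOn_of_card_image_eq ?_
      rw [himg, card_insert_of_notMem hyF.2, card_image_of_injOn h1, card_range, card_range]
    · intro i hi
      rcases Nat.lt_succ_iff_lt_or_eq.1 hi with hi | rfl
      · rw [Function.update_of_ne hi.ne]
        exact h2 i hi
      · rw [Function.update_self]
        exact ⟨(mem_sdiff.1 hy).2, hyF.1⟩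
    · rw [himg, Finset.insert_comm]; exact hy1
    · rw [himg, Finset.insert_comm]; exact hy2

/-- The vertices `p`, `q` in `A` and `e 0, …, e (k - 1)` outside `A` form a bridge: the latter are
an edge, whose first and last `k - 1` vertices form a supported set with `p` and `q`. -/
structure IsBridge (E : Finset (Finset V)) (k : ℕ) (A : Finset V) (p q : V) (e : ℕ → V) :
    Prop where
  injOn : Set.InjOn e (range k)
  notMem : ∀ i < k, e i ∉ A
  supp : Supp E ((range k).image e)
  supp_left : Supp E (insert p ((range (k - 1)).image e))
  supp_right : Supp E (insert q ((Ico 1 k).image e))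

theorem NearExtremal.exists_bridge {E : Finset (Finset V)} {k a G h : ℕ} {A X : Finset V}
    (H : NearExtremal E k a G h A X) (hk : 3 ≤ k) (hcov : ∀ v, ∃ e ∈ E, v ∈ e)
    (hco : ∀ S : Finset V, S.card = k - 1 → Supp E S →
      Fintype.card V ≤ (exts E S).card + a + (k - 3))
    (ha : 3 * a ≤ Fintype.card V) (F : Finset V) (hF : F.card + 2 * k + 8 * G + h < a)
    {p q : V} (hp : p ∈ A) (hq : q ∈ A) :
    ∃ e, IsBridge E k A p q e ∧ ∀ i < k, e i ∉ F := by
  classical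
  have : Nonempty V := ⟨p⟩
  have hcov' : ∀ v, Supp E {v} := fun v => by
    obtain ⟨e, he, hv⟩ := hcov v
    exact ⟨e, he, by simpa using hv⟩
  have hup := H.upper
  obtain ⟨b, h1, h2, h3, h4⟩ := H.exists_common_seq F hp hq (hcov' p) (hcov' q) (by omega)
    (k - 2) (by omega)
  set R := (range (k - 2)).image b with hR
  have hRc : R.card = k - 2 := by rw [hR, card_image_of_injOn h1, card_range]
  have hcA := card_sdiff_add_card_eq_card (subset_univ A)
  rw [card_univ] at hcA
  have hip := card_insert_le p R
  have hiq := card_insert_le q R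
  have hFR := card_union_le F R
  obtain ⟨y, hy, hyF, hy1, -⟩ := H.exists_common (F ∪ R) _ _ h3 h3
    ⟨p, mem_insert_self _ _, hp⟩ ⟨p, mem_insert_self _ _, hp⟩ (by omega) (by omega)
    (univ \ A) (by omega) sdiff_disjoint
  rw [mem_union, not_or] at hyF
  have hyc : (insert y R).card = k - 1 := by
    rw [card_insert_of_notMem hyF.2]
    omega
  have hyS : Supp E (insert y R) := hy1.mono (insert_subset_insert _ (subset_insert _ _))
  have hext := hco _ hyc hyS
  have hextA : (exts E (insert y R)).card ≤ (exts E (insert y R) \ A).card + A.card := by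
    have := card_le_card_sdiff_add_card (s := exts E (insert y R)) (t := A)
    omega
  obtain ⟨w, hw, hwF, hw1, -⟩ := H.exists_common F _ _ h4 h4
    ⟨q, mem_insert_self _ _, hq⟩ ⟨q, mem_insert_self _ _, hq⟩ (by omega) (by omega)
    (exts E (insert y R) \ A) (by omega) sdiff_disjoint
  rw [mem_sdiff, mem_exts] at hw
  set e : ℕ → V := fun i => if i = 0 then y else if i < k - 1 then b (i - 1) else w with he
  have hmid : (Ico 1 (k - 1)).image e = R := by
    ext v
    simp only [mem_image, mem_Ico, hR, mem_range]
    constructor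
    · rintro ⟨i, hi, rfl⟩
      refine ⟨i - 1, by omega, ?_⟩
      rw [he]
      simp only
      rw [if_neg (by omega), if_pos (by omega)]
    · rintro ⟨i, hi, rfl⟩
      refine ⟨i + 1, by omega, ?_⟩
      rw [he]
      simp only
      rw [if_neg (by omega), if_pos (by omega), Nat.add_sub_cancel]
  have e0 : e 0 = y := by rw [he]; simp
  have ek : e (k - 1) = w := by
    rw [he]
    simp only
    rw [if_neg (by omega), if_neg (by omega)]
  have hfront : (range (k - 1)).image e = insert y R := by
    have : range (k - 1) = insert 0 (Ico 1 (k - 1)) := by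
      ext i; simp only [mem_range, mem_insert, mem_Ico]; omega
    rw [this, image_insert, hmid, e0]
  have hback : (Ico 1 k).image e = insert w R := by
    have : Ico 1 k = insert (k - 1) (Ico 1 (k - 1)) := by
      ext i; simp only [mem_insert, mem_Ico]; omega
    rw [this, image_insert, hmid, ek]
  have hall : (range k).image e = insert w (insert y R) := by
    have : range k = insert (k - 1) (range (k - 1)) := by
      ext i; simp only [mem_range, mem_insert]; omega
    rw [this, image_insert, hfront, ek]
  have hin : ∀ i < k, e i ∈ insert w (insert y R) := fun i hi => by
    rw [← hall]; exact mem_image_of_mem _ (mem_range.2 hi)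
  have hgood : ∀ v ∈ insert w (insert y R), v ∉ A ∧ v ∉ F := by
    intro v hv
    rw [mem_insert, mem_insert] at hv
    rcases hv with rfl | rfl | hv
    · exact ⟨hw.2, hwF⟩
    · exact ⟨(mem_sdiff.1 hy).2, hyF.1⟩
    · obtain ⟨i, hi, rfl⟩ := mem_image.1 hv
      exact h2 i (mem_range.1 hi)
  refine ⟨e, ⟨?_, fun i hi => (hgood _ (hin i hi)).1, ?_, ?_, ?_⟩,
    fun i hi => (hgood _ (hin i hi)).2⟩
  · refine injOn_of_card_image_eq ?_
    rw [hall, card_insert_of_notMem hw.1.1, hyc, card_range]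
    omega
  · rw [hall]; exact hw.1.2
  · rw [hfront, Finset.insert_comm]; exact hy1
  · rw [hback, Finset.insert_comm]; exact hw1

end Gadgets

section Filling

variable {V : Type*} [DecidableEq V]

/-- An assignment of the vertices of `A ∪ X` to the slots of a cyclic arrangement: `av` lists the
vertices of `A` that are responsible for the windows containing them, `z` the remaining vertices of
`A ∪ X`, and `e` the bridges. -/
structure Filling (E : Finset (Finset V)) (k b c u : ℕ) (A X : Finset V) (av z : ℕ → V)
    (e : ℕ → ℕ → V) : Prop where
  injOn_av : Set.InjOn av (range b)
  injOn_z : Set.InjOn z (range c)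
  e_inj : ∀ j < u, ∀ i < k, ∀ j' < u, ∀ i' < k, e j i = e j' i' → j = j' ∧ i = i'
  av_mem : ∀ i < b, av i ∈ A
  z_mem : ∀ j < c, z j ∈ A ∪ X
  e_notMem : ∀ j < u, ∀ i < k, e j i ∉ A ∪ X
  av_ne_z : ∀ i < b, ∀ j < c, av i ≠ z j
  cover : A ∪ X ⊆ (range b).image av ∪ (range c).image z
  bridge : ∀ j < u, IsBridge E k A (av (2 * j)) (av (2 * j + 1)) (e j)
  supp_z : ∀ j < c, ∀ i, i = 2 * (u + j) ∨ i = 2 * (u + j) + 1 → Supp E {z j, av i}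

variable [Fintype V]

theorem NearExtremal.exists_filling {E : Finset (Finset V)} {k a G h : ℕ} {A X : Finset V}
    (H : NearExtremal E k a G h A X) (hk : 3 ≤ k) (hcov : ∀ v, ∃ e ∈ E, v ∈ e)
    (hco : ∀ S : Finset V, S.card = k - 1 → Supp E S →
      Fintype.card V ≤ (exts E S).card + a + (k - 3))
    (ha : 3 * a ≤ Fintype.card V) {x c u : ℕ} (hx : x = A.card - a) (hc : c = x + X.card)
    (hbr : (k + 2) * (c + u) + X.card + 2 * k + 8 * G + h + 2 < a)
    (hG : 2 * ((k + 2) * (c + u) + 2) ≤ G) (hA : (k + 2) * x + 2 * (k + 2) * G < A.card)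
    (hb : 2 * (c + u) ≤ A.card - x) :
    ∃ av z e, Filling E k (A.card - x) c u A X av z e := by
  classical
  have hlow := H.lower
  obtain ⟨v₀, hv₀⟩ : A.Nonempty := card_pos.1 (by omega)
  have : Nonempty V := ⟨v₀⟩
  obtain ⟨xe, hxi, hxe⟩ := exists_enum X
  have hXA : ∀ v ∈ A, v ∉ X := fun v h => Finset.disjoint_left.1 H.disj h
  have hxeX : ∀ j < X.card, xe j ∈ X := fun j hj => by
    have := mem_image_of_mem xe (mem_range.2 hj)
    rwa [hxe] at this
  let supp : ℕ → (ℕ → V) → Finset V := fun j γ =>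
    if j < x then {γ 0, γ 1, γ 2} else if j < c then {γ 0, γ 1} else
      insert (γ 0) (insert (γ 1) ((range k).image fun i => γ (i + 2)))
  let P : ℕ → (ℕ → V) → Prop := fun j γ =>
    γ 0 ∈ A ∧ γ 1 ∈ A ∧ γ 0 ≠ γ 1 ∧ (j < x → γ 2 ∈ A ∧ γ 0 ≠ γ 2 ∧ γ 1 ≠ γ 2) ∧
      (x ≤ j → j < c → γ 2 = xe (j - x)) ∧ (j < c → Supp E {γ 2, γ 0} ∧ Supp E {γ 2, γ 1}) ∧
      (c ≤ j → IsBridge E k A (γ 0) (γ 1) (fun i => γ (i + 2)) ∧ ∀ i < k, γ (i + 2) ∉ X)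
  have hstep : ∀ j < c + u, ∀ F, X ⊆ F → (F \ X).card ≤ (k + 2) * j →
      ∃ γ, P j γ ∧ (supp j γ).card ≤ k + 2 ∧ Disjoint (supp j γ) F := by
    intro j hj F hXF hF
    have hFA : (F ∩ A).card ≤ (k + 2) * j := by
      refine (card_le_card fun v hv => ?_).trans hF
      rw [mem_inter] at hv
      exact mem_sdiff.2 ⟨hv.1, hXA v hv.2⟩
    have hjc : (k + 2) * j ≤ (k + 2) * (c + u) := Nat.mul_le_mul_left _ hj.le
    rcases lt_or_ge j x with hjx | hjx
    · obtain ⟨p, hp, q, hq, z, hz, h1, h2, h3, h4, h5, h6, h7, h8⟩ :=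
        H.exists_cherry (x := x) (by omega) (by omega) F (k + 2)
          (hFA.trans (Nat.mul_le_mul_left _ hjx.le)) hA
      refine ⟨fun i => if i = 0 then p else if i = 1 then q else z, ?_, ?_, ?_⟩
      · refine ⟨by simpa, by simpa, by simpa, fun _ => by simpa using ⟨hz, h2, h3⟩,
          fun h => by omega, fun _ => by simpa using ⟨h4, h5⟩, fun h => by omega⟩
      · simp only [supp, if_pos hjx]
        exact card_le_three.trans (by omega)
      · simp only [supp, if_pos hjx]
        simp [h6, h7, h8]
    · rcases lt_or_ge j c with hjc' | hjc'
      · have hz := hxeX (j - x) (by omega)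
        have hzA : xe (j - x) ∉ A := fun h => hXA _ h hz
        have h1 := H.le_nbr _ hzA
        have h2 : 1 < (nbr E (xe (j - x)) A \ F).card := by
          have h3 := card_sdiff_add_card_inter (nbr E (xe (j - x)) A) F
          have h4 : (nbr E (xe (j - x)) A ∩ F).card ≤ (F ∩ A).card := by
            rw [inter_comm]
            exact card_le_card (inter_subset_inter_left nbr_subset)
          omega
        obtain ⟨p, hp, q, hq, hpq⟩ := one_lt_card.1 h2
        rw [mem_sdiff, mem_nbr] at hp hq
        refine ⟨fun i => if i = 0 then p else if i = 1 then q else xe (j - x), ?_, ?_, ?_⟩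
        · refine ⟨by simpa using hp.1.1, by simpa using hq.1.1, by simpa, fun h => by omega,
            fun _ _ => by simp, fun _ => ?_, fun h => by omega⟩
          simp only [OfNat.ofNat_ne_zero, if_false, OfNat.ofNat_ne_one, if_true, one_ne_zero]
          rw [pair_comm, pair_comm _ q]
          exact ⟨hp.1.2.2, hq.1.2.2⟩
        · simp only [supp, if_neg hjx.not_gt, if_pos hjc']
          exact card_le_two.trans (by omega)
        · simp only [supp, if_neg hjx.not_gt, if_pos hjc']
          simp [hp.2, hq.2]
      · have h2 : 1 < (A \ F).card := by
          have h3 := card_sdiff_add_card_inter A F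
          rw [inter_comm] at h3
          omega
        obtain ⟨p, hp, q, hq, hpq⟩ := one_lt_card.1 h2
        rw [mem_sdiff] at hp hq
        have hFc : F.card ≤ (F \ X).card + X.card := by
          rw [card_sdiff_add_card_eq_card hXF]
        obtain ⟨e, he, heF⟩ := H.exists_bridge hk hcov hco ha F (by omega) hp.1 hq.1
        have hfun : (fun i => (fun i => if i = 0 then p else if i = 1 then q else e (i - 2))
            (i + 2)) = e := by
          funext i
          simp
        refine ⟨fun i => if i = 0 then p else if i = 1 then q else e (i - 2), ?_, ?_, ?_⟩
        · refine ⟨by simpa using hp.1, by simpa using hq.1, by simpa, fun h => by omega,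
            fun _ h => by omega, fun h => by omega, fun _ => ⟨?_, ?_⟩⟩
          · rw [hfun]; simpa using he
          · intro i hi
            have := congrFun hfun i
            simp only at this ⊢
            rw [this]
            exact fun h => heF i hi (hXF h)
        · simp only [supp, if_neg hjx.not_gt, if_neg hjc'.not_gt]
          refine (card_insert_le _ _).trans (Nat.succ_le_succ ((card_insert_le _ _).trans
            (Nat.succ_le_succ (card_image_le.trans (card_range k).le))))
        · simp only [supp, if_neg hjx.not_gt, if_neg hjc'.not_gt]
          rw [hfun]
          simp only [if_true, one_ne_zero, if_false]
          rw [disjoint_insert_left, disjoint_insert_left, Finset.disjoint_left]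
          refine ⟨hp.2, hq.2, fun v hv => ?_⟩
          obtain ⟨i, hi, rfl⟩ := mem_image.1 hv
          exact heF i (mem_range.1 hi)
  obtain ⟨g, hg⟩ := exists_disjoint_family supp P (k + 2) (c + u) X hstep
  have hdis : ∀ i < c + u, ∀ j < c + u, ∀ v, v ∈ supp i (g i) → v ∈ supp j (g j) → i = j := by
    intro i hi j hj v hvi hvj
    rcases lt_trichotomy i j with h | h | h
    · exact absurd hvi (Finset.disjoint_left.1 ((hg j hj).2.2.2 i h) hvj)
    · exact h
    · exact absurd hvj (Finset.disjoint_left.1 ((hg i hi).2.2.2 j h) hvi)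
  have hs0 : ∀ j, g j 0 ∈ supp j (g j) := fun j => by
    simp only [supp]; split_ifs <;> simp
  have hs1 : ∀ j, g j 1 ∈ supp j (g j) := fun j => by
    simp only [supp]; split_ifs <;> simp
  have hs2 : ∀ j < x, g j 2 ∈ supp j (g j) := fun j hj => by
    simp only [supp, if_pos hj]; simp
  have hse : ∀ j, c ≤ j → ∀ i < k, g j (i + 2) ∈ supp j (g j) := fun j hj i hi => by
    simp only [supp, if_neg (show ¬ j < x by omega), if_neg (show ¬ j < c by omega)]
    exact mem_insert_of_mem (mem_insert_of_mem (mem_image.2 ⟨i, mem_range.2 hi, rfl⟩))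
  have hzX : ∀ j, x ≤ j → j < c → g j 2 = xe (j - x) := fun j h1 h2 =>
    (hg j (by omega)).1.2.2.2.2.1 h1 h2
  have hzA : ∀ j < x, g j 2 ∈ A ∧ g j 0 ≠ g j 2 ∧ g j 1 ≠ g j 2 := fun j h1 =>
    (hg j (by omega)).1.2.2.2.1 h1
  have hzinj : Set.InjOn (fun j => g j 2) (range c) := by
    intro i hi j hj hij
    rw [coe_range, Set.mem_Iio] at hi hj
    simp only at hij
    rcases lt_or_ge i x with hix | hix <;> rcases lt_or_ge j x with hjx | hjx
    · exact hdis i (by omega) j (by omega) _ (hs2 i hix) (hij ▸ hs2 j hjx)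
    · have h1 := (hzA i hix).1
      rw [hij, hzX j hjx hj] at h1
      exact absurd (hxeX _ (by omega)) (hXA _ h1)
    · have h1 := (hzA j hjx).1
      rw [← hij, hzX i hix hi] at h1
      exact absurd (hxeX _ (by omega)) (hXA _ h1)
    · rw [hzX i hix hi, hzX j hjx hj] at hij
      have := hxi (by rw [coe_range, Set.mem_Iio]; omega) (by rw [coe_range, Set.mem_Iio]; omega)
        hij
      omega
  set S := A \ (range x).image (fun j => g j 2) with hS
  have hSc : S.card = A.card - x := by
    rw [hS, card_sdiff_of_subset, card_image_of_injOn, card_range]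
    · exact hzinj.mono (by rw [coe_range, coe_range]; exact Set.Iio_subset_Iio (by omega))
    · intro v hv
      obtain ⟨i, hi, rfl⟩ := mem_image.1 hv
      exact (hzA i (mem_range.1 hi)).1
  let idx : ℕ → ℕ := fun j => if j < u then c + j else j - u
  have hidx : ∀ j < c + u, idx j < c + u := fun j hj => by
    simp only [idx]; split_ifs <;> omega
  have hidx_inj : ∀ i < c + u, ∀ j < c + u, idx i = idx j → i = j := fun i hi j hj => by
    simp only [idx]; split_ifs <;> omega
  have hmod : ∀ i : ℕ, i % 2 = 0 ∨ i % 2 = 1 := fun i => by omega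
  have hs01 : ∀ i j, g j (i % 2) ∈ supp j (g j) := fun i j => by
    rcases hmod i with h | h <;> rw [h]
    exacts [hs0 j, hs1 j]
  obtain ⟨av, hav, havinj, havS⟩ := exists_enum_extending S (2 * (c + u))
    (fun i => g (idx (i / 2)) (i % 2)) (by
      intro i hi j hj hij
      rw [coe_range, Set.mem_Iio] at hi hj
      simp only at hij
      have h1 := hdis _ (hidx (i / 2) (by omega)) _ (hidx (j / 2) (by omega)) _ (hs01 i _)
        (hij ▸ hs01 j _)
      have h2 := hidx_inj _ (by omega) _ (by omega) h1
      rw [← h1] at hij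
      have h3 := (hg _ (hidx (i / 2) (by omega))).1.2.2.1
      rcases hmod i with h | h <;> rcases hmod j with h' | h' <;> rw [h, h'] at hij
      · omega
      · exact absurd hij h3
      · exact absurd hij.symm h3
      · omega) (by
      intro i hi
      have h1 := (hg _ (hidx (i / 2) (by omega))).1
      rw [hS, mem_sdiff]
      refine ⟨?_, fun hmem => ?_⟩
      · rcases hmod i with h | h <;> rw [h]
        exacts [h1.1, h1.2.1]
      · obtain ⟨j, hj, hji⟩ := mem_image.1 hmem
        rw [mem_range] at hj
        have h2 := hdis j (by omega) _ (hidx (i / 2) (by omega)) _ (hs2 j hj) (hji ▸ hs01 i _)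
        rw [← h2] at hji
        rcases hmod i with h | h <;> rw [h] at hji
        exacts [(hzA j hj).2.1 hji.symm, (hzA j hj).2.2 hji.symm])
  rw [hSc] at havinj havS
  have havmem : ∀ i < A.card - x, av i ∈ S := fun i hi => by
    rw [← havS]; exact mem_image_of_mem _ (mem_range.2 hi)
  have hav0 : ∀ j < c + u, av (2 * j) = g (idx j) 0 := fun j hj => by
    rw [hav _ (by omega)]
    congr 2 <;> omega
  have hav1 : ∀ j < c + u, av (2 * j + 1) = g (idx j) 1 := fun j hj => by
    rw [hav _ (by omega)]
    congr 2 <;> omega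
  have hbridge := fun j (hj : j < u) => (hg (c + j) (by omega)).1.2.2.2.2.2.2 (by omega)
  refine ⟨av, fun j => g j 2, fun j i => g (c + j) (i + 2), havinj, hzinj, ?_, ?_, ?_, ?_, ?_, ?_,
    ?_, ?_⟩
  · intro j hj i hi j' hj' i' hi' heq
    have h1 := hdis (c + j) (by omega) (c + j') (by omega) _ (hse _ (by omega) i hi)
      (heq ▸ hse _ (by omega) i' hi')
    have h2 : j = j' := by omega
    subst h2
    exact ⟨rfl, (hbridge j hj).1.injOn (by simpa using hi) (by simpa using hi') heq⟩
  · exact fun i hi => (mem_sdiff.1 (havmem i hi)).1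
  · intro j hj
    rw [mem_union]
    rcases lt_or_ge j x with hjx | hjx
    · exact Or.inl (hzA j hjx).1
    · rw [hzX j hjx hj]
      exact Or.inr (hxeX _ (by omega))
  · intro j hj i hi hmem
    rcases mem_union.1 hmem with h | h
    · exact (hbridge j hj).1.notMem i hi h
    · exact (hbridge j hj).2 i hi h
  · intro i hi j hj hij
    have h1 := havmem i hi
    rw [hS, mem_sdiff] at h1
    rcases lt_or_ge j x with hjx | hjx
    · exact h1.2 (hij ▸ mem_image.2 ⟨j, mem_range.2 hjx, rfl⟩)
    · rw [hij, hzX j hjx hj] at h1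
      exact hXA _ h1.1 (hxeX _ (by omega))
  · intro v hv
    rw [mem_union]
    by_cases hvx : v ∈ (range x).image (fun j => g j 2)
    · right
      exact image_subset_image (range_subset_range.2 (by omega)) hvx
    · rcases mem_union.1 hv with hv | hv
      · left
        rw [havS]
        exact mem_sdiff.2 ⟨hv, hvx⟩
      · right
        rw [← hxe] at hv
        obtain ⟨i, hi, rfl⟩ := mem_image.1 hv
        rw [mem_range] at hi
        refine mem_image.2 ⟨x + i, mem_range.2 (by omega), ?_⟩
        rw [hzX _ (by omega) (by omega), Nat.add_sub_cancel_left]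
  · intro j hj
    rw [hav0 j (by omega), hav1 j (by omega)]
    simp only [idx, if_pos hj]
    exact (hbridge j hj).1
  · intro j hj i hi
    have h1 := (hg j (by omega)).1.2.2.2.2.2.1 hj
    have h2 : idx (u + j) = j := by
      simp only [idx, if_neg (show ¬ u + j < u by omega), Nat.add_sub_cancel_left]
    rcases hi with rfl | rfl
    · rw [hav0 _ (by omega), h2]; exact h1.1
    · rw [hav1 _ (by omega), h2]; exact h1.2

end Filling

section Layout

/-- The first window of the `i`-th block: every block consists of `r` consecutive windows, and
the blocks number `0, 2, …, 2 (u - 1)` are followed by one additional window. -/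
def blockStart (r u i : ℕ) : ℕ := r * i + min ((i + 1) / 2) u

/-- The position behind the last window start of the `i`-th block. -/
def blockEnd (r s u i : ℕ) : ℕ := (blockStart r u i + r) * s

theorem blockStart_succ (r u i : ℕ) : blockStart r u (i + 1) =
    blockStart r u i + r + if i % 2 = 0 ∧ i / 2 < u then 1 else 0 := by
  simp only [blockStart, mul_add, mul_one]
  split_ifs <;> omega

theorem blockEnd_succ (r s u i : ℕ) : blockEnd r s u (i + 1) =
    blockEnd r s u i + r * s + if i % 2 = 0 ∧ i / 2 < u then s else 0 := by
  simp only [blockEnd, blockStart_succ]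
  split_ifs <;> ring

theorem blockEnd_mono (r s u : ℕ) : Monotone (blockEnd r s u) :=
  monotone_nat_of_le_succ fun i => by rw [blockEnd_succ]; omega

theorem exists_block (r u b : ℕ) {w : ℕ} (hw : w < blockStart r u b) :
    ∃ i < b, blockStart r u i ≤ w ∧ w < blockStart r u (i + 1) := by
  induction b with
  | zero => simp [blockStart] at hw
  | succ b ih =>
    rcases lt_or_ge w (blockStart r u b) with h | h
    · obtain ⟨i, hi, h'⟩ := ih h
      exact ⟨i, by omega, h'⟩
    · exact ⟨b, by omega, h, hw⟩

variable {V : Type*}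

/-- In the cyclic arrangement the vertex `v` is placed at position `p`, within block `i`. -/
def IsSlot (r s u b c k : ℕ) (av z : ℕ → V) (e : ℕ → ℕ → V) (i p : ℕ) (v : V) : Prop :=
  i < b ∧ ((p + 1 = blockEnd r s u i ∧ v = av i) ∨
    (∃ j < u, i = 2 * j ∧ ∃ d < k, p = blockEnd r s u i + d ∧ v = e j d) ∨
    ∃ j < c, i = 2 * (u + j) ∧ p = blockEnd r s u i ∧ v = z j)

variable {r s u b c k : ℕ} {av z : ℕ → V} {e : ℕ → ℕ → V}

theorem IsSlot.bracket (hrs : 2 ≤ r * s) (hk : k < r * s + s) {i p : ℕ} {v : V}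
    (h : IsSlot r s u b c k av z e i p v) :
    blockEnd r s u i ≤ p + 1 ∧ p + 1 < blockEnd r s u (i + 1) := by
  rw [blockEnd_succ]
  obtain ⟨-, ⟨h1, -⟩ | ⟨j, hj, rfl, d, hd, h1, -⟩ | ⟨j, hj, h2, h1, -⟩⟩ := h
  · omega
  · rw [if_pos (by omega)]
    omega
  · omega

theorem eq_of_bracket {i j p : ℕ} (hi : blockEnd r s u i ≤ p ∧ p < blockEnd r s u (i + 1))
    (hj : blockEnd r s u j ≤ p ∧ p < blockEnd r s u (j + 1)) : i = j := by
  rcases lt_trichotomy i j with h | h | h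
  · have := blockEnd_mono r s u (show i + 1 ≤ j from h)
    omega
  · exact h
  · have := blockEnd_mono r s u (show j + 1 ≤ i from h)
    omega

theorem IsSlot.lt (hrs : 2 ≤ r * s) (hk : k < r * s + s) (hb : 2 * (c + u) ≤ b) {i p : ℕ} {v : V}
    (h : IsSlot r s u b c k av z e i p v) : p < blockStart r u b * s := by
  have hle : ∀ j, j + 1 ≤ b → blockEnd r s u j ≤ blockStart r u b * s := by
    intro j hj
    obtain ⟨b, rfl⟩ : ∃ b', b = b' + 1 := ⟨b - 1, by omega⟩
    refine (blockEnd_mono r s u (show j ≤ b by omega)).trans ?_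
    rw [blockEnd]
    exact Nat.mul_le_mul_right _ (by rw [blockStart_succ]; omega)
  have hbr := h.bracket hrs hk
  obtain ⟨hib, ⟨h1, -⟩ | ⟨j, hj, rfl, d, hd, h1, -⟩ | ⟨j, hj, h2, h1, -⟩⟩ := h
  · have := hle i hib
    omega
  · have := hle (2 * j + 1) (by omega)
    omega
  · have := hle (i + 1) (by omega)
    omega

theorem IsSlot.unique (hrs : 2 ≤ r * s) (hk : k < r * s + s) {i i' p : ℕ} {v v' : V}
    (h : IsSlot r s u b c k av z e i p v) (h' : IsSlot r s u b c k av z e i' p v') : v = v' := by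
  obtain rfl := eq_of_bracket (h.bracket hrs hk) (h'.bracket hrs hk)
  obtain ⟨-, ⟨h1, h2⟩ | ⟨j, hj, h3, d, hd, h1, h2⟩ | ⟨j, hj, h3, h1, h2⟩⟩ := h <;>
  obtain ⟨-, ⟨h1', h2'⟩ | ⟨j', hj', h3', d', hd', h1', h2'⟩ | ⟨j', hj', h3', h1', h2'⟩⟩ := h'
  · rw [h2, h2']
  · omega
  · omega
  · omega
  · obtain rfl : j = j' := by omega
    obtain rfl : d = d' := by omega
    rw [h2, h2']
  · omega
  · omega
  · omega
  · obtain rfl : j = j' := by omega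
    rw [h2, h2']

theorem IsSlot.injective [DecidableEq V] {E : Finset (Finset V)} {A X : Finset V}
    (hf : Filling E k b c u A X av z e) {i i' p p' : ℕ} {v : V}
    (h : IsSlot r s u b c k av z e i p v) (h' : IsSlot r s u b c k av z e i' p' v) : p = p' := by
  obtain ⟨hi, ⟨h1, h2⟩ | ⟨j, hj, h3, d, hd, h1, h2⟩ | ⟨j, hj, h3, h1, h2⟩⟩ := h <;>
  obtain ⟨hi', ⟨h1', h2'⟩ | ⟨j', hj', h3', d', hd', h1', h2'⟩ | ⟨j', hj', h3', h1', h2'⟩⟩ := h' <;>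
  rw [h2] at h2'
  · obtain rfl := hf.injOn_av (by simpa using hi) (by simpa using hi') h2'
    omega
  · exact absurd (mem_union_left _ (hf.av_mem i hi)) (h2' ▸ hf.e_notMem j' hj' d' hd')
  · exact absurd h2' (hf.av_ne_z i hi j' hj')
  · exact absurd (mem_union_left _ (hf.av_mem i' hi')) (h2' ▸ hf.e_notMem j hj d hd)
  · obtain ⟨rfl, rfl⟩ := hf.e_inj j hj d hd j' hj' d' hd' h2'
    rw [h1, h1', h3', h3]
  · exact absurd (hf.z_mem j' hj') (h2' ▸ hf.e_notMem j hj d hd)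
  · exact absurd h2'.symm (hf.av_ne_z i' hi' j hj)
  · exact absurd (hf.z_mem j hj) (h2' ▸ hf.e_notMem j' hj' d' hd')
  · obtain rfl := hf.injOn_z (by simpa using hj) (by simpa using hj') h2'
    rw [h1, h1', h3', h3]

/-- The vertices placed in a window of block `i`. -/
theorem IsSlot.window_cases (hrs : 2 ≤ r * s) (hs : 1 ≤ s) (hk : k < r * s + s) {i i' p w : ℕ}
    {v : V}
    (h : IsSlot r s u b c k av z e i' p v) (hw1 : blockStart r u i ≤ w)
    (hw2 : w < blockStart r u i + r) (hp1 : w * s ≤ p) (hp2 : p < w * s + k) :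
    v = av i ∨ (∃ j < u, i = 2 * j ∧ ∃ d < k - 1, v = e j d) ∨
      (∃ j < u, i = 2 * j + 1 ∧ ∃ d, 1 ≤ d ∧ d < k ∧ v = e j d) ∨
      ∃ j < c, (i = 2 * (u + j) ∨ i = 2 * (u + j) + 1) ∧ v = z j := by
  have e1 : blockEnd r s u i ≤ w * s + r * s := by
    rw [blockEnd, add_mul]
    exact Nat.add_le_add_right (Nat.mul_le_mul_right _ hw1) _
  have e2 : w * s + s ≤ blockEnd r s u i := by
    rw [blockEnd, ← Nat.succ_mul]
    exact Nat.mul_le_mul_right _ hw2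
  have hbr := h.bracket hrs hk
  have hsucc := blockEnd_succ r s u i
  have hi' : i' ≤ i := by
    by_contra hlt
    have := blockEnd_mono r s u (show i + 1 ≤ i' by omega)
    omega
  rcases hi'.eq_or_lt with rfl | hlt
  · obtain ⟨hi, ⟨h1, h2⟩ | ⟨j, hj, h3, d, hd, h1, h2⟩ | ⟨j, hj, h3, h1, h2⟩⟩ := h
    · exact Or.inl h2
    · exact Or.inr (Or.inl ⟨j, hj, h3, d, by omega, h2⟩)
    · exact Or.inr (Or.inr (Or.inr ⟨j, hj, Or.inl h3, h2⟩))
  · obtain ⟨i, rfl⟩ : ∃ i₀, i = i₀ + 1 := ⟨i - 1, by omega⟩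
    have hsucc' := blockEnd_succ r s u i
    obtain rfl : i' = i := by
      by_contra hne
      have := blockEnd_mono r s u (show i' + 1 ≤ i by omega)
      omega
    obtain ⟨hi, ⟨h1, h2⟩ | ⟨j, hj, h3, d, hd, h1, h2⟩ | ⟨j, hj, h3, h1, h2⟩⟩ := h
    · omega
    · rw [if_pos (by omega)] at hsucc'
      exact Or.inr (Or.inr (Or.inl ⟨j, hj, by omega, d, by omega, hd, h2⟩))
    · exact Or.inr (Or.inr (Or.inr ⟨j, hj, by omega, h2⟩))

theorem Filling.exists_supp [DecidableEq V] {E : Finset (Finset V)} {A X : Finset V}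
    (hf : Filling E k b c u A X av z e) (hcov : ∀ v, ∃ e ∈ E, v ∈ e)
    (hrs : 2 ≤ r * s) (hs : 1 ≤ s) (hk : k < r * s + s)
    {i w : ℕ} (hw1 : blockStart r u i ≤ w) (hw2 : w < blockStart r u i + r) :
    ∃ C, Supp E C ∧ (2 * (u + c) ≤ i → C = {av i}) ∧
      ∀ i' p v, IsSlot r s u b c k av z e i' p v → w * s ≤ p → p < w * s + k → v ∈ C := by
  have key := fun i' p v (h : IsSlot r s u b c k av z e i' p v) h1 h2 =>
    h.window_cases hrs hs hk hw1 hw2 h1 h2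
  rcases lt_or_ge i (2 * u) with hiu | hiu
  · rcases Nat.mod_two_eq_zero_or_one i with hpar | hpar
    · refine ⟨_, (hf.bridge (i / 2) (by omega)).supp_left, fun h => by omega, ?_⟩
      intro i' p v h h1 h2
      rw [show 2 * (i / 2) = i by omega, mem_insert, mem_image]
      rcases key i' p v h h1 h2 with h | ⟨j, hj, h3, d, hd, h4⟩ | ⟨j, hj, h3, d, hd, hd', h4⟩ |
        ⟨j, hj, h3, h4⟩
      · exact Or.inl h
      · right
        obtain rfl : j = i / 2 := by omega
        exact ⟨d, mem_range.2 hd, h4.symm⟩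
      · omega
      · omega
    · refine ⟨_, (hf.bridge (i / 2) (by omega)).supp_right, fun h => by omega, ?_⟩
      intro i' p v h h1 h2
      rw [show 2 * (i / 2) + 1 = i by omega, mem_insert, mem_image]
      rcases key i' p v h h1 h2 with h | ⟨j, hj, h3, d, hd, h4⟩ | ⟨j, hj, h3, d, hd, hd', h4⟩ |
        ⟨j, hj, h3, h4⟩
      · exact Or.inl h
      · omega
      · right
        obtain rfl : j = i / 2 := by omega
        exact ⟨d, mem_Ico.2 ⟨hd, hd'⟩, h4.symm⟩
      · omega
  · rcases lt_or_ge i (2 * (u + c)) with hic | hic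
    · refine ⟨_, hf.supp_z (i / 2 - u) (by omega) i (by omega), fun h => by omega, ?_⟩
      intro i' p v h h1 h2
      rw [mem_insert, mem_singleton]
      rcases key i' p v h h1 h2 with h | ⟨j, hj, h3, d, hd, h4⟩ | ⟨j, hj, h3, d, hd, hd', h4⟩ |
        ⟨j, hj, h3, h4⟩
      · exact Or.inr h
      · omega
      · omega
      · left
        obtain rfl : j = i / 2 - u := by omega
        exact h4
    · obtain ⟨f, hfE, hvf⟩ := hcov (av i)
      refine ⟨{av i}, ⟨f, hfE, by simpa using hvf⟩, fun _ => rfl, ?_⟩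
      intro i' p v h h1 h2
      rw [mem_singleton]
      rcases key i' p v h h1 h2 with h | ⟨j, hj, h3, d, hd, h4⟩ | ⟨j, hj, h3, d, hd, hd', h4⟩ |
        ⟨j, hj, h3, h4⟩
      · exact h
      all_goals omega

theorem exists_perm_of_rel {V : Type*} [Fintype V] [DecidableEq V] (R : V → V → Prop)
    (hfun : ∀ p v v', R p v → R p v' → v = v') (hinj : ∀ p p' v, R p v → R p' v → p = p') :
    ∃ π : Equiv.Perm V, ∀ p v, R p v → π p = v := by
  obtain ⟨π, hπ, -⟩ := exists_perm_map_tuple (γ := {p // ∃ v, R p v}) Subtype.val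
    (fun p => p.2.choose) Subtype.val_injective fun p q hpq => by
      have hp := p.2.choose_spec
      have hq := q.2.choose_spec
      simp only at hpq
      rw [hpq] at hp
      exact Subtype.ext (hinj _ _ _ hp hq)
  exact ⟨π, fun p v h => (hπ ⟨p, v, h⟩).trans
    (hfun p _ _ (⟨v, h⟩ : ∃ v, R p v).choose_spec h)⟩

end Layout

section Assembly

/-- The `w`-th window of the cyclic arrangement: `k` cyclically consecutive positions. -/
def window (n : ℕ) [NeZero n] (s k w : ℕ) : Finset (Fin n) :=
  (range k).image fun d => Fin.ofNat n (w * s + d)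

theorem mem_window {n s k w : ℕ} [NeZero n] {p : Fin n} :
    p ∈ window n s k w ↔ ∃ d < k, (w * s + d) % n = p := by
  simp only [window, mem_image, mem_range, Fin.ext_iff, Fin.val_ofNat]

theorem card_window {n s k w : ℕ} [NeZero n] (hk : k ≤ n) : (window n s k w).card = k := by
  rw [window, card_image_of_injOn, card_range]
  intro d hd d' hd' heq
  rw [coe_range, Set.mem_Iio] at hd hd'
  simp only [Fin.ext_iff, Fin.val_ofNat] at heq
  have h : d ≡ d' [MOD n] := Nat.ModEq.add_left_cancel' _ heq
  exact Nat.ModEq.eq_of_lt_of_lt h (by omega) (by omega)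

theorem card_windows_through_le {n s k m : ℕ} [NeZero n] (hn : n = m * s) (p : Fin n) :
    ((range m).filter fun w => p ∈ window n s k w).card ≤ k := by
  have hs : 0 < s := Nat.pos_of_ne_zero fun h => NeZero.ne n (by rw [hn, h, mul_zero])
  have hsub : ((range m).filter fun w => p ∈ window n s k w) ⊆
      (range k).biUnion fun d => (range m).filter fun w => (w * s + d) % n = p := by
    intro w hw
    rw [mem_filter, mem_window] at hw
    obtain ⟨hwm, d, hd, h⟩ := hw
    exact mem_biUnion.2 ⟨d, mem_range.2 hd, mem_filter.2 ⟨hwm, h⟩⟩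
  refine (card_le_card hsub).trans ((card_biUnion_le_card_mul _ _ 1 fun d _ => ?_).trans ?_)
  · rw [card_le_one]
    intro w hw w' hw'
    rw [mem_filter, mem_range] at hw hw'
    have h : w * s ≡ w' * s [MOD n] := Nat.ModEq.add_right_cancel' d (hw.2.trans hw'.2.symm)
    rw [hn] at h
    exact Nat.ModEq.eq_of_lt_of_lt (Nat.ModEq.mul_right_cancel' hs.ne' h) hw.1 hw'.1
  · rw [card_range, mul_one]

theorem mem_window_of_lt {n s k w p : ℕ} [NeZero n] (hp : p < n) (h1 : w * s ≤ p)
    (h2 : p < w * s + k) : (⟨p, hp⟩ : Fin n) ∈ window n s k w := by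
  rw [mem_window]
  refine ⟨p - w * s, by omega, ?_⟩
  rw [Nat.add_sub_cancel' h1, Nat.mod_eq_of_lt hp]

theorem le_of_mem_window {n s k m w : ℕ} [NeZero n] (hn : n = m * s) (hw : w < m)
    {p : Fin n} (hp : p ∈ window n s k w) (hpk : k ≤ p + s) :
    w * s ≤ p ∧ (p : ℕ) < w * s + k := by
  obtain ⟨d, hd, hdp⟩ := mem_window.1 hp
  have h1 : w * s + s ≤ n := by
    rw [hn, ← Nat.succ_mul]
    exact Nat.mul_le_mul_right _ hw
  rcases lt_or_ge (w * s + d) n with h | h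
  · rw [Nat.mod_eq_of_lt h] at hdp
    omega
  · rw [Nat.mod_eq_sub_mod h, Nat.mod_eq_of_lt (by omega)] at hdp
    omega

variable {r s u b c k m n : ℕ} {av z : ℕ → Fin n} {e : ℕ → ℕ → Fin n}
  {E : Finset (Finset (Fin n))} {A X : Finset (Fin n)}

theorem Filling.card_slots_le (hf : Filling E k b c u A X av z e) (S : Finset (Fin n))
    (hS : ∀ p ∈ S, ∃ i v, IsSlot r s u b c k av z e i p v) : S.card ≤ b + u * k + c := by
  choose! i v hiv using hS
  have h1 : S.card = (S.image v).card := by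
    refine (card_image_of_injOn fun p hp q hq hpq => ?_).symm
    have h2 := hiv q hq
    rw [← hpq] at h2
    exact Fin.ext ((hiv p hp).injective hf h2)
  have h2 : S.image v ⊆ ((range b).image av ∪ (range u).biUnion fun j => (range k).image (e j)) ∪
      (range c).image z := by
    intro y hy
    obtain ⟨p, hp, rfl⟩ := mem_image.1 hy
    obtain ⟨hi, ⟨-, h2⟩ | ⟨j, hj, -, d, hd, -, h2⟩ | ⟨j, hj, -, -, h2⟩⟩ := hiv p hp <;> rw [h2]
    · exact mem_union_left _ (mem_union_left _ (mem_image_of_mem _ (mem_range.2 hi)))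
    · exact mem_union_left _ (mem_union_right _ (mem_biUnion.2 ⟨j, mem_range.2 hj,
        mem_image_of_mem _ (mem_range.2 hd)⟩))
    · exact mem_union_right _ (mem_image_of_mem _ (mem_range.2 hj))
  rw [h1]
  refine (card_le_card h2).trans ((card_union_le _ _).trans ?_)
  refine Nat.add_le_add ((card_union_le _ _).trans (Nat.add_le_add ?_ ?_)) ?_
  · exact card_image_le.trans (card_range b).le
  · refine (card_biUnion_le_card_mul _ _ k fun j _ => ?_).trans (by rw [card_range])
    exact card_image_le.trans (card_range k).le
  · exact card_image_le.trans (card_range c).le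

variable [NeZero n]

set_option maxHeartbeats 1000000 in
theorem Filling.exists_arrangement {a G h K N : ℕ} (H : NearExtremal E k a G h A X)
    (hf : Filling E k b c u A X av z e) (hcov : ∀ v, ∃ e ∈ E, v ∈ e)
    (hrs : 2 ≤ r * s) (hs : 1 ≤ s) (hk : k < r * s + s) (hkr : r * s ≤ k)
    (hb : 2 * (c + u) ≤ b) (hm : blockStart r u b = m) (hn : n = m * s) (hkn : k ≤ n)
    (hK : 4 * G ≤ K) (hK' : r * (2 * (u + c) + 2 * G) ≤ K)
    (hN : b + u * k + c + N ≤ n) (hNm : m ≤ 4 * N) (hN3 : 3 ≤ N) (hNk : 2 * k ^ 2 ≤ N)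
    (hNK : 48 * k ^ 3 * K ≤ N) :
    ∃ ρ : Equiv.Perm (Fin n), ∀ w < m, Supp E ((window n s k w).image ρ) := by
  classical
  obtain ⟨π, hπ⟩ := exists_perm_of_rel
    (fun p v : Fin n => ∃ i, IsSlot r s u b c k av z e i p v)
    (fun p v v' ⟨i, h⟩ ⟨i', h'⟩ => h.unique hrs hk h')
    (fun p p' v ⟨i, h⟩ ⟨i', h'⟩ => Fin.ext (h.injective hf h'))
  set P : Finset (Fin n) := univ.filter fun p => ¬ ∃ i v, IsSlot r s u b c k av z e i p v with hP
  have hmemP : ∀ p, p ∉ P → ∃ i, IsSlot r s u b c k av z e i p (π p) := fun p hp => by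
    rw [hP, mem_filter] at hp
    push Not at hp
    obtain ⟨i, v, h⟩ := hp (mem_univ _)
    exact ⟨i, by rwa [hπ p v ⟨i, h⟩]⟩
  have hslotP : ∀ (p : Fin n) i v, IsSlot r s u b c k av z e i p v → p ∉ P := fun p i v h hp =>
    (mem_filter.1 hp).2 ⟨i, v, h⟩
  have hPc : N ≤ P.card := by
    have h1 := hf.card_slots_le (univ \ P) (r := r) (s := s) fun p hp => by
      obtain ⟨i, h⟩ := hmemP p (mem_sdiff.1 hp).2
      exact ⟨i, _, h⟩
    have h2 := card_sdiff_add_card_eq_card (subset_univ P)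
    rw [card_univ, Fintype.card_fin] at h2
    omega
  have hlt : ∀ {i p v}, IsSlot r s u b c k av z e i p v → p < n := fun h => by
    rw [hn, ← hm]; exact h.lt hrs hk hb
  have hend : blockEnd r s u 0 = r * s := by simp [blockEnd, blockStart]
  have hPval : ∀ p ∈ P, π p ∉ A ∪ X := by
    intro p hp hmem
    have hslot : ∃ i q, IsSlot r s u b c k av z e i q (π p) := by
      rcases mem_union.1 (hf.cover hmem) with h | h
      · obtain ⟨i, hi, hip⟩ := mem_image.1 h
        rw [mem_range] at hi
        have hpos : 1 ≤ blockEnd r s u i := by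
          refine le_trans ?_ (blockEnd_mono r s u (Nat.zero_le i))
          rw [hend]
          omega
        exact ⟨i, blockEnd r s u i - 1, hi, Or.inl ⟨Nat.sub_add_cancel hpos, hip.symm⟩⟩
      · obtain ⟨j, hj, hjp⟩ := mem_image.1 h
        rw [mem_range] at hj
        exact ⟨2 * (u + j), _, by omega, Or.inr (Or.inr ⟨j, hj, rfl, rfl, hjp.symm⟩)⟩
    obtain ⟨i, q, h⟩ := hslot
    have h1 : π ⟨q, hlt h⟩ = π p := hπ _ _ ⟨i, h⟩
    have h2 := π.injective h1
    exact hslotP _ _ _ (by rw [← h2]; exact h) hp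
  have hslot_le : ∀ {i p v}, IsSlot r s u b c k av z e i p v → k ≤ p + s := fun {i p v} h => by
    have h1 := (h.bracket hrs hk).1
    have h2 := blockEnd_mono r s u (Nat.zero_le i)
    omega
  set 𝒲 := (range m).filter fun w => ∃ i < b, blockStart r u i ≤ w ∧ w < blockStart r u i + r
    with h𝒲
  have h𝒲m : ∀ w ∈ 𝒲, w < m := fun w hw => mem_range.1 (mem_filter.1 hw).1
  have hcontent : ∀ w < m, ∀ i < b, blockStart r u i ≤ w → w < blockStart r u i + r →
      av i ∈ (window n s k w \ P).image π ∧ ∃ C, Supp E C ∧ (2 * (u + c) ≤ i → C = {av i}) ∧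
        (window n s k w \ P).image π ⊆ C := by
    intro w hw i hi hw1 hw2
    have e1 : blockEnd r s u i ≤ w * s + r * s := by
      rw [blockEnd, add_mul]
      exact Nat.add_le_add_right (Nat.mul_le_mul_right _ hw1) _
    have e2 : w * s + s ≤ blockEnd r s u i := by
      rw [blockEnd, ← Nat.succ_mul]
      exact Nat.mul_le_mul_right _ hw2
    constructor
    · have hsl : IsSlot r s u b c k av z e i (blockEnd r s u i - 1) (av i) :=
        ⟨hi, Or.inl ⟨by omega, rfl⟩⟩
      refine mem_image.2 ⟨⟨_, hlt hsl⟩, mem_sdiff.2 ⟨?_, hslotP _ _ _ hsl⟩, hπ _ _ ⟨i, hsl⟩⟩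
      exact mem_window_of_lt _ (by omega) (by omega)
    · obtain ⟨C, hC, hC1, hC2⟩ := hf.exists_supp hcov hrs hs hk hw1 hw2
      refine ⟨C, hC, hC1, fun v hv => ?_⟩
      obtain ⟨p, hp, rfl⟩ := mem_image.1 hv
      rw [mem_sdiff] at hp
      obtain ⟨i', h⟩ := hmemP p hp.2
      have := le_of_mem_window hn hw hp.1 (hslot_le h)
      exact hC2 i' p _ h this.1 this.2
  obtain ⟨ρ, hρ, hρ𝒲⟩ := exists_completion 𝒲 (window n s k) π P
    (fun S => Supp E S ∧ ∃ v ∈ S, v ∈ A) k K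
    (fun w _ => card_window hkn)
    (fun p => (card_le_card (filter_subset_filter _ (filter_subset _ _))).trans
      (card_windows_through_le hn p)) (by
      intro w hw
      obtain ⟨hwm, i, hi, hw1, hw2⟩ := mem_filter.1 hw
      obtain ⟨h1, C, hC, -, hsub⟩ := hcontent w (mem_range.1 hwm) i hi hw1 hw2
      exact ⟨hC.mono hsub, av i, h1, hf.av_mem i hi⟩) (by
      rintro S ⟨hS, v, hvS, hvA⟩ hSk
      refine le_trans ?_ hK
      rw [← card_image_of_injective _ π.injective]
      refine H.exts_le S hS ⟨v, hvS, hvA⟩ hSk _ fun y hy => ?_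
      obtain ⟨x, hx, rfl⟩ := mem_image.1 hy
      simp only [mem_filter] at hx
      refine ⟨fun h => hPval x hx.1 (mem_union_left _ h), fun h => hx.2 ⟨h, v, ?_, hvA⟩⟩
      exact mem_insert_of_mem hvS) (by
      intro x hx
      have hxval := hPval x hx
      rw [mem_union, not_or] at hxval
      have hnon := H.nonnbr_le _ hxval.1 hxval.2
      set I := range (2 * (u + c)) ∪ (range b).filter fun i => av i ∈ A \ nbr E (π x) A with hI
      have hIc : I.card ≤ 2 * (u + c) + 2 * G := by
        refine (card_union_le _ _).trans (Nat.add_le_add (card_range _).le ?_)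
        refine le_trans ?_ hnon
        refine card_le_card_of_injOn av (fun i hi => ?_) (hf.injOn_av.mono fun i hi => ?_)
        · exact (mem_filter.1 hi).2
        · exact (mem_filter.1 hi).1
      refine le_trans (card_le_card (t := I.biUnion fun i =>
        Ico (blockStart r u i) (blockStart r u i + r)) ?_) ((card_biUnion_le_card_mul _ _ r
          fun i _ => by rw [Nat.card_Ico]; omega).trans ?_)
      · intro w hw
        simp only [mem_filter] at hw
        obtain ⟨hwm, i, hi, hw1, hw2⟩ := mem_filter.1 hw.1
        refine mem_biUnion.2 ⟨i, ?_, mem_Ico.2 ⟨hw1, hw2⟩⟩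
        rw [hI, mem_union, mem_range, mem_filter, mem_range, mem_sdiff]
        by_contra hcon
        push Not at hcon
        have hnb := hcon.2 hi (hf.av_mem i hi)
        obtain ⟨h1, C, hC, hCi, hsub⟩ := hcontent w (mem_range.1 hwm) i hi hw1 hw2
        rw [hCi hcon.1] at hsub
        refine hw.2 ⟨?_, av i, mem_insert_of_mem h1, hf.av_mem i hi⟩
        have h2 := (mem_nbr.1 hnb).2.2
        rw [pair_comm] at h2
        exact h2.mono (insert_subset_insert _ hsub)
      · rw [mul_comm]
        exact (Nat.mul_le_mul_left _ hIc).trans hK')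
    ((card_filter_le _ _).trans (by rw [card_range]; omega)) (by omega) (by omega) (by omega)
  refine ⟨ρ, fun w hw => ?_⟩
  by_cases hw𝒲 : w ∈ 𝒲
  · exact (hρ𝒲 w hw𝒲).1
  · obtain ⟨i, hi, hw1, hw2⟩ := exists_block r u b (hm ▸ hw)
    rw [h𝒲, mem_filter] at hw𝒲
    push Not at hw𝒲
    have h1 := hw𝒲 (mem_range.2 hw) i hi hw1
    rw [blockStart_succ] at hw2
    have hpar : i % 2 = 0 ∧ i / 2 < u := by
      by_contra hne
      rw [if_neg hne] at hw2
      omega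
    rw [if_pos hpar] at hw2
    have hws : w * s = blockEnd r s u i := by
      rw [blockEnd]
      congr 1
      omega
    refine (hf.bridge (i / 2) hpar.2).supp.mono fun v hv => ?_
    obtain ⟨p, hp, rfl⟩ := mem_image.1 hv
    obtain ⟨d, hd, hdp⟩ := mem_window.1 hp
    have hsl : IsSlot r s u b c k av z e i (w * s + d) (e (i / 2) d) :=
      ⟨hi, Or.inr (Or.inl ⟨i / 2, hpar.2, by omega, d, hd, by rw [hws], rfl⟩)⟩
    rw [Nat.mod_eq_of_lt (hlt hsl)] at hdp
    rw [hdp] at hsl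
    rw [hρ p (hslotP _ _ _ hsl), hπ p _ ⟨i, hsl⟩]
    exact mem_image_of_mem _ (mem_range.2 hd)

theorem hamCycle_of_arrangement {l : ℕ} (hE : ∀ e ∈ E, e.card = k) (hs : s = k - l)
    (hn : n = m * s) (hkn : k ≤ n) (ρ : Equiv.Perm (Fin n))
    (hρ : ∀ w < m, Supp E ((window n s k w).image ρ)) : HamCycle k l E := by
  have hm : 0 < m := Nat.pos_of_ne_zero fun h => NeZero.ne n (by rw [hn, h, zero_mul])
  refine ⟨fun x => ρ (Fin.ofNat n x.val), ρ.bijective.comp ?_, fun i => ?_⟩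
  · rw [Fintype.bijective_iff_injective_and_card, ZMod.card, Fintype.card_fin]
    refine ⟨fun x y hxy => ZMod.val_injective n ?_, rfl⟩
    simpa only [Fin.ext_iff, Fin.val_ofNat, Nat.mod_eq_of_lt (ZMod.val_lt _)] using hxy
  · obtain ⟨f, hf, hsub⟩ := hρ (i % m) (Nat.mod_lt _ hm)
    have hcard : ((window n s k (i % m)).image ρ).card = f.card := by
      rw [card_image_of_injective _ ρ.injective, card_window hkn, hE f hf]
    have heq := eq_of_subset_of_card_le hsub hcard.ge
    convert hf
    rw [← heq]
    ext v
    simp only [window, mem_image, mem_univ, true_and, mem_range, exists_exists_and_eq_and,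
      ZMod.val_natCast]
    have hmod : ∀ d, Fin.ofNat n ((i * (k - l) + d) % n) = Fin.ofNat n (i % m * s + d) := by
      intro d
      rw [Fin.ext_iff, Fin.val_ofNat, Fin.val_ofNat, Nat.mod_mod, ← hs]
      have : i % m * s = i * s % n := by rw [hn, Nat.mul_mod_mul_right]
      rw [this, Nat.mod_add_mod]
    constructor
    · rintro ⟨d, rfl⟩
      exact ⟨d, d.2, by rw [hmod]⟩
    · rintro ⟨d, hd, rfl⟩
      exact ⟨⟨d, hd⟩, by rw [hmod]⟩

end Assembly

section Main

variable {n k l r s m a h D : ℕ} {E : Finset (Finset (Fin n))}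

/-- The extremal case with explicit parameters: `D ^ 2` bounds twice the number of supported
pairs, and `h` bounds the change made to the given set. -/
theorem hamCycle_of_suppPairs_le (hk : 3 ≤ k) (hE : ∀ e ∈ E, e.card = k)
    (hcov : ∀ v, ∃ e ∈ E, v ∈ e)
    (hco : ∀ S : Finset (Fin n), S.card = k - 1 → Supp E S → n ≤ (exts E S).card + a + (k - 3))
    (hs : s = k - l) (hs1 : 1 ≤ s) (hrs : 3 ≤ r * s) (hkr : r * s ≤ k) (hkt : k < r * s + s)
    (hn : n = m * s) (ha : a = n / (r * s)) (hh : 6000 * k ^ 6 * h ≤ n) (hD : 1 ≤ D)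
    (hDh : 2 * D ≤ h) (hkh : k ≤ h) (hnD : n * D ≤ 14 * k ^ 2 * h ^ 2)
    (A : Finset (Fin n)) (hA : A.card = a) (hsupp : 2 * suppPairs E A ≤ D * D) :
    HamCycle k l E := by
  obtain ⟨p₁, hp₁⟩ : ∃ p, p = k * h := ⟨_, rfl⟩
  obtain ⟨p₂, hp₂⟩ : ∃ p, p = k * p₁ := ⟨_, rfl⟩
  obtain ⟨p₃, hp₃⟩ : ∃ p, p = k * p₂ := ⟨_, rfl⟩
  have h₁ : 3 * h ≤ p₁ := hp₁ ▸ Nat.mul_le_mul_right h hk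
  have h₂ : 3 * p₁ ≤ p₂ := hp₂ ▸ Nat.mul_le_mul_right p₁ hk
  have h₃ : 3 * p₂ ≤ p₃ := hp₃ ▸ Nat.mul_le_mul_right p₂ hk
  have hnp : 6000 * (k ^ 3 * p₃) ≤ n := by
    refine le_trans (le_of_eq ?_) hh
    rw [hp₃, hp₂, hp₁]
    ring
  have hk3 : 27 ≤ k ^ 3 := Nat.pow_le_pow_left hk 3
  have hnp₃ : 27 * p₃ ≤ k ^ 3 * p₃ := Nat.mul_le_mul_right p₃ hk3
  have : NeZero n := ⟨by omega⟩
  have hrk : r ≤ k := (Nat.le_mul_of_pos_right r hs1).trans hkr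
  have han : r * s * a ≤ n := by rw [ha]; exact Nat.mul_div_le n _
  have ham : r * a ≤ m := by
    refine Nat.le_of_mul_le_mul_right ?_ hs1
    rw [← hn, Nat.mul_right_comm]
    exact han
  have hlt : n < r * s * (a + 1) := by
    rw [ha]
    exact Nat.lt_mul_div_succ n (by omega)
  have hma : m < r * (a + 1) := by
    refine Nat.lt_of_mul_lt_mul_right (a := s) ?_
    rw [← hn, Nat.mul_right_comm]
    exact hlt
  have h3a : 3 * a ≤ n := (Nat.mul_le_mul_right a hrs).trans han
  have hpa : 200 * p₃ < a := by
    have h1 : k * (6000 * (k ^ 2 * p₃)) < k * (a + 1) := by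
      refine lt_of_le_of_lt (le_trans (le_of_eq ?_) hnp)
        (hlt.trans_le (Nat.mul_le_mul_right _ hkr))
      ring
    have h2 := Nat.lt_of_mul_lt_mul_left h1
    have h3 : 9 * p₃ ≤ k ^ 2 * p₃ := Nat.mul_le_mul_right p₃ (Nat.pow_le_pow_left hk 2)
    omega
  obtain ⟨A', X, H⟩ := exists_nearExtremal (h := h) (D := D) (G := 14 * p₂) hk hE hcov
    (by simpa using hco) (by simpa using h3a) hD (by omega) (by omega) hDh
    (by
      rw [Fintype.card_fin]
      refine hnD.trans (le_of_eq ?_)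
      rw [hp₂, hp₁]
      ring) (by omega) A hA ((sum_card_nbr_le E A).trans hsupp)
  have hlow := H.lower
  have hup := H.upper
  have hX := H.card_X
  obtain ⟨x, hx⟩ : ∃ x, x = A'.card - a := ⟨_, rfl⟩
  obtain ⟨c, hc⟩ : ∃ c, c = x + X.card := ⟨_, rfl⟩
  obtain ⟨b, hb⟩ : ∃ b, b = A'.card - x := ⟨_, rfl⟩
  obtain ⟨u, hu⟩ : ∃ u, u = m - r * b := ⟨_, rfl⟩
  have hrb : r * b ≤ m := (Nat.mul_le_mul_left r (by omega)).trans ham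
  have hub : u ≤ k + p₁ := by
    have h1 : r * (a + 1) ≤ r * b + r * (h + 1) := by
      rw [← Nat.mul_add]
      exact Nat.mul_le_mul_left r (by omega)
    have h2 : r * (h + 1) ≤ k * (h + 1) := Nat.mul_le_mul_right _ hrk
    rw [Nat.mul_succ k, ← hp₁] at h2
    omega
  have hcu : c + u ≤ 3 * p₁ := by omega
  have hkcu : k * (c + u) ≤ 3 * p₂ := by
    refine (Nat.mul_le_mul_left k hcu).trans (le_of_eq ?_)
    rw [hp₂]
    ring
  have hkx : k * x ≤ p₁ := by
    rw [hp₁]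
    exact Nat.mul_le_mul_left k (by omega)
  have hkp : k * (14 * p₂) = 14 * p₃ := by rw [hp₃]; ring
  obtain ⟨av, z, e, hf⟩ := H.exists_filling (u := u) hk hcov (by simpa using hco)
    (by simpa using h3a) hx hc (by rw [Nat.add_mul]; omega) (by rw [Nat.add_mul]; omega)
    (by rw [Nat.mul_assoc 2, Nat.add_mul, Nat.add_mul, hkp]; omega) (by omega)
  rw [← hb] at hf
  have hkcu' : u * k + c * k ≤ 3 * p₂ := by
    refine le_trans (le_of_eq ?_) hkcu
    ring
  have hck : c ≤ c * k := Nat.le_mul_of_pos_right c (by omega)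
  have hk2 : k ^ 2 ≤ p₁ := by
    rw [hp₁, sq]
    exact Nat.mul_le_mul_left k hkh
  have hmn : m ≤ n := hn ▸ Nat.le_mul_of_pos_right m hs1
  obtain ⟨ρ, hρ⟩ := hf.exists_arrangement (r := r) (s := s) (m := m) (K := 56 * p₃) (N := n / 2) H
    hcov (by omega) hs1 hkt hkr (by omega) (by rw [blockStart]; omega) hn (by omega) (by omega)
    (by
      refine (Nat.mul_le_mul_right _ hrk).trans ?_
      have h1 : k * (2 * (u + c) + 2 * (14 * p₂)) = 2 * (k * (c + u)) + 2 * (k * (14 * p₂)) := by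
        ring
      rw [h1, hkp]
      omega) (by omega) (by omega) (by omega) (by omega) (by
      have h1 : 48 * k ^ 3 * (56 * p₃) = 2688 * (k ^ 3 * p₃) := by ring
      rw [h1]
      omega)
  exact hamCycle_of_arrangement hE hs hn (by omega) ρ hρ

end Main

/-- The extremal case: if `δ*(G) ≥ (1 - 1/t)n - (k-3)` and some set `A` of
`⌊n/t⌋` vertices contains at most `εn²` supported pairs, then `G` has a
Hamilton ℓ-cycle. -/
theorem hamilton_ell_cycle_extremal
    (k l t : ℕ) (hk : 3 ≤ k) (hl : 1 ≤ l) (hlk : l ≤ k - 1)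
    (hne : ¬(k = 3 ∧ l = 1)) (ht : t = k / (k - l) * (k - l)) :
    ∃ ε₀ : ℝ, 0 < ε₀ ∧ ∀ ε : ℝ, 0 < ε → ε ≤ ε₀ →
      ∃ n₀ : ℕ, ∀ n : ℕ, n₀ ≤ n → (k - l) ∣ n →
        ∀ E : Finset (Finset (Fin n)),
          (∀ e ∈ E, e.card = k) →
          (∀ v : Fin n, ∃ e ∈ E, v ∈ e) →
          (∀ S : Finset (Fin n), S.card = k - 1 → (∃ e ∈ E, S ⊆ e) →
            (1 - 1 / (t : ℝ)) * (n : ℝ) - ((k : ℝ) - 3) ≤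
              ((E.filter fun e => S ⊆ e).card : ℝ)) →
          (∃ A : Finset (Fin n), A.card = n / t ∧
            (suppPairs E A : ℝ) ≤ ε * (n : ℝ) ^ 2) →
          HamCycle k l E := by
  obtain ⟨s, hs⟩ : ∃ s, s = k - l := ⟨_, rfl⟩
  rw [← hs] at ht ⊢
  have hs1 : 1 ≤ s := by omega
  have htk : t ≤ k := ht ▸ Nat.div_mul_le_self k s
  have hkt : k < t + s := by
    rw [ht, ← Nat.succ_mul, mul_comm]
    exact Nat.lt_mul_div_succ k hs1
  have hst : s ≤ t := by
    rw [ht]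
    exact Nat.le_mul_of_pos_left s (Nat.div_pos (by omega) hs1)
  have ht3 : 3 ≤ t := by
    by_contra hcon
    have h2 : t = 2 := by omega
    have : s = 1 := by omega
    omega
  obtain ⟨P, hP⟩ : ∃ P, P = 6000 * k ^ 6 := ⟨_, rfl⟩
  obtain ⟨R, hR⟩ : ∃ R, R = 1000 * k ^ 4 := ⟨_, rfl⟩
  have hkpos : 0 < k := by omega
  have hPpos : 0 < P := by rw [hP]; positivity
  have hRpos : 0 < R := by rw [hR]; positivity
  have hQpos : (0 : ℝ) < (P * R : ℕ) := by exact_mod_cast Nat.mul_pos hPpos hRpos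
  refine ⟨1 / (8 * ((P * R : ℕ) : ℝ) ^ 2), by positivity, fun ε hε hε₀ => ⟨P * R, ?_⟩⟩
  rintro n hn ⟨m, hnm⟩ E hE hcov hco ⟨A, hA, hsupp⟩
  have hD : 1 ≤ n / P / R := by
    rw [Nat.div_div_eq_div_mul]
    exact Nat.div_pos hn (Nat.mul_pos hPpos hRpos)
  have hRD : R * (n / P / R) ≤ n / P := Nat.mul_div_le _ _
  have hR1 : 1000 * k ≤ R := by
    rw [hR]
    exact Nat.mul_le_mul_left _ (Nat.le_self_pow (by norm_num) k)
  have hRle : R ≤ R * (n / P / R) := Nat.le_mul_of_pos_right R hD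
  have hnP : n < P * (n / P + 1) := Nat.lt_mul_div_succ n hPpos
  refine hamCycle_of_suppPairs_le (r := k / s) (s := s) (m := m) (a := n / t) (h := n / P)
    (D := n / P / R) hk hE hcov ?_ hs hs1 (ht ▸ ht3) (ht ▸ htk) (ht ▸ hkt) (by rw [hnm, mul_comm])
    (by rw [ht]) (by rw [← hP]; exact Nat.mul_div_le n P) hD ?_ (by omega) ?_ A hA ?_
  · intro S hS hSE
    have h1 := hco S hS hSE
    have h2 := card_edges_le_card_exts (by omega) hE S hS
    have h3 : ((E.filter fun e => S ⊆ e).card : ℝ) ≤ (exts E S).card := by exact_mod_cast h2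
    have h4 : (n : ℝ) / t < (n / t : ℕ) + 1 := by
      rw [div_lt_iff₀ (by positivity), mul_comm]
      exact_mod_cast Nat.lt_mul_div_succ n (by omega)
    have h5 : (n : ℝ) < (exts E S).card + (n / t : ℕ) + 1 + (k - 3 : ℕ) := by
      rw [Nat.cast_sub hk]
      have : (1 - 1 / (t : ℝ)) * n = n - n / t := by ring
      push_cast at h4 ⊢
      linarith
    have h6 : n < (exts E S).card + n / t + 1 + (k - 3) := by exact_mod_cast h5
    omega
  · refine le_trans (Nat.mul_le_mul_right _ ?_) hRD
    omega
  · generalize n / P = h at *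
    generalize h / R = D at *
    have h1 : n * D ≤ P * (2 * h) * D :=
      Nat.mul_le_mul_right _ (hnP.le.trans (Nat.mul_le_mul_left _ (by omega)))
    have h2 : P * (2 * h) * D = 12 * k ^ 2 * h * (R * D) := by rw [hP, hR]; ring
    have h3 : 12 * k ^ 2 * h * (R * D) ≤ 12 * k ^ 2 * h * h := Nat.mul_le_mul_left _ hRD
    have h4 : 14 * k ^ 2 * h ^ 2 = 12 * k ^ 2 * h * h + 2 * k ^ 2 * h ^ 2 := by ring
    omega
  · have h1 : n < P * R * (n / P / R + 1) := by
      rw [Nat.div_div_eq_div_mul]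
      exact Nat.lt_mul_div_succ n (Nat.mul_pos hPpos hRpos)
    generalize n / P / R = D at *
    have h2 : n ≤ 2 * (P * R) * D := by nlinarith [Nat.mul_le_mul_left (P * R) hD]
    have h3 : (n : ℝ) ≤ 2 * (P * R : ℕ) * D := by exact_mod_cast h2
    have h4 : (suppPairs E A : ℝ) ≤ 1 / (8 * ((P * R : ℕ) : ℝ) ^ 2) * (2 * (P * R : ℕ) * D) ^ 2 :=
      hsupp.trans (by gcongr)
    have h5 : 1 / (8 * ((P * R : ℕ) : ℝ) ^ 2) * (2 * (P * R : ℕ) * D) ^ 2 = D * D / 2 := by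
      field_simp
      ring
    have h6 : (2 * suppPairs E A : ℝ) ≤ D * D := by linarith
    exact_mod_cast h6
end

section
/- Let k ≥ 3 and ℓ ∈ [k−1], and set t = ⌊k/(k−ℓ)⌋·(k−ℓ). There exists μ₀ > 0 such that for every μ ∈ (0, μ₀] there exists μ'₀ > 0 such that for every μ' ∈ (0, μ'₀] there exists ε₀ > 0 such that for every ε ∈ (0, ε₀] there exists s₀ such that for every s ≥ s₀ there exists n₀ such that the following holds for every n ≥ n₀ divisible by k−ℓ. Let G be an n-vertex k-graph with no isolated vertices and δ*(G) ≥ (1 − 1/t − ε)·n, such that every set of at least n/t vertices contains at least μn² supported pairs. Let W ⊆ V(G) with |W| ≤ 2k, and let S be a uniformly random s-element subset of V(G) containing W. Then with probability at least 1 − 1/s², the induced subgraph G[S] has no isolated vertices, satisfies δ*(G[S]) ≥ (1 − 1/t − 2ε)·s, and every subset of S of size at least s/t contains at least μ's² supported pairs of G[S]. -/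
open Finset

/-! ### Random subsets containing a given set -/

/-- The elementary symmetric sum of nonnegative weights is at most the power of their sum
divided by the factorial of the degree. -/
theorem factorial_mul_sum_powersetCard_prod_le {α : Type*} [DecidableEq α] (w : α → ℝ)
    (hw : ∀ a, 0 ≤ w a) (A : Finset α) (r : ℕ) :
    (r.factorial : ℝ) * ∑ U ∈ A.powersetCard r, ∏ v ∈ U, w v ≤ (∑ v ∈ A, w v) ^ r := by
  induction A using Finset.induction_on generalizing r with
  | empty =>
    cases r with
    | zero => simp
    | succ r => rw [powersetCard_eq_empty.2 (by simp)]; simp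
  | insert a A ha ih =>
    cases r with
    | zero => simp
    | succ r =>
      have hS : 0 ≤ ∑ v ∈ A, w v := sum_nonneg fun v _ => hw v
      have hdisj : Disjoint (A.powersetCard (r + 1)) ((A.powersetCard r).image (insert a)) := by
        rw [Finset.disjoint_left]
        intro U hU hU'
        obtain ⟨U', -, rfl⟩ := mem_image.1 hU'
        exact ha ((mem_powersetCard.1 hU).1 (mem_insert_self a U'))
      have hinj : Set.InjOn (insert a) (A.powersetCard r : Set (Finset α)) := by
        intro U hU U' hU' h
        have h1 : a ∉ U := fun h => ha ((mem_powersetCard.1 (mem_coe.1 hU)).1 h)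
        have h2 : a ∉ U' := fun h => ha ((mem_powersetCard.1 (mem_coe.1 hU')).1 h)
        rw [← erase_insert h1, ← erase_insert h2, h]
      have himg : ∑ U ∈ (A.powersetCard r).image (insert a), ∏ v ∈ U, w v
          = w a * ∑ U ∈ A.powersetCard r, ∏ v ∈ U, w v := by
        rw [sum_image hinj, mul_sum]
        refine sum_congr rfl fun U hU => prod_insert fun h => ha ((mem_powersetCard.1 hU).1 h)
      rw [powersetCard_succ_insert ha, sum_union hdisj, himg, sum_insert ha]
      have h1 := ih (r + 1)
      have h2 := mul_le_mul_of_nonneg_left (ih r)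
        (mul_nonneg (by positivity : (0 : ℝ) ≤ (r : ℝ) + 1) (hw a))
      rw [Nat.factorial_succ] at h1 ⊢
      push_cast at h1 ⊢
      rw [add_comm (w a)]
      have h3 : (∑ v ∈ A, w v) ^ (r + 1) + ((r : ℝ) + 1) * w a * (∑ v ∈ A, w v) ^ r
          ≤ (∑ v ∈ A, w v + w a) ^ (r + 1) := by
        have := pow_add_mul_le_add_pow hS (b := w a) (by linarith [hw a]) (r + 1)
        simp only [add_tsub_cancel_right] at this
        push_cast at this
        linarith
      linarith

/-- The `s`-subsets containing `X`. -/
def supersetsCard {α : Type*} [Fintype α] [DecidableEq α] (X : Finset α) (s : ℕ) :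
    Finset (Finset α) :=
  univ.filter fun U => U.card = s ∧ X ⊆ U

theorem mem_supersetsCard {α : Type*} [Fintype α] [DecidableEq α] {X U : Finset α} {s : ℕ} :
    U ∈ supersetsCard X s ↔ U.card = s ∧ X ⊆ U := by
  simp [supersetsCard]

theorem sum_supersetsCard_sdiff {α : Type*} [Fintype α] [DecidableEq α] (X : Finset α) {s : ℕ}
    (hX : X.card ≤ s) (f : Finset α → ℝ) :
    ∑ U ∈ supersetsCard X s, f (U \ X) = ∑ U ∈ Xᶜ.powersetCard (s - X.card), f U := by
  refine sum_bij' (fun U _ => U \ X) (fun U _ => U ∪ X) ?_ ?_ ?_ ?_ ?_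
  · intro U hU
    obtain ⟨h1, h2⟩ := mem_supersetsCard.1 hU
    rw [mem_powersetCard, card_sdiff_of_subset h2, h1]
    exact ⟨fun a ha => mem_compl.2 (mem_sdiff.1 ha).2, rfl⟩
  · intro U hU
    obtain ⟨h1, h2⟩ := mem_powersetCard.1 hU
    have hd : Disjoint U X := disjoint_left.2 fun a ha => mem_compl.1 (h1 ha)
    rw [mem_supersetsCard, card_union_of_disjoint hd, h2]
    exact ⟨by omega, subset_union_right⟩
  · intro U hU
    exact sdiff_union_of_subset (mem_supersetsCard.1 hU).2
  · intro U hU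
    obtain ⟨h1, h2⟩ := mem_powersetCard.1 hU
    have hd : Disjoint U X := disjoint_left.2 fun a ha => mem_compl.1 (h1 ha)
    exact union_sdiff_cancel_right hd
  · intro U hU
    rfl

theorem card_supersetsCard {α : Type*} [Fintype α] [DecidableEq α] (X : Finset α) {s : ℕ}
    (hX : X.card ≤ s) :
    (supersetsCard X s).card = (Fintype.card α - X.card).choose (s - X.card) := by
  have := sum_supersetsCard_sdiff X hX fun _ => 1
  simp only [sum_const, nsmul_eq_mul, mul_one, card_powersetCard, card_compl] at this
  exact_mod_cast this

theorem pow_le_two_mul_factorial_mul_choose {n s x : ℕ} (hxs : x ≤ s)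
    (hn : 2 * s ^ 2 ≤ n) (hs : 0 < s) :
    (n : ℝ) ^ (s - x) ≤ 2 * ((s - x).factorial * (n - x).choose (s - x) : ℝ) := by
  have hsn : s ≤ n := by nlinarith
  have h1 : (n - s) ^ (s - x) ≤ (s - x).factorial * (n - x).choose (s - x) := by
    rw [← Nat.descFactorial_eq_factorial_mul_choose]
    refine le_trans (Nat.pow_le_pow_left ?_ _) (Nat.pow_sub_le_descFactorial _ _)
    omega
  have hn0 : (0 : ℝ) < n := by exact_mod_cast lt_of_lt_of_le hs hsn
  have hnR : 2 * (s : ℝ) ^ 2 ≤ n := by exact_mod_cast hn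
  have hsnR : (s : ℝ) ≤ n := by exact_mod_cast hsn
  have h1' : ((n : ℝ) - s) ^ (s - x) ≤ (s - x).factorial * (n - x).choose (s - x) := by
    rw [← Nat.cast_sub hsn]; exact_mod_cast h1
  have h2 : (1 : ℝ) / 2 ≤ (1 + -((s : ℝ) / n)) ^ (s - x) := by
    have hdiv : (s : ℝ) / n ≤ 1 := (div_le_one hn0).2 hsnR
    refine le_trans ?_ (one_add_mul_le_pow (by linarith) (s - x))
    have hle : ((s - x : ℕ) : ℝ) ≤ s := by exact_mod_cast Nat.sub_le s x
    have : ((s - x : ℕ) : ℝ) * (s / n) ≤ 1 / 2 := by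
      calc ((s - x : ℕ) : ℝ) * (s / n) ≤ s * (s / n) := by gcongr
        _ = s ^ 2 / n := by ring
        _ ≤ 1 / 2 := by rw [div_le_div_iff₀ hn0 two_pos]; linarith
    linarith
  have h3 : ((n : ℝ) - s) ^ (s - x) = (n : ℝ) ^ (s - x) * (1 + -((s : ℝ) / n)) ^ (s - x) := by
    rw [← mul_pow]; congr 1; field_simp; ring
  have h4 : (n : ℝ) ^ (s - x) * (1 / 2) ≤ (n : ℝ) ^ (s - x) * (1 + -((s : ℝ) / n)) ^ (s - x) := by
    gcongr
  linarith

theorem exp_neg_le_one_sub_add_sq {x : ℝ} (hx : 0 ≤ x) : Real.exp (-x) ≤ 1 - x + x ^ 2 / 2 := by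
  rw [Real.exp_neg]
  refine inv_le_of_inv_le₀ (by nlinarith [sq_nonneg (x - 1)]) ?_
  refine le_trans ?_ (Real.quadratic_le_exp_of_nonneg hx)
  rw [inv_le_iff_one_le_mul₀ (by nlinarith [sq_nonneg (x - 1)])]
  nlinarith [sq_nonneg (x ^ 2)]

/-- Lower tail bound for the number of elements of `Q` in a random `s`-set containing `X`. -/
theorem card_supersetsCard_filter_few_le {α : Type*} [Fintype α] [DecidableEq α]
    (X Q : Finset α) {s : ℕ} {η : ℝ} (hη : 0 ≤ η) (hs : 0 < s) (hX : X.card ≤ s)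
    (hn : 2 * s ^ 2 ≤ Fintype.card α) :
    (((supersetsCard X s).filter fun U =>
        ((U ∩ Q).card : ℝ) < ((Q.card : ℝ) / Fintype.card α - η) * s).card : ℝ) ≤
      2 * Real.exp X.card * Real.exp (-(η ^ 2 / 2 * s)) * (supersetsCard X s).card := by
  set n := Fintype.card α with hn_def
  set r := s - X.card with hr
  set p : ℝ := (Q.card : ℝ) / n with hp
  set y : ℝ := Real.exp (-η) with hy
  set w : α → ℝ := fun v => if v ∈ Q then y else 1 with hw
  set bad := (supersetsCard X s).filter fun U => ((U ∩ Q).card : ℝ) < (p - η) * s with hbad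
  have hn0 : (0 : ℝ) < n := by
    have : 0 < n := by nlinarith
    exact_mod_cast this
  have hy0 : 0 < y := Real.exp_pos _
  have hy1 : y ≤ 1 := Real.exp_le_one_iff.2 (by linarith)
  have hp0 : 0 ≤ p := by positivity
  have hp1 : p ≤ 1 := by
    rw [hp, div_le_one hn0]
    exact_mod_cast card_le_univ Q
  have hw0 : ∀ v, 0 ≤ w v := fun v => by
    simp only [hw]; split_ifs <;> linarith
  have hprod : ∀ U : Finset α, ∏ v ∈ U, w v = y ^ (U ∩ Q).card := fun U => by
    simp only [hw]
    rw [prod_ite_mem, prod_const]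
  have hmarkov : (bad.card : ℝ) * Real.exp (-η * ((p - η) * s)) ≤
      ∑ U ∈ supersetsCard X s, ∏ v ∈ U \ X, w v := by
    rw [← nsmul_eq_mul, ← sum_const]
    refine le_trans (sum_le_sum fun U hU => ?_)
      (sum_le_sum_of_subset_of_nonneg (filter_subset _ _) fun U _ _ => prod_nonneg fun v _ => hw0 v)
    rw [hprod, hy, ← Real.exp_nat_mul]
    refine Real.exp_le_exp.2 ?_
    have h1 : (((U \ X) ∩ Q).card : ℝ) ≤ (U ∩ Q).card := by
      exact_mod_cast card_le_card (inter_subset_inter_right sdiff_subset)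
    have h2 := (mem_filter.1 hU).2
    nlinarith
  rw [sum_supersetsCard_sdiff X hX fun U => ∏ v ∈ U, w v] at hmarkov
  have hsum : ∑ v ∈ Xᶜ, w v ≤ n * (1 - p * (1 - y)) := by
    calc ∑ v ∈ Xᶜ, w v ≤ ∑ v, w v :=
          sum_le_sum_of_subset_of_nonneg (subset_univ _) fun v _ _ => hw0 v
      _ = n * (1 - p * (1 - y)) := by
          have : ∀ v, w v = 1 - if v ∈ Q then (1 - y) else 0 := fun v => by
            simp only [hw]; split_ifs <;> ring
          simp only [this, sum_sub_distrib, sum_ite_mem, univ_inter, sum_const, nsmul_eq_mul,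
            card_univ, hp]
          field_simp
          rw [hn_def]
  have hesymm := factorial_mul_sum_powersetCard_prod_le w hw0 Xᶜ r
  have hpow : (∑ v ∈ Xᶜ, w v) ^ r ≤ (n : ℝ) ^ r * Real.exp (-(p * (1 - y)) * r) := by
    calc (∑ v ∈ Xᶜ, w v) ^ r ≤ (n * (1 - p * (1 - y))) ^ r :=
          pow_le_pow_left₀ (sum_nonneg fun v _ => hw0 v) hsum r
      _ = (n : ℝ) ^ r * (1 - p * (1 - y)) ^ r := mul_pow _ _ _
      _ ≤ (n : ℝ) ^ r * Real.exp (-(p * (1 - y))) ^ r := by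
          gcongr
          · nlinarith
          · exact Real.one_sub_le_exp_neg _
      _ = _ := by rw [← Real.exp_nat_mul, mul_comm (r : ℝ)]
  have hchoose := pow_le_two_mul_factorial_mul_choose hX hn hs
  rw [← card_supersetsCard X hX, ← hr] at hchoose
  have hrR : (r : ℝ) = s - X.card := by rw [hr, Nat.cast_sub hX]
  have hexp : Real.exp (-(p * (1 - y)) * r) ≤
      Real.exp X.card * Real.exp (-(η ^ 2 / 2 * s)) * Real.exp (-η * ((p - η) * s)) := by
    rw [← Real.exp_add, ← Real.exp_add]
    refine Real.exp_le_exp.2 ?_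
    have h1 : η - η ^ 2 / 2 ≤ 1 - y := by linarith [exp_neg_le_one_sub_add_sq hη]
    have h2 : p * (1 - y) * X.card ≤ 1 * X.card := by
      gcongr; nlinarith
    have h3 : p * (η - η ^ 2 / 2) * s ≤ p * (1 - y) * s := by gcongr
    have h4 : p * (η ^ 2 / 2 * s) ≤ 1 * (η ^ 2 / 2 * s) := by gcongr
    rw [hrR]
    nlinarith
  have hf : (0 : ℝ) < r.factorial := by exact_mod_cast Nat.factorial_pos r
  have he : 0 < Real.exp (-η * ((p - η) * s)) := Real.exp_pos _
  have key : (r.factorial : ℝ) * ((bad.card : ℝ) * Real.exp (-η * ((p - η) * s))) ≤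
      r.factorial * ((2 * Real.exp X.card * Real.exp (-(η ^ 2 / 2 * s)) *
        (supersetsCard X s).card) *
        Real.exp (-η * ((p - η) * s))) := by
    calc _ ≤ (r.factorial : ℝ) * ∑ U ∈ Xᶜ.powersetCard r, ∏ v ∈ U, w v := by gcongr
      _ ≤ (n : ℝ) ^ r * Real.exp (-(p * (1 - y)) * r) := hesymm.trans hpow
      _ ≤ 2 * (r.factorial * (supersetsCard X s).card : ℝ) *
          (Real.exp X.card * Real.exp (-(η ^ 2 / 2 * s)) * Real.exp (-η * ((p - η) * s))) := by
          gcongr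
      _ = _ := by ring
  exact le_of_mul_le_mul_right (le_of_mul_le_mul_left key hf) he

/-- A random `s`-set containing `W` meets every set of a family indexed by tuples of its own
elements in about the expected proportion, or more. -/
theorem exists_forall_card_supersetsCard_filter_le (k : ℕ) (ι : Type*) [Fintype ι] {η : ℝ}
    (hη : 0 < η) :
    ∃ s₀ : ℕ, ∀ s : ℕ, s₀ ≤ s → ∀ {α : Type} [Fintype α] [DecidableEq α],
      2 * s ^ 2 ≤ Fintype.card α → ∀ W : Finset α, W.card ≤ 2 * k →
      ∀ Q : ι → (Fin k → α) → Finset α,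
        ∃ 𝒰 ⊆ supersetsCard W s, (∀ U ∈ 𝒰, ∀ i τ, (∀ j, τ j ∈ U) →
            (((Q i τ).card : ℝ) / Fintype.card α - η) * s ≤ ((U ∩ Q i τ).card : ℝ)) ∧
          (1 - 1 / (s : ℝ) ^ 2) * (supersetsCard W s).card ≤ 𝒰.card := by
  classical
  set C : ℝ := Fintype.card ι * (2 * Real.exp (3 * k)) with hC
  have hlim : Filter.Tendsto (fun s : ℕ => C * ((s : ℝ) ^ ((k + 2 : ℕ) : ℝ) *
      Real.exp (-(η ^ 2 / 2) * s))) Filter.atTop (nhds 0) := by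
    have := ((tendsto_rpow_mul_exp_neg_mul_atTop_nhds_zero ((k + 2 : ℕ) : ℝ) (η ^ 2 / 2)
      (by positivity)).comp tendsto_natCast_atTop_atTop).const_mul C
    simpa using this
  obtain ⟨s₁, hs₁⟩ := Filter.eventually_atTop.1 (hlim.eventually_le_const one_pos)
  refine ⟨max s₁ (3 * k + 1), fun s hs α _ _ hn W hW Q => ?_⟩
  have hs1 := hs₁ s (le_trans (le_max_left _ _) hs)
  have hs2 : 3 * k + 1 ≤ s := le_trans (le_max_right _ _) hs
  have hs0 : 0 < s := by omega
  rw [Real.rpow_natCast] at hs1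
  set T := supersetsCard W s with hT
  set δ : ℝ := 2 * Real.exp (3 * k) * Real.exp (-(η ^ 2 / 2 * s)) with hδ
  set few : ι → (Fin k → α) → Finset α → Prop := fun i τ U =>
    ((U ∩ Q i τ).card : ℝ) < (((Q i τ).card : ℝ) / Fintype.card α - η) * s with hfew
  have hone : ∀ (i : ι) (τ : Fin k → α),
      ((T.filter fun U => (∀ j, τ j ∈ U) ∧ few i τ U).card : ℝ) ≤
        δ * (T.filter fun U => ∀ j, τ j ∈ U).card := by
    intro i τ
    set X := W ∪ univ.image τ with hXdef
    have hX : X.card ≤ 3 * k := by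
      have h1 := card_union_le W (univ.image τ)
      have h2 := card_image_le (s := univ) (f := τ)
      rw [card_univ, Fintype.card_fin] at h2
      rw [hXdef]
      omega
    have hTX : (T.filter fun U => ∀ j, τ j ∈ U) = supersetsCard X s := by
      ext U
      simp only [hT, hXdef, mem_filter, mem_supersetsCard, union_subset_iff, image_subset_iff,
        mem_univ, true_imp_iff, and_assoc]
    rw [← filter_filter, hTX]
    refine (card_supersetsCard_filter_few_le X (Q i τ) hη.le hs0 (by omega) hn).trans ?_
    have : Real.exp X.card ≤ Real.exp (3 * k) := Real.exp_le_exp.2 (by exact_mod_cast hX)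
    rw [hδ]
    gcongr
  have hcount : ∑ τ : Fin k → α, ((T.filter fun U => ∀ j, τ j ∈ U).card : ℝ) =
      T.card * (s : ℝ) ^ k := by
    have h := sum_card_bipartiteAbove_eq_sum_card_bipartiteBelow
      (fun (τ : Fin k → α) (U : Finset α) => ∀ j, τ j ∈ U) (s := univ) (t := T)
    simp only [bipartiteAbove, bipartiteBelow] at h
    have h2 : ∀ U ∈ T, (univ.filter fun τ : Fin k → α => ∀ j, τ j ∈ U).card = s ^ k := by
      intro U hU
      rw [← (mem_supersetsCard.1 hU).1, ← Fintype.card_piFinset_const]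
      congr 1
      ext τ
      simp [Fintype.mem_piFinset]
    rw [sum_congr rfl h2, sum_const, smul_eq_mul] at h
    exact_mod_cast h
  have hsplit := card_filter_add_card_filter_not (s := T) fun U => ∀ i τ, (∀ j, τ j ∈ U) →
    (((Q i τ).card : ℝ) / Fintype.card α - η) * s ≤ ((U ∩ Q i τ).card : ℝ)
  set good := T.filter fun U => ∀ i τ, (∀ j, τ j ∈ U) →
    (((Q i τ).card : ℝ) / Fintype.card α - η) * s ≤ ((U ∩ Q i τ).card : ℝ) with hgood
  set bad := T.filter fun U => ¬ ∀ i τ, (∀ j, τ j ∈ U) →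
    (((Q i τ).card : ℝ) / Fintype.card α - η) * s ≤ ((U ∩ Q i τ).card : ℝ) with hbad
  have hbadle : (bad.card : ℝ) ≤ Fintype.card ι * (δ * (T.card * (s : ℝ) ^ k)) := by
    have hsub : bad ⊆ (univ : Finset (ι × (Fin k → α))).biUnion fun x =>
        T.filter fun U => (∀ j, x.2 j ∈ U) ∧ few x.1 x.2 U := by
      intro U hU
      obtain ⟨h1, h2⟩ := mem_filter.1 hU
      push Not at h2
      obtain ⟨i, τ, h3, h4⟩ := h2
      exact mem_biUnion.2 ⟨(i, τ), mem_univ _, mem_filter.2 ⟨h1, h3, h4⟩⟩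
    calc (bad.card : ℝ) ≤ ∑ x : ι × (Fin k → α),
          ((T.filter fun U => (∀ j, x.2 j ∈ U) ∧ few x.1 x.2 U).card : ℝ) := by
          exact_mod_cast (card_le_card hsub).trans card_biUnion_le
      _ = ∑ i : ι, ∑ τ : Fin k → α,
          ((T.filter fun U => (∀ j, τ j ∈ U) ∧ few i τ U).card : ℝ) := Fintype.sum_prod_type _
      _ ≤ ∑ i : ι, ∑ τ : Fin k → α, δ * ((T.filter fun U => ∀ j, τ j ∈ U).card : ℝ) :=
          sum_le_sum fun i _ => sum_le_sum fun τ _ => hone i τ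
      _ = _ := by
          simp only [← mul_sum, hcount, sum_const, card_univ, nsmul_eq_mul]
          ring
  have hsR : (0 : ℝ) < s := by exact_mod_cast hs0
  have hfin : Fintype.card ι * (δ * (T.card * (s : ℝ) ^ k)) ≤ 1 / (s : ℝ) ^ 2 * T.card := by
    have heq : Fintype.card ι * (δ * (T.card * (s : ℝ) ^ k)) =
        (C * ((s : ℝ) ^ (k + 2) * Real.exp (-(η ^ 2 / 2) * s))) * (1 / (s : ℝ) ^ 2 * T.card) := by
      rw [hC, hδ, neg_mul]
      field_simp
      ring
    rw [heq]
    exact mul_le_of_le_one_left (by positivity) hs1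
  refine ⟨good, filter_subset _ _, fun U hU => (mem_filter.1 hU).2, ?_⟩
  have hsplitR : (good.card : ℝ) + bad.card = T.card := by exact_mod_cast hsplit
  linarith

/-! ### Local density in graphs of large minimum degree -/

section LocalDensity

variable {V : Type*} [DecidableEq V] (G : SimpleGraph V) [DecidableRel G.Adj]

theorem SimpleGraph.card_interedges_self_le (A B : Finset V) :
    (G.interedges A A).card ≤ (G.interedges B B).card + 2 * ((A \ B).card * A.card) := by
  have hsub : G.interedges A A ⊆ G.interedges B B ∪ ((A \ B) ×ˢ A ∪ A ×ˢ (A \ B)) := by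
    rintro ⟨v, w⟩ h
    rw [SimpleGraph.mk_mem_interedges_iff] at h
    simp only [mem_union, SimpleGraph.mk_mem_interedges_iff, mem_product, mem_sdiff]
    tauto
  have h1 := (card_le_card hsub).trans (card_union_le _ _)
  have h2 := card_union_le ((A \ B) ×ˢ A) (A ×ˢ (A \ B))
  rw [card_product, card_product] at h2
  nlinarith

variable [Fintype V]

theorem SimpleGraph.card_interedges_eq_sum (A B : Finset V) :
    (G.interedges A B).card = ∑ v ∈ A, (G.neighborFinset v ∩ B).card := by
  rw [SimpleGraph.interedges_def, card_filter, sum_product]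
  refine sum_congr rfl fun v _ => ?_
  rw [← card_filter]
  congr 1
  ext w
  simp [and_comm]

/-- In a graph where large vertex sets span many edges, slightly smaller sets do, too. -/
theorem SimpleGraph.le_card_interedges_of_almost_large {c μ : ℝ} (hμ : 0 < μ) (hc1 : c ≤ 1)
    (hn : 8 ≤ μ * Fintype.card V)
    (hdense : ∀ A : Finset V, c * Fintype.card V ≤ A.card →
      μ * (Fintype.card V : ℝ) ^ 2 ≤ (G.interedges A A).card)
    (B : Finset V) (hB : (c - μ / 4) * Fintype.card V ≤ B.card) :
    μ / 4 * (Fintype.card V : ℝ) ^ 2 ≤ (G.interedges B B).card := by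
  set n := Fintype.card V with hn_def
  have hn0 : (0 : ℝ) < n := by
    by_contra h
    nlinarith
  have hceil : ⌈c * n⌉₊ ≤ n := Nat.ceil_le.2 (by nlinarith)
  obtain ⟨C, hBC, hC⟩ := exists_superset_card_eq (s := B) (n := max B.card ⌈c * n⌉₊)
    (le_max_left _ _) (max_le (card_le_univ B) hceil)
  have hClarge : c * n ≤ C.card := by
    rw [hC]
    exact (Nat.le_ceil _).trans (by exact_mod_cast le_max_right _ _)
  have hdiff : ((C \ B).card : ℝ) ≤ μ / 4 * n + 1 := by
    rw [cast_card_sdiff hBC, hC, Nat.cast_max]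
    rcases le_total (B.card : ℝ) (⌈c * n⌉₊ : ℝ) with h | h
    · rw [max_eq_right h]
      by_cases hcn : 0 ≤ c * n
      · linarith [Nat.ceil_lt_add_one hcn]
      · rw [Nat.ceil_eq_zero.2 (by linarith)]
        have : (0 : ℝ) ≤ B.card := by positivity
        have : 0 < μ * n := by positivity
        push_cast
        linarith
    · rw [max_eq_left h]
      have : 0 < μ * n := by positivity
      linarith
  have h1 := hdense C hClarge
  have h2 : ((G.interedges C C).card : ℝ) ≤
      (G.interedges B B).card + 2 * ((C \ B).card * C.card) := by
    exact_mod_cast G.card_interedges_self_le C B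
  have h3 : (C.card : ℝ) ≤ n := by exact_mod_cast card_le_univ C
  have h4 : ((C \ B).card : ℝ) * C.card ≤ (μ / 4 * n + 1) * n := by gcongr
  nlinarith

/-- A set spanning many edges contains many vertices of large degree inside the set. -/
theorem SimpleGraph.le_card_filter_of_le_card_interedges {c : ℝ}
    (B : Finset V) (hB : 2 * c * (Fintype.card V : ℝ) ^ 2 ≤ (G.interedges B B).card) :
    c * Fintype.card V ≤
      (B.filter fun u => c * Fintype.card V ≤ ((G.neighborFinset u ∩ B).card : ℝ)).card := by
  set n := Fintype.card V with hn_def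
  rcases Nat.eq_zero_or_pos n with hz | hpos
  · rw [hz]; simp
  have hn0 : (0 : ℝ) < n := by exact_mod_cast hpos
  by_cases hc : 0 ≤ c
  swap
  · have : c * n ≤ 0 := by nlinarith
    exact this.trans (by positivity)
  have hsum : ((G.interedges B B).card : ℝ) ≤ ∑ v ∈ B,
      ((if c * n ≤ ((G.neighborFinset v ∩ B).card : ℝ) then (n : ℝ) else 0) + c * n) := by
    rw [G.card_interedges_eq_sum]
    push_cast
    refine sum_le_sum fun v _ => ?_
    have h1 : ((G.neighborFinset v ∩ B).card : ℝ) ≤ n := by exact_mod_cast card_le_univ _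
    have h2 : 0 ≤ c * n := by positivity
    split_ifs with h
    · linarith
    · linarith
  rw [sum_add_distrib, ← sum_filter, sum_const, sum_const, nsmul_eq_mul, nsmul_eq_mul] at hsum
  have h3 : (B.card : ℝ) * (c * n) ≤ n * (c * n) := by
    gcongr
    exact_mod_cast card_le_univ B
  nlinarith

/-- Suppose that `G` has minimum degree about `(1 - c) n` and all sets of `c n` vertices span many
edges. If `U` meets certain sets defined by its vertices in the expected proportion, then all
subsets of `U` of proportion `c` span many edges. -/
theorem SimpleGraph.le_card_interedges_of_sample {c μ μ' ε : ℝ} (hc0 : 0 < c) (hc1 : c ≤ 1)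
    (hμ : 0 < μ) (hμ1 : μ ≤ 1) (hμ' : 0 < μ') (hε : 0 < ε)
    (hμμ' : μ' ≤ μ ^ 2 / 5000 * c) (hμε : ε ≤ μ ^ 2 / 5000)
    (hn : 8 ≤ μ * Fintype.card V)
    (hmin : ∀ v, (1 - c - ε) * Fintype.card V ≤ (G.neighborFinset v).card)
    (hdense : ∀ A : Finset V, c * Fintype.card V ≤ A.card →
      μ * (Fintype.card V : ℝ) ^ 2 ≤ (G.interedges A A).card)
    (U : Finset V) (hU : 0 < U.card)
    (hN : ∀ v ∈ U, (((G.neighborFinset v).card : ℝ) / Fintype.card V - ε) * U.card ≤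
      ((U ∩ G.neighborFinset v).card : ℝ))
    (hB : ∀ v ∈ U, (((((G.neighborFinset v)ᶜ.filter fun u => μ / 8 * Fintype.card V ≤
        ((G.neighborFinset u ∩ (G.neighborFinset v)ᶜ).card : ℝ)).card : ℝ)) /
          Fintype.card V - ε) * U.card ≤
      ((U ∩ (G.neighborFinset v)ᶜ.filter fun u => μ / 8 * Fintype.card V ≤
        ((G.neighborFinset u ∩ (G.neighborFinset v)ᶜ).card : ℝ)).card : ℝ))
    (hNB : ∀ v ∈ U, ∀ u ∈ U, (((G.neighborFinset u ∩ (G.neighborFinset v)ᶜ).card : ℝ) /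
        Fintype.card V - ε) * U.card ≤
      ((U ∩ (G.neighborFinset u ∩ (G.neighborFinset v)ᶜ)).card : ℝ))
    (A : Finset V) (hAU : A ⊆ U) (hA : c * U.card ≤ A.card) :
    2 * μ' * (U.card : ℝ) ^ 2 ≤ (G.interedges A A).card := by
  by_contra! hfew
  set n : ℝ := (Fintype.card V : ℝ) with hn_def
  set s : ℝ := (U.card : ℝ) with hs_def
  clear_value n s
  have hn0 : 0 < n := by by_contra h; nlinarith
  have hs0 : 0 < s := by rw [hs_def]; exact_mod_cast hU
  have hμsq : μ ^ 2 ≤ μ := by nlinarith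
  have hA0 : (0 : ℝ) < A.card := lt_of_lt_of_le (by positivity) hA
  have hAne : A.Nonempty := by
    rw [← card_pos]; exact_mod_cast hA0
  obtain ⟨κ, hκ⟩ : ∃ κ, κ = μ' / c := ⟨_, rfl⟩
  have hκ0 : 0 < κ := by rw [hκ]; positivity
  have hκc : μ' = κ * c := by rw [hκ]; field_simp
  have hκμ : κ ≤ μ ^ 2 / 5000 := by rw [hκ, div_le_iff₀ hc0]; exact hμμ'
  have hμ'κ : μ' ≤ κ := by rw [hκc]; nlinarith
  -- a vertex of small degree in `A`
  obtain ⟨v, hvA, hv⟩ : ∃ v ∈ A, ((G.neighborFinset v ∩ A).card : ℝ) ≤ 2 * κ * s := by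
    refine exists_le_of_sum_le hAne ?_
    rw [G.card_interedges_eq_sum] at hfew
    push_cast at hfew
    rw [sum_const, nsmul_eq_mul]
    refine hfew.le.trans ?_
    have : c * s * (2 * κ * s) ≤ A.card * (2 * κ * s) := by gcongr
    rw [hκc]
    linarith
  have hvU := hAU hvA
  set B := (G.neighborFinset v)ᶜ with hBdef
  have hBcard : (B.card : ℝ) = n - (G.neighborFinset v).card := by
    rw [hBdef, card_compl, Nat.cast_sub (card_le_univ _), hn_def]
  -- `A` is almost contained in `U ∩ B`
  have hUB : ((U ∩ B).card : ℝ) ≤ (B.card / n + ε) * s := by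
    have h1 : ((U ∩ G.neighborFinset v).card : ℝ) + (U ∩ B).card = s := by
      have := card_inter_add_card_sdiff U (G.neighborFinset v)
      rw [sdiff_eq_inter_compl, ← hBdef] at this
      rw [hs_def]; exact_mod_cast this
    have h2 := hN v hvU
    have h3 : (B.card : ℝ) / n = 1 - (G.neighborFinset v).card / n := by
      rw [hBcard]; field_simp
    rw [h3]
    linarith
  have hAB : (A.card : ℝ) - 2 * κ * s ≤ (A ∩ B).card := by
    have h1 : ((A ∩ G.neighborFinset v).card : ℝ) + (A ∩ B).card = A.card := by
      have := card_inter_add_card_sdiff A (G.neighborFinset v)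
      rw [sdiff_eq_inter_compl, ← hBdef] at this
      exact_mod_cast this
    rw [inter_comm] at hv
    linarith
  have hABU : ((A ∩ B).card : ℝ) ≤ (U ∩ B).card := by
    exact_mod_cast card_le_card (inter_subset_inter_right hAU)
  have hBlarge : (c - μ / 4) * n ≤ B.card := by
    have h1 : (c - 2 * κ - ε) * s ≤ B.card / n * s := by linarith
    have h2 := le_of_mul_le_mul_right h1 hs0
    rw [le_div_iff₀ hn0] at h2
    refine le_trans (mul_le_mul_of_nonneg_right ?_ hn0.le) h2
    linarith
  have hBhigh : μ / 8 * n ≤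
      (B.filter fun u => μ / 8 * n ≤ ((G.neighborFinset u ∩ B).card : ℝ)).card := by
    rw [hn_def] at hn hdense hBlarge ⊢
    have hBdense := G.le_card_interedges_of_almost_large hμ hc1 hn hdense B hBlarge
    exact G.le_card_filter_of_le_card_interedges B (le_trans (le_of_eq (by ring)) hBdense)
  have hBv := hB v hvU
  set B' := B.filter fun u => μ / 8 * n ≤ ((G.neighborFinset u ∩ B).card : ℝ) with hB'def
  have hUB' : μ / 16 * s ≤ (U ∩ B').card := by
    refine le_trans ?_ hBv
    have : μ / 8 ≤ B'.card / n := by rw [le_div_iff₀ hn0]; exact hBhigh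
    gcongr
    linarith
  have hdeg : ∀ u ∈ U ∩ B', μ / 16 * s ≤ ((G.neighborFinset u ∩ (U ∩ B)).card : ℝ) := by
    intro u hu
    obtain ⟨huU, huB'⟩ := mem_inter.1 hu
    have h1 := hNB v hvU u huU
    rw [inter_left_comm] at h1
    refine le_trans ?_ h1
    have : μ / 8 ≤ (G.neighborFinset u ∩ B).card / n := by
      rw [le_div_iff₀ hn0]; exact (mem_filter.1 huB').2
    gcongr
    linarith
  have hlower : μ / 16 * s * (μ / 16 * s) ≤ (G.interedges (U ∩ B) (U ∩ B)).card := by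
    rw [G.card_interedges_eq_sum]
    push_cast
    calc μ / 16 * s * (μ / 16 * s) ≤ (U ∩ B').card * (μ / 16 * s) :=
          mul_le_mul_of_nonneg_right hUB' (by positivity)
      _ = ∑ u ∈ U ∩ B', μ / 16 * s := by rw [sum_const, nsmul_eq_mul]
      _ ≤ ∑ u ∈ U ∩ B', ((G.neighborFinset u ∩ (U ∩ B)).card : ℝ) := sum_le_sum hdeg
      _ ≤ _ := sum_le_sum_of_subset_of_nonneg
          (inter_subset_inter_left (filter_subset _ _)) fun _ _ _ => Nat.cast_nonneg _
  have hdiff : (((U ∩ B) \ A).card : ℝ) ≤ (2 * ε + 2 * κ) * s := by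
    have h1 : (((U ∩ B) ∩ A).card : ℝ) + ((U ∩ B) \ A).card = (U ∩ B).card := by
      exact_mod_cast card_inter_add_card_sdiff (U ∩ B) A
    have h2 : (U ∩ B) ∩ A = A ∩ B := by
      rw [inter_right_comm, inter_eq_right.2 hAU]
    have h3 : (B.card : ℝ) / n ≤ c + ε := by
      rw [div_le_iff₀ hn0, hBcard]
      linarith [hmin v]
    have h4 : (B.card : ℝ) / n * s ≤ (c + ε) * s :=
      mul_le_mul_of_nonneg_right h3 hs0.le
    rw [h2] at h1
    linarith
  have hupper : ((G.interedges (U ∩ B) (U ∩ B)).card : ℝ) ≤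
      (G.interedges A A).card + 2 * (((U ∩ B) \ A).card * (U ∩ B).card) := by
    exact_mod_cast G.card_interedges_self_le (U ∩ B) A
  have hUBs : ((U ∩ B).card : ℝ) ≤ s := by
    rw [hs_def]; exact_mod_cast card_le_card inter_subset_left
  have hprod : (((U ∩ B) \ A).card : ℝ) * (U ∩ B).card ≤ (2 * ε + 2 * κ) * s * s :=
    mul_le_mul hdiff hUBs (Nat.cast_nonneg _) ((Nat.cast_nonneg _).trans hdiff)
  have hs2 : 0 < s ^ 2 := by positivity
  have hfinal : (μ ^ 2 / 256 - (2 * μ' + 4 * ε + 4 * κ)) * s ^ 2 < 0 := by linarith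
  have hpos : 0 < μ ^ 2 / 256 - (2 * μ' + 4 * ε + 4 * κ) := by
    have : 0 < μ ^ 2 := by positivity
    linarith
  nlinarith

end LocalDensity

/-! ### Links and shadows of uniform hypergraphs -/

/-- The vertices extending `T` to a larger supported set. -/
def linkNbhd {n : ℕ} (E : Finset (Finset (Fin n))) (T : Finset (Fin n)) : Finset (Fin n) :=
  univ.filter fun x => x ∉ T ∧ ∃ e ∈ E, insert x T ⊆ e

theorem mem_linkNbhd {n : ℕ} {E : Finset (Finset (Fin n))} {T : Finset (Fin n)} {x : Fin n} :
    x ∈ linkNbhd E T ↔ x ∉ T ∧ ∃ e ∈ E, insert x T ⊆ e := by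
  simp [linkNbhd]

/-- The graph of supported pairs. -/
def shadowGraph {n : ℕ} (E : Finset (Finset (Fin n))) : SimpleGraph (Fin n) where
  Adj v w := v ≠ w ∧ ∃ e ∈ E, v ∈ e ∧ w ∈ e
  symm := ⟨fun _ _ ⟨h, e, he, hv, hw⟩ => ⟨h.symm, e, he, hw, hv⟩⟩
  loopless := ⟨fun _ h => h.1 rfl⟩

instance {n : ℕ} (E : Finset (Finset (Fin n))) : DecidableRel (shadowGraph E).Adj :=
  fun v w => inferInstanceAs (Decidable (v ≠ w ∧ ∃ e ∈ E, v ∈ e ∧ w ∈ e))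

theorem neighborFinset_shadowGraph {n : ℕ} (E : Finset (Finset (Fin n))) (v : Fin n) :
    (shadowGraph E).neighborFinset v = linkNbhd E {v} := by
  ext w
  rw [SimpleGraph.mem_neighborFinset, mem_linkNbhd]
  simp only [shadowGraph, mem_singleton, insert_subset_iff, singleton_subset_iff]
  exact and_congr ne_comm (exists_congr fun e => and_congr_right fun _ => and_comm)

theorem suppPairs_le_card_interedges {n : ℕ} (E : Finset (Finset (Fin n))) (A : Finset (Fin n)) :
    suppPairs E A ≤ ((shadowGraph E).interedges A A).card := by
  refine card_le_card_of_surjOn (fun x => {x.1, x.2}) fun p hp => ?_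
  obtain ⟨hp, e, he, hpe⟩ := mem_filter.1 (mem_coe.1 hp)
  obtain ⟨hpA, hp2⟩ := mem_powersetCard.1 hp
  obtain ⟨v, w, hvw, rfl⟩ := card_eq_two.1 hp2
  simp only [insert_subset_iff, singleton_subset_iff] at hpe hpA
  exact ⟨(v, w), mem_coe.2 ((shadowGraph E).mk_mem_interedges_iff.2
    ⟨hpA.1, hpA.2, hvw, e, he, hpe⟩), rfl⟩

theorem card_interedges_le_two_mul_suppPairs {n : ℕ} (E : Finset (Finset (Fin n)))
    (A : Finset (Fin n)) : ((shadowGraph E).interedges A A).card ≤ 2 * suppPairs E A := by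
  refine card_le_mul_card_image_of_maps_to (f := fun x => ({x.1, x.2} : Finset (Fin n))) ?_ 2 ?_
  · rintro ⟨v, w⟩ h
    obtain ⟨hv, hw, hvw, e, he, hve, hwe⟩ := (shadowGraph E).mk_mem_interedges_iff.1 h
    simp only [mem_filter, mem_powersetCard, insert_subset_iff, singleton_subset_iff]
    exact ⟨⟨⟨hv, hw⟩, card_pair hvw⟩, e, he, hve, hwe⟩
  · intro p hp
    obtain ⟨v, w, hvw, rfl⟩ := card_eq_two.1 (mem_powersetCard.1 (mem_filter.1 hp).1).2
    refine (card_le_card (t := {(v, w), (w, v)}) ?_).trans card_le_two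
    rintro ⟨a, b⟩ h
    obtain ⟨h1, h2⟩ := mem_filter.1 h
    have hab : a ≠ b := ((shadowGraph E).mk_mem_interedges_iff.1 h1).2.2.1
    have ha : a ∈ ({v, w} : Finset (Fin n)) := h2 ▸ mem_insert_self a {b}
    have hb : b ∈ ({v, w} : Finset (Fin n)) := h2 ▸ mem_insert_of_mem (mem_singleton_self b)
    simp only [mem_insert, mem_singleton, Prod.mk.injEq] at ha hb ⊢
    grind

theorem linkNbhd_anti {n : ℕ} (E : Finset (Finset (Fin n))) {T S : Finset (Fin n)} (h : T ⊆ S) :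
    linkNbhd E S ⊆ linkNbhd E T := by
  intro x hx
  obtain ⟨h1, e, he, h2⟩ := mem_linkNbhd.1 hx
  exact mem_linkNbhd.2 ⟨fun h' => h1 (h h'), e, he, (insert_subset_insert x h).trans h2⟩

theorem card_filter_superset_le_card_linkNbhd {n k : ℕ} {E : Finset (Finset (Fin n))}
    (hE : ∀ e ∈ E, e.card = k) {S : Finset (Fin n)} (hS : S.card + 1 = k) :
    (E.filter fun e => S ⊆ e).card ≤ (linkNbhd E S).card := by
  refine card_le_card_of_surjOn (fun x => insert x S) fun e he => ?_
  obtain ⟨he, hSe⟩ := mem_filter.1 (mem_coe.1 he)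
  obtain ⟨x, hx, rfl⟩ := exists_eq_insert_iff.2 ⟨hSe, hS.trans (hE e he).symm⟩
  exact ⟨x, mem_coe.2 (mem_linkNbhd.2 ⟨hx, _, he, Subset.rfl⟩), rfl⟩

theorem card_inter_linkNbhd_le {n k : ℕ} {E : Finset (Finset (Fin n))}
    (hE : ∀ e ∈ E, e.card = k) {S U : Finset (Fin n)} (hS : S.card + 1 = k) (hSU : S ⊆ U) :
    (U ∩ linkNbhd E S).card ≤ ((E.filter fun e => e ⊆ U).filter fun e => S ⊆ e).card := by
  refine card_le_card_of_injOn (fun x => insert x S) (fun x hx => ?_) fun x hx y hy h => ?_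
  · obtain ⟨hxU, hx⟩ := mem_inter.1 (mem_coe.1 hx)
    obtain ⟨hxS, e, he, hxe⟩ := mem_linkNbhd.1 hx
    have : insert x S = e := eq_of_subset_of_card_le hxe (by
      rw [card_insert_of_notMem hxS, hS, hE e he])
    simp only [coe_filter, mem_filter, Set.mem_ofPred_eq]
    exact ⟨⟨this ▸ he, insert_subset hxU hSU⟩, subset_insert x S⟩
  · have hxS := (mem_linkNbhd.1 (mem_inter.1 (mem_coe.1 hx)).2).1
    exact (insert_inj hxS).1 h

theorem le_card_linkNbhd {n k : ℕ} {E : Finset (Finset (Fin n))} (hE : ∀ e ∈ E, e.card = k)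
    {d : ℝ} (hd : ∀ S : Finset (Fin n), S.card = k - 1 → (∃ e ∈ E, S ⊆ e) →
      d ≤ ((E.filter fun e => S ⊆ e).card : ℝ))
    {T : Finset (Fin n)} (hT : T.card < k) (hTE : ∃ e ∈ E, T ⊆ e) :
    d ≤ (linkNbhd E T).card := by
  obtain ⟨e, he, hTe⟩ := hTE
  obtain ⟨S, hTS, hSe, hS⟩ := exists_subsuperset_card_eq (n := k - 1) hTe (by omega)
    (by rw [hE e he]; omega)
  refine (hd S hS ⟨e, he, hSe⟩).trans ?_
  exact_mod_cast (card_filter_superset_le_card_linkNbhd hE (by omega)).trans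
    (card_le_card (linkNbhd_anti E hTS))

/-- If supported subsets of `U` extend inside `U`, then they lie in edges inside `U`. -/
theorem exists_edge_subset_of_linkNbhd_nonempty {n k : ℕ} {E : Finset (Finset (Fin n))}
    (hE : ∀ e ∈ E, e.card = k) {U : Finset (Fin n)}
    (hU : ∀ T ⊆ U, T.Nonempty → T.card < k → (∃ e ∈ E, T ⊆ e) → (U ∩ linkNbhd E T).Nonempty)
    {T : Finset (Fin n)} (hTU : T ⊆ U) (hT : T.Nonempty) (hTE : ∃ e ∈ E, T ⊆ e) :
    ∃ e ∈ E.filter (fun e => e ⊆ U), T ⊆ e := by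
  induction hm : k - T.card generalizing T with
  | zero =>
    obtain ⟨e, he, hTe⟩ := hTE
    have : T = e := eq_of_subset_of_card_le hTe (by rw [hE e he]; omega)
    exact ⟨e, mem_filter.2 ⟨he, this ▸ hTU⟩, hTe⟩
  | succ m ih =>
    obtain ⟨x, hx⟩ := hU T hTU hT (by omega) hTE
    obtain ⟨hxU, hx⟩ := mem_inter.1 hx
    obtain ⟨hxT, hxE⟩ := mem_linkNbhd.1 hx
    obtain ⟨e, he, hxe⟩ := ih (insert_subset hxU hTU) (insert_nonempty x T) hxE
      (by rw [card_insert_of_notMem hxT]; omega)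
    exact ⟨e, he, (subset_insert x T).trans hxe⟩

theorem Finset.exists_image_univ_fin_eq {α : Type*} [DecidableEq α] {k : ℕ} {T : Finset α}
    (hT : T.Nonempty) (hk : T.card ≤ k) : ∃ τ : Fin k → α, univ.image τ = T := by
  obtain ⟨a, ha⟩ := hT
  refine ⟨fun j => if h : (j : ℕ) < T.card then (T.equivFin.symm ⟨j, h⟩ : α) else a, ?_⟩
  ext x
  simp only [mem_image, mem_univ, true_and]
  constructor
  · rintro ⟨j, rfl⟩
    split_ifs
    · exact (T.equivFin.symm _).2
    · exact ha
  · intro hx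
    refine ⟨⟨T.equivFin ⟨x, hx⟩, (T.equivFin ⟨x, hx⟩).2.trans_le hk⟩, ?_⟩
    simp

theorem two_le_div_mul_self {k m : ℕ} (hk : 2 ≤ k) (hm : 1 ≤ m) (hmk : m ≤ k) :
    2 ≤ k / m * m := by
  have h1 : 1 ≤ k / m := (Nat.one_le_div_iff hm).2 hmk
  rcases Nat.lt_or_ge m 2 with h | h
  · have : m = 1 := by omega
    subst this
    simpa using hk
  · nlinarith

/-- If `U` meets certain sets defined by tuples of its elements in the expected proportion, then
it inherits the degree and density properties of the hypergraph. -/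
theorem inherits_of_forall_le_card_inter {n k : ℕ} (hk : 3 ≤ k) {c μ μ' ε : ℝ} (hc0 : 0 < c)
    (hc1 : c ≤ 1 / 2) (hμ : 0 < μ) (hμ1 : μ ≤ 1) (hμ' : 0 < μ') (hε : 0 < ε)
    (hμμ' : μ' ≤ μ ^ 2 / 5000 * c) (hμε : ε ≤ μ ^ 2 / 5000) (hn : 8 ≤ μ * n)
    {E : Finset (Finset (Fin n))} (hE : ∀ e ∈ E, e.card = k)
    (hiso : ∀ v : Fin n, ∃ e ∈ E, v ∈ e)
    (hdeg : ∀ S : Finset (Fin n), S.card = k - 1 → (∃ e ∈ E, S ⊆ e) →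
      (1 - c - ε) * (n : ℝ) ≤ ((E.filter fun e => S ⊆ e).card : ℝ))
    (hdense : ∀ A : Finset (Fin n), c * n ≤ A.card → μ * (n : ℝ) ^ 2 ≤ suppPairs E A)
    {U : Finset (Fin n)} (hU : 0 < U.card)
    (hlink : ∀ τ : Fin k → Fin n, (∀ j, τ j ∈ U) →
      (((linkNbhd E (univ.image τ)).card : ℝ) / n - ε) * U.card ≤
        ((U ∩ linkNbhd E (univ.image τ)).card : ℝ))
    (hhigh : ∀ v ∈ U, (((((linkNbhd E {v})ᶜ.filter fun u => μ / 8 * n ≤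
        ((linkNbhd E {u} ∩ (linkNbhd E {v})ᶜ).card : ℝ)).card : ℝ)) / n - ε) * U.card ≤
      ((U ∩ (linkNbhd E {v})ᶜ.filter fun u => μ / 8 * n ≤
        ((linkNbhd E {u} ∩ (linkNbhd E {v})ᶜ).card : ℝ)).card : ℝ))
    (hpair : ∀ v ∈ U, ∀ u ∈ U,
      (((linkNbhd E {u} ∩ (linkNbhd E {v})ᶜ).card : ℝ) / n - ε) * U.card ≤
        ((U ∩ (linkNbhd E {u} ∩ (linkNbhd E {v})ᶜ)).card : ℝ)) :
    (∀ v ∈ U, ∃ e ∈ E.filter (fun e => e ⊆ U), v ∈ e) ∧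
    (∀ S : Finset (Fin n), S.card = k - 1 → (∃ e ∈ E.filter (fun e => e ⊆ U), S ⊆ e) →
      (1 - c - 2 * ε) * (U.card : ℝ) ≤
        (((E.filter (fun e => e ⊆ U)).filter fun e => S ⊆ e).card : ℝ)) ∧
    ∀ A : Finset (Fin n), A ⊆ U → c * (U.card : ℝ) ≤ (A.card : ℝ) →
      μ' * (U.card : ℝ) ^ 2 ≤ (suppPairs (E.filter (fun e => e ⊆ U)) A : ℝ) := by
  have hn0 : (0 : ℝ) < n := by by_contra h; nlinarith
  have hUR : (0 : ℝ) < U.card := by exact_mod_cast hU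
  have hlinkT : ∀ T ⊆ U, T.Nonempty → T.card ≤ k →
      (((linkNbhd E T).card : ℝ) / n - ε) * U.card ≤ ((U ∩ linkNbhd E T).card : ℝ) := by
    intro T hTU hT hTk
    obtain ⟨τ, rfl⟩ := exists_image_univ_fin_eq hT hTk
    exact hlink τ fun j => hTU (mem_image_of_mem τ (mem_univ j))
  have hext : ∀ T ⊆ U, T.Nonempty → T.card < k → (∃ e ∈ E, T ⊆ e) →
      (1 - c - 2 * ε) * (U.card : ℝ) ≤ ((U ∩ linkNbhd E T).card : ℝ) := by
    intro T hTU hT hTk hTE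
    refine le_trans (mul_le_mul_of_nonneg_right ?_ hUR.le) (hlinkT T hTU hT hTk.le)
    have := (le_div_iff₀ hn0).2 (le_card_linkNbhd hE hdeg hTk hTE)
    linarith
  have hedge : ∀ T ⊆ U, T.Nonempty → (∃ e ∈ E, T ⊆ e) →
      ∃ e ∈ E.filter (fun e => e ⊆ U), T ⊆ e := by
    intro T hTU hT hTE
    refine exists_edge_subset_of_linkNbhd_nonempty hE (fun T hTU hT hTk hTE => ?_) hTU hT hTE
    rw [← card_pos]
    have hpos : 0 < (1 - c - 2 * ε) * (U.card : ℝ) := mul_pos (by nlinarith) hUR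
    exact_mod_cast hpos.trans_le (hext T hTU hT hTk hTE)
  refine ⟨fun v hv => ?_, fun S hS hSE => ?_, fun A hAU hA => ?_⟩
  · obtain ⟨e, he, hve⟩ := hiso v
    simpa using hedge {v} (by simpa using hv) (singleton_nonempty v) ⟨e, he, by simpa using hve⟩
  · obtain ⟨e, he, hSe⟩ := hSE
    obtain ⟨he, heU⟩ := mem_filter.1 he
    have hSU := hSe.trans heU
    refine (hext S hSU (card_pos.1 (by omega)) (by omega) ⟨e, he, hSe⟩).trans ?_
    exact_mod_cast card_inter_linkNbhd_le hE (by omega) hSU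
  · have hsupp : suppPairs (E.filter (fun e => e ⊆ U)) A = suppPairs E A := by
      unfold suppPairs
      congr 1
      refine filter_congr fun p hp => ⟨?_, fun h => ?_⟩
      · rintro ⟨e, he, hpe⟩
        exact ⟨e, (mem_filter.1 he).1, hpe⟩
      · obtain ⟨hpA, hp2⟩ := mem_powersetCard.1 hp
        exact hedge p (hpA.trans hAU) (card_pos.1 (by omega)) h
    rw [hsupp]
    have hmain := (shadowGraph E).le_card_interedges_of_sample (μ := μ) hc0 (by linarith) hμ hμ1
      hμ' hε hμμ' hμε (by simpa using hn)
    simp only [neighborFinset_shadowGraph, Fintype.card_fin] at hmain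
    have h := hmain
      (fun v => by
        obtain ⟨e, he, hve⟩ := hiso v
        exact le_card_linkNbhd hE hdeg (by rw [card_singleton]; omega)
          ⟨e, he, by simpa using hve⟩)
      (fun A hA => (hdense A hA).trans (by exact_mod_cast suppPairs_le_card_interedges E A))
      U hU
      (fun v hv => hlinkT {v} (by simpa using hv) (singleton_nonempty v)
        (by rw [card_singleton]; omega))
      hhigh hpair A hAU hA
    have h2 : (((shadowGraph E).interedges A A).card : ℝ) ≤ 2 * suppPairs E A := by
      exact_mod_cast card_interedges_le_two_mul_suppPairs E A
    linarith

/-- Structural inheritance: a uniformly random `s`-subset containing `W` of a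
non-extremal hypergraph induces, with probability at least `1 - 1/s²`, a
non-extremal hypergraph (with slightly weaker constants). Probability is
expressed by counting: the number of good `s`-subsets containing `W` is at
least `(1 - 1/s²)` times the total number of `s`-subsets containing `W`. -/
theorem structural_inheritance
    (k l t : ℕ) (hk : 3 ≤ k) (hl : 1 ≤ l) (hlk : l ≤ k - 1)
    (ht : t = k / (k - l) * (k - l)) :
    ∃ μ₀ : ℝ, 0 < μ₀ ∧ ∀ μ : ℝ, 0 < μ → μ ≤ μ₀ →
    ∃ μ'₀ : ℝ, 0 < μ'₀ ∧ ∀ μ' : ℝ, 0 < μ' → μ' ≤ μ'₀ →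
    ∃ ε₀ : ℝ, 0 < ε₀ ∧ ∀ ε : ℝ, 0 < ε → ε ≤ ε₀ →
    ∃ s₀ : ℕ, ∀ s : ℕ, s₀ ≤ s →
    ∃ n₀ : ℕ, ∀ n : ℕ, n₀ ≤ n → (k - l) ∣ n →
    ∀ E : Finset (Finset (Fin n)),
      (∀ e ∈ E, e.card = k) →
      (∀ v : Fin n, ∃ e ∈ E, v ∈ e) →
      (∀ S : Finset (Fin n), S.card = k - 1 → (∃ e ∈ E, S ⊆ e) →
        (1 - 1 / (t : ℝ) - ε) * (n : ℝ) ≤ ((E.filter fun e => S ⊆ e).card : ℝ)) →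
      (∀ A : Finset (Fin n), (n : ℝ) / (t : ℝ) ≤ (A.card : ℝ) →
        μ * (n : ℝ) ^ 2 ≤ (suppPairs E A : ℝ)) →
      ∀ W : Finset (Fin n), W.card ≤ 2 * k →
        (1 - 1 / (s : ℝ) ^ 2) *
            (Set.ncard {U : Finset (Fin n) | U.card = s ∧ W ⊆ U} : ℝ) ≤
          (Set.ncard {U : Finset (Fin n) | U.card = s ∧ W ⊆ U ∧
            (∀ v ∈ U, ∃ e ∈ E.filter (fun e => e ⊆ U), v ∈ e) ∧
            (∀ S : Finset (Fin n), S.card = k - 1 →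
              (∃ e ∈ E.filter (fun e => e ⊆ U), S ⊆ e) →
              (1 - 1 / (t : ℝ) - 2 * ε) * (s : ℝ) ≤
                (((E.filter (fun e => e ⊆ U)).filter fun e => S ⊆ e).card : ℝ)) ∧
            (∀ A : Finset (Fin n), A ⊆ U → (s : ℝ) / (t : ℝ) ≤ (A.card : ℝ) →
              μ' * (s : ℝ) ^ 2 ≤
                (suppPairs (E.filter (fun e => e ⊆ U)) A : ℝ))} : ℝ) := by
  have ht2 : 2 ≤ t := by
    rw [ht]
    exact two_le_div_mul_self (by omega) (by omega) (by omega)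
  have htR : (2 : ℝ) ≤ t := by exact_mod_cast ht2
  have ht0 : (0 : ℝ) < t := by linarith
  have hc1 : 1 / (t : ℝ) ≤ 1 / 2 := one_div_le_one_div_of_le two_pos htR
  refine ⟨1, one_pos, fun μ hμ hμ1 => ⟨μ ^ 2 / 5000 * (1 / t), by positivity,
    fun μ' hμ' hμμ' => ⟨μ ^ 2 / 5000, by positivity, fun ε hε hμε => ?_⟩⟩⟩
  obtain ⟨s₀, hs₀⟩ := exists_forall_card_supersetsCard_filter_le k (Fin 3) hε
  refine ⟨max s₀ 1, fun s hs => ⟨max (2 * s ^ 2) ⌈8 / μ⌉₊,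
    fun n hn _ E hE hiso hdeg hdense W hW => ?_⟩⟩
  have hs1 : 1 ≤ s := (le_max_right _ _).trans hs
  have hnμ : 8 ≤ μ * n := by
    have h1 : (8 / μ : ℝ) ≤ n :=
      (Nat.le_ceil _).trans (by exact_mod_cast (le_max_right _ _).trans hn)
    rw [div_le_iff₀ hμ] at h1
    linarith
  obtain ⟨𝒰, h𝒰, hgood, hcard⟩ := hs₀ s ((le_max_left _ _).trans hs) (α := Fin n)
    (by rw [Fintype.card_fin]; exact (le_max_left _ _).trans hn) W hW
    ![fun τ => linkNbhd E (univ.image τ),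
      fun τ => (linkNbhd E {τ ⟨0, by omega⟩})ᶜ.filter fun u => μ / 8 * n ≤
        ((linkNbhd E {u} ∩ (linkNbhd E {τ ⟨0, by omega⟩})ᶜ).card : ℝ),
      fun τ => linkNbhd E {τ ⟨1, by omega⟩} ∩ (linkNbhd E {τ ⟨0, by omega⟩})ᶜ]
  have htotal : {U : Finset (Fin n) | U.card = s ∧ W ⊆ U} = ↑(supersetsCard W s) := by
    ext U
    simp [mem_supersetsCard]
  rw [htotal, Set.ncard_coe_finset]
  refine hcard.trans ?_
  rw [← Set.ncard_coe_finset, Nat.cast_le]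
  refine Set.ncard_le_ncard (fun U hU => ?_) (Set.toFinite _)
  obtain ⟨rfl, hWU⟩ := mem_supersetsCard.1 (h𝒰 (mem_coe.1 hU))
  have hgood := hgood U (mem_coe.1 hU)
  rw [Fintype.card_fin] at hgood
  refine ⟨rfl, hWU, ?_⟩
  have key := inherits_of_forall_le_card_inter hk (one_div_pos.2 ht0) hc1 hμ hμ1 hμ' hε hμμ' hμε
    hnμ hE hiso hdeg (fun A hA => hdense A (by rwa [div_eq_mul_one_div, mul_comm])) hs1
    (hgood 0)
    (fun v hv => hgood 1 (fun _ => v) fun _ => hv)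
    (fun v hv u hu => by
      simpa using hgood 2 (fun j => if (j : ℕ) = 0 then v else u) fun j => by
        split_ifs <;> assumption)
  refine ⟨key.1, key.2.1, fun A hAU hA => key.2.2 A hAU ?_⟩
  rwa [div_eq_mul_one_div, mul_comm] at hA
end

section
/- Let k ≥ 3 and ℓ ∈ [k−1], and set t = ⌊k/(k−ℓ)⌋·(k−ℓ). There exists μ₀ > 0 such that for every μ ∈ (0, μ₀] there exists μ'₀ > 0 such that for every μ' ∈ (0, μ'₀] there exists ε₀ > 0 such that for every ε ∈ (0, ε₀] there exists n₀ such that the following holds for every n ≥ n₀ divisible by k−ℓ. If G is an n-vertex k-graph with no isolated vertices and δ*(G) ≥ (1 − 1/t − ε)·n such that every set of at least n/t vertices contains at least μn² supported pairs, then for every vertex v ∈ V(G), either d¹(v) ≥ (1 − 1/t + μ')·n, or the set V(G) ∖ N¹(v) contains at least μ'n² supported pairs. -/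
open Finset

/-- The vertex neighbourhood `N¹(v)`: all vertices `u ≠ v` with `{v,u}` supported. -/
def vertexNbhd {n : ℕ} (E : Finset (Finset (Fin n))) (v : Fin n) : Finset (Fin n) :=
  Finset.univ.filter fun u => u ≠ v ∧ ∃ e ∈ E, ({v, u} : Finset (Fin n)) ⊆ e

/-- Enlarging a vertex set by `m` vertices creates at most `m * n` new supported pairs. -/
theorem suppPairs_le_add_card_sdiff_mul {n : ℕ} (E : Finset (Finset (Fin n)))
    (A B : Finset (Fin n)) : suppPairs E B ≤ suppPairs E A + (B \ A).card * n := by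
  classical
  have hsub : ((B.powersetCard 2).filter fun p => ∃ e ∈ E, p ⊆ e) ⊆
      ((A.powersetCard 2).filter fun p => ∃ e ∈ E, p ⊆ e) ∪
        ((B \ A) ×ˢ (univ : Finset (Fin n))).image fun q => {q.1, q.2} := by
    intro p hp
    obtain ⟨hpB, hpE⟩ := mem_filter.1 hp
    obtain ⟨hpB, hcard⟩ := mem_powersetCard.1 hpB
    by_cases hpA : p ⊆ A
    · exact mem_union_left _ (mem_filter.2 ⟨mem_powersetCard.2 ⟨hpA, hcard⟩, hpE⟩)
    · obtain ⟨x, hxp, hxA⟩ := not_subset.1 hpA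
      obtain ⟨y, -, rfl⟩ : ∃ y, y ≠ x ∧ p = {x, y} := by
        obtain ⟨a, b, hab, rfl⟩ := card_eq_two.1 hcard
        rcases mem_insert.1 hxp with rfl | hx
        · exact ⟨b, hab.symm, rfl⟩
        · obtain rfl := mem_singleton.1 hx
          exact ⟨a, hab, pair_comm _ _⟩
      exact mem_union_right _ (mem_image.2 ⟨(x, y),
        mem_product.2 ⟨mem_sdiff.2 ⟨hpB hxp, hxA⟩, mem_univ y⟩, rfl⟩)
  calc suppPairs E B ≤ _ := card_le_card hsub
    _ ≤ _ := card_union_le _ _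
    _ ≤ suppPairs E A + (B \ A).card * n := by
      refine Nat.add_le_add_left (card_image_le.trans ?_) _
      rw [card_product, card_univ, Fintype.card_fin]

/-- In a non-extremal hypergraph, every vertex `v` either has vertex co-degree
at least `(1 - 1/t + μ')n`, or `V(G) \ N¹(v)` contains at least `μ'n²`
supported pairs. -/
theorem nonextremal_vertex_alternative
    (k l t : ℕ) (hk : 3 ≤ k) (hl : 1 ≤ l) (hlk : l ≤ k - 1)
    (ht : t = k / (k - l) * (k - l)) :
    ∃ μ₀ : ℝ, 0 < μ₀ ∧ ∀ μ : ℝ, 0 < μ → μ ≤ μ₀ →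
    ∃ μ'₀ : ℝ, 0 < μ'₀ ∧ ∀ μ' : ℝ, 0 < μ' → μ' ≤ μ'₀ →
    ∃ ε₀ : ℝ, 0 < ε₀ ∧ ∀ ε : ℝ, 0 < ε → ε ≤ ε₀ →
    ∃ n₀ : ℕ, ∀ n : ℕ, n₀ ≤ n → (k - l) ∣ n →
    ∀ E : Finset (Finset (Fin n)),
      (∀ e ∈ E, e.card = k) →
      (∀ v : Fin n, ∃ e ∈ E, v ∈ e) →
      (∀ S : Finset (Fin n), S.card = k - 1 → (∃ e ∈ E, S ⊆ e) →
        (1 - 1 / (t : ℝ) - ε) * (n : ℝ) ≤ ((E.filter fun e => S ⊆ e).card : ℝ)) →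
      (∀ A : Finset (Fin n), (n : ℝ) / (t : ℝ) ≤ (A.card : ℝ) →
        μ * (n : ℝ) ^ 2 ≤ (suppPairs E A : ℝ)) →
      ∀ v : Fin n,
        (1 - 1 / (t : ℝ) + μ') * (n : ℝ) ≤ ((vertexNbhd E v).card : ℝ) ∨
        μ' * (n : ℝ) ^ 2 ≤ (suppPairs E (Finset.univ \ vertexNbhd E v) : ℝ) := by
  classical
  have ht1 : 1 ≤ t := by
    rw [ht]
    exact Nat.mul_pos (Nat.div_pos (Nat.sub_le k l) (by omega)) (by omega)
  have ht1' : (1 : ℝ) ≤ t := by exact_mod_cast ht1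
  refine ⟨1, one_pos, fun μ hμ _ => ⟨μ / 4, by positivity, fun μ' hμ' hμ'μ =>
    ⟨1, one_pos, fun ε _ _ => ⟨⌈2 / μ⌉₊, fun n hn _ E _ _ _ hA v => ?_⟩⟩⟩⟩
  have hnμ : 2 ≤ n * μ := (div_le_iff₀ hμ).1 ((Nat.le_ceil _).trans (by exact_mod_cast hn))
  have hn0 : (0 : ℝ) ≤ n := n.cast_nonneg
  refine or_iff_not_imp_left.2 fun hdeg => ?_
  rw [not_le] at hdeg
  set A : Finset (Fin n) := univ \ vertexNbhd E v with hAdef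
  have hAcard : (A.card : ℝ) + (vertexNbhd E v).card = n := by
    have h := card_sdiff_add_card_eq_card (subset_univ (vertexNbhd E v))
    rw [card_univ, Fintype.card_fin] at h
    exact_mod_cast h
  have hdiv : (1 - 1 / (t : ℝ) + μ') * n = n - n / t + μ' * n := by ring
  rcases le_total ((n : ℝ) / t) A.card with hle | hlt
  · refine le_trans ?_ (hA A hle)
    gcongr
    linarith
  · have hceil : ⌈(n : ℝ) / t⌉₊ ≤ Fintype.card (Fin n) := by
      rw [Fintype.card_fin]
      exact Nat.ceil_le.2 (div_le_self hn0 ht1')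
    have hAceil : A.card ≤ ⌈(n : ℝ) / t⌉₊ := by
      exact_mod_cast hlt.trans (Nat.le_ceil _)
    obtain ⟨B, hAB, hBcard⟩ := exists_superset_card_eq hAceil hceil
    have hB : μ * (n : ℝ) ^ 2 ≤ suppPairs E B :=
      hA B (by rw [hBcard]; exact Nat.le_ceil _)
    have hBA : ((B \ A).card : ℝ) ≤ μ' * n + 1 := by
      have h : ((B \ A).card : ℝ) + A.card = ⌈(n : ℝ) / t⌉₊ := by
        rw [← hBcard]
        exact_mod_cast card_sdiff_add_card_eq_card hAB
      have := Nat.ceil_lt_add_one (div_nonneg hn0 (zero_le_one.trans ht1'))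
      linarith
    have hle : (suppPairs E B : ℝ) ≤ suppPairs E A + (B \ A).card * n := by
      exact_mod_cast suppPairs_le_add_card_sdiff_mul E A B
    have h₁ := mul_le_mul_of_nonneg_right hBA hn0
    have h₂ := mul_le_mul_of_nonneg_right hnμ hn0
    have h₃ := mul_le_mul_of_nonneg_right hμ'μ (sq_nonneg (n : ℝ))
    linarith
end

section
/- Let k ≥ 3 and ℓ ∈ [k−1], and set t = ⌊k/(k−ℓ)⌋·(k−ℓ). There exists μ₀ > 0 such that for every μ ∈ (0, μ₀] there exists μ'₀ > 0 such that for every μ' ∈ (0, μ'₀] there exists ε₀ > 0 such that for every ε ∈ (0, ε₀] there exists n₀ such that the following holds for every n ≥ n₀. Let G be an n-vertex k-graph with no isolated vertices and δ*(G) ≥ (1 − 1/t − ε)·n. Suppose that for every vertex v ∈ V(G), either d¹(v) ≥ (1 − 1/t + 3μ't)·n, or V(G) ∖ N¹(v) contains at least μn² supported pairs. Then every set of ⌊n/t⌋ vertices in G contains at least μ'n² supported pairs. -/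
open Finset

/-- Double counting: the degrees inside `A` sum to at most twice the number of supported pairs. -/
theorem sum_card_vertexNbhd_inter_le {n : ℕ} (E : Finset (Finset (Fin n))) (A : Finset (Fin n)) :
    ∑ v ∈ A, (vertexNbhd E v ∩ A).card ≤ 2 * suppPairs E A := by
  set P := (A.powersetCard 2).filter fun p => ∃ e ∈ E, p ⊆ e with hP
  have hdeg : ∀ v ∈ A, (vertexNbhd E v ∩ A).card ≤ (P.filter fun p => v ∈ p).card := by
    intro v hv
    refine Finset.card_le_card_of_injOn (fun u => ({v, u} : Finset (Fin n))) ?_ ?_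
    · intro u hu
      simp only [vertexNbhd, Finset.coe_inter, Finset.coe_filter, Finset.mem_univ, true_and,
        Set.mem_inter_iff, Set.mem_ofPred_eq, Finset.mem_coe] at hu
      obtain ⟨⟨huv, he⟩, huA⟩ := hu
      simp only [hP, Finset.coe_filter, Set.mem_ofPred_eq, Finset.mem_filter,
        Finset.mem_powersetCard]
      refine ⟨⟨⟨?_, Finset.card_pair huv.symm⟩, he⟩, by simp⟩
      intro x hx
      simp only [Finset.mem_insert, Finset.mem_singleton] at hx
      rcases hx with rfl | rfl <;> assumption
    · intro u hu w hw h
      have huv : u ≠ v := by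
        have := (Finset.mem_inter.1 (Finset.mem_coe.1 hu)).1
        simp only [vertexNbhd, Finset.mem_filter] at this
        exact this.2.1
      have hmem : u ∈ ({v, w} : Finset (Fin n)) := by
        have h' : ({v, u} : Finset (Fin n)) = {v, w} := h
        rw [← h']
        simp
      simpa [huv] using hmem
  calc ∑ v ∈ A, (vertexNbhd E v ∩ A).card
      ≤ ∑ v ∈ A, (P.filter fun p => v ∈ p).card := Finset.sum_le_sum hdeg
    _ = ∑ p ∈ P, (A.filter fun v => v ∈ p).card :=
        Finset.sum_card_bipartiteAbove_eq_sum_card_bipartiteBelow (fun v p => v ∈ p)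
    _ ≤ ∑ _p ∈ P, 2 := by
        refine Finset.sum_le_sum fun p hp => ?_
        have hp2 : p.card = 2 := (Finset.mem_powersetCard.1 (Finset.mem_filter.1 hp).1).2
        rw [← hp2]
        exact Finset.card_le_card fun x hx => (Finset.mem_filter.1 hx).2
    _ = 2 * suppPairs E A := by
        rw [Finset.sum_const, smul_eq_mul, mul_comm]
        rfl

/-- The edges through a set `S` of size one less than the uniformity correspond to distinct
neighbours of any `v ∈ S`. -/
theorem card_filter_subset_le_card_vertexNbhd {n k : ℕ} (E : Finset (Finset (Fin n)))
    (hE : ∀ e ∈ E, e.card = k) {S : Finset (Fin n)} (hS : S.card + 1 = k) {v : Fin n}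
    (hv : v ∈ S) : (E.filter fun e => S ⊆ e).card ≤ (vertexNbhd E v).card := by
  have hsub : (E.filter fun e => S ⊆ e) ⊆ (vertexNbhd E v).image fun u => insert u S := by
    intro e he
    obtain ⟨heE, hSe⟩ := Finset.mem_filter.1 he
    obtain ⟨u, hu⟩ := Finset.card_eq_one.1
      (show (e \ S).card = 1 by rw [Finset.card_sdiff_of_subset hSe, hE e heE]; omega)
    have hue : u ∈ e \ S := by simp [hu]
    obtain ⟨hue, huS⟩ := Finset.mem_sdiff.1 hue
    refine Finset.mem_image.2 ⟨u, ?_, ?_⟩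
    · simp only [vertexNbhd, Finset.mem_filter, Finset.mem_univ, true_and]
      refine ⟨fun h => huS (h ▸ hv), e, heE, ?_⟩
      intro x hx
      simp only [Finset.mem_insert, Finset.mem_singleton] at hx
      rcases hx with rfl | rfl
      · exact hSe hv
      · exact hue
    · rw [Finset.insert_eq, ← hu, Finset.sdiff_union_of_subset hSe]
  exact (Finset.card_le_card hsub).trans Finset.card_image_le

/-- In a graph with no isolated vertices the supported co-degree bounds every vertex degree. -/
theorem le_card_vertexNbhd {n k : ℕ} (hk : 2 ≤ k) (E : Finset (Finset (Fin n)))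
    (hE : ∀ e ∈ E, e.card = k) (hiso : ∀ v : Fin n, ∃ e ∈ E, v ∈ e) {d : ℝ}
    (hd : ∀ S : Finset (Fin n), S.card = k - 1 → (∃ e ∈ E, S ⊆ e) →
      d ≤ ((E.filter fun e => S ⊆ e).card : ℝ)) (v : Fin n) :
    d ≤ ((vertexNbhd E v).card : ℝ) := by
  obtain ⟨e, he, hve⟩ := hiso v
  obtain ⟨S, hvS, hSe, hS⟩ := Finset.exists_subsuperset_card_eq (s := {v}) (t := e) (n := k - 1)
    (by simpa using hve) (by simp; omega) (by rw [hE e he]; omega)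
  refine (hd S hS ⟨e, he, hSe⟩).trans ?_
  exact_mod_cast card_filter_subset_le_card_vertexNbhd E hE (by omega)
    (hvS (Finset.mem_singleton_self v))

/-- If every vertex `v` either has vertex co-degree at least `(1 - 1/t + 3μ't)n`
or `V(G) \ N¹(v)` contains at least `μn²` supported pairs, then every set of
`⌊n/t⌋` vertices contains at least `μ'n²` supported pairs. -/
theorem vertex_alternative_implies_nonextremal
    (k l t : ℕ) (hk : 3 ≤ k) (hl : 1 ≤ l) (hlk : l ≤ k - 1)
    (ht : t = k / (k - l) * (k - l)) :
    ∃ μ₀ : ℝ, 0 < μ₀ ∧ ∀ μ : ℝ, 0 < μ → μ ≤ μ₀ →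
    ∃ μ'₀ : ℝ, 0 < μ'₀ ∧ ∀ μ' : ℝ, 0 < μ' → μ' ≤ μ'₀ →
    ∃ ε₀ : ℝ, 0 < ε₀ ∧ ∀ ε : ℝ, 0 < ε → ε ≤ ε₀ →
    ∃ n₀ : ℕ, ∀ n : ℕ, n₀ ≤ n →
    ∀ E : Finset (Finset (Fin n)),
      (∀ e ∈ E, e.card = k) →
      (∀ v : Fin n, ∃ e ∈ E, v ∈ e) →
      (∀ S : Finset (Fin n), S.card = k - 1 → (∃ e ∈ E, S ⊆ e) →
        (1 - 1 / (t : ℝ) - ε) * (n : ℝ) ≤ ((E.filter fun e => S ⊆ e).card : ℝ)) →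
      (∀ v : Fin n,
        (1 - 1 / (t : ℝ) + 3 * μ' * (t : ℝ)) * (n : ℝ) ≤ ((vertexNbhd E v).card : ℝ) ∨
        μ * (n : ℝ) ^ 2 ≤ (suppPairs E (Finset.univ \ vertexNbhd E v) : ℝ)) →
      ∀ A : Finset (Fin n), A.card = n / t →
        μ' * (n : ℝ) ^ 2 ≤ (suppPairs E A : ℝ) := by
  have htpos : 0 < t := by
    rw [ht]
    exact Nat.mul_pos (Nat.div_pos (Nat.sub_le k l) (by omega)) (by omega)
  clear ht
  have htR : (0 : ℝ) < t := by exact_mod_cast htpos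
  refine ⟨1, one_pos, fun μ hμ _ => ⟨μ / (3 * t + 2), by positivity, fun μ' hμ' hμ'le =>
    ⟨μ', hμ', fun ε hε hεle => ⟨max (5 * t) ⌈2 / (μ' * t)⌉₊, ?_⟩⟩⟩⟩
  intro n hn E hE hiso hcodeg halt A hA
  rw [le_div_iff₀ (by positivity)] at hμ'le
  have hn5 : 5 * (t : ℝ) ≤ n := by exact_mod_cast (le_max_left _ _).trans hn
  have hn2 : 2 ≤ μ' * t * n := by
    have h : 2 / (μ' * t) ≤ n :=
      (Nat.le_ceil _).trans (by exact_mod_cast (le_max_right _ _).trans hn)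
    rwa [div_le_iff₀' (by positivity)] at h
  have hnpos : (0 : ℝ) < n := by linarith
  have hAt : (n : ℝ) < t * A.card + t := by
    rw [hA]
    have := Nat.lt_mul_div_succ n htpos
    rw [mul_add, mul_one] at this
    exact_mod_cast this
  have hA1 : (1 / t : ℝ) * n - 1 < A.card := by
    rw [one_div_mul_eq_div, sub_lt_iff_lt_add, div_lt_iff₀ htR]
    linarith
  have hA45 : 4 * (n : ℝ) ≤ 5 * t * A.card := by linarith
  have hApos : (0 : ℝ) < A.card := by
    by_contra h
    nlinarith
  by_contra! hlt
  obtain ⟨v, -, hv⟩ : ∃ v ∈ A,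
      ((vertexNbhd E v ∩ A).card : ℝ) * (2 * A.card) < 5 * μ' * t * n * A.card := by
    by_contra! hall
    have hsum := Finset.sum_le_sum hall
    rw [Finset.sum_const, nsmul_eq_mul, ← Finset.sum_mul] at hsum
    have hdc : ∑ v ∈ A, ((vertexNbhd E v ∩ A).card : ℝ) ≤ 2 * suppPairs E A := by
      exact_mod_cast sum_card_vertexNbhd_inter_le E A
    have h1 : 5 * μ' * t * n * A.card ≤
        2 * ∑ v ∈ A, ((vertexNbhd E v ∩ A).card : ℝ) := by
      refine le_of_mul_le_mul_right ?_ hApos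
      linarith
    have h2 : μ' * n * (4 * n) ≤ μ' * n * (5 * t * A.card) :=
      mul_le_mul_of_nonneg_left hA45 (by positivity)
    nlinarith
  have hd : ((vertexNbhd E v ∩ A).card : ℝ) < 5 / 2 * μ' * t * n := by
    refine lt_of_mul_lt_mul_right (a := 2 * (A.card : ℝ)) ?_ (by positivity)
    linarith
  have hNA : ((vertexNbhd E v).card : ℝ) + A.card ≤ n + (vertexNbhd E v ∩ A).card := by
    have h := Finset.card_union_add_card_inter (vertexNbhd E v) A
    have h' := Finset.card_le_univ (vertexNbhd E v ∪ A)
    rw [Fintype.card_fin] at h'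
    exact_mod_cast (by omega : _ + _ ≤ _ + _)
  rcases halt v with hdeg | hpairs
  · linarith
  · have hmin := le_card_vertexNbhd (by omega) E hE hiso hcodeg v
    have hout : (((Finset.univ \ vertexNbhd E v) \ A).card : ℝ) + (vertexNbhd E v).card + A.card
        = n + (vertexNbhd E v ∩ A).card := by
      have h := Finset.card_union_add_card_inter (vertexNbhd E v) A
      have h' := Finset.card_sdiff_add_card_eq_card (Finset.subset_univ (vertexNbhd E v ∪ A))
      rw [Finset.card_univ, Fintype.card_fin] at h'
      rw [sdiff_sdiff_left]
      exact_mod_cast (by simp only [Finset.sup_eq_union]; omega :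
        (Finset.univ \ (vertexNbhd E v ⊔ A)).card + (vertexNbhd E v).card + A.card
          = n + (vertexNbhd E v ∩ A).card)
    have hεn : ε * n ≤ μ' * n := by gcongr
    have hsmall : (((Finset.univ \ vertexNbhd E v) \ A).card : ℝ) ≤ (1 + 3 * t) * μ' * n := by
      linarith
    have hsplit : (suppPairs E (Finset.univ \ vertexNbhd E v) : ℝ) ≤
        suppPairs E A + ((Finset.univ \ vertexNbhd E v) \ A).card * n := by
      exact_mod_cast suppPairs_le_add_card_sdiff_mul E A (Finset.univ \ vertexNbhd E v)
    have h1 := mul_le_mul_of_nonneg_right hsmall hnpos.le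
    have h2 := mul_le_mul_of_nonneg_right hμ'le (sq_nonneg (n : ℝ))
    nlinarith
end
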